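/- Let 0 < α ≤ 1 and 1 ≤ r ≤ ∞ with conjugate exponent r′, and let (q,p) satisfy 2/q + 1/p = 1/r together with one of the following: (1) 4 ≤ q ≤ ∞ and 4 < p ≤ ∞; (2) 1/4 ≤ 1/p and 1/p + 1/q < 1/2; (3) (q,p) = (∞,2). Then there exists a constant C > 0 (depending only on α, r, q, p) such that for every Schwartz function φ on ℝ one has ‖ |∂_x|^{α/q} W_α(t)φ ‖_{L^q_t L^p_x(ℝ×ℝ)} ≤ C ‖φ̂‖_{L^{r′}(ℝ)}, where |∂_x|^{α/q} is the Fourier multiplier with symbol |ξ|^{α/q}. -/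

import Mathlib

open MeasureTheory ENNReal Complex

/-- Dispersion relation of the dispersion generalized Benjamin–Ono equation. -/
noncomputable def omegaBO (α ξ : ℝ) : ℝ := -ξ * |ξ| ^ (1 + α)

/-- Spatial Fourier transform φ̂(ξ) = ∫ e^{-ixξ} φ(x) dx. -/
noncomputable def ft1 (φ : ℝ → ℂ) (ξ : ℝ) : ℂ :=
  ∫ x : ℝ, Complex.exp (-Complex.I * ((x * ξ : ℝ) : ℂ)) * φ x

/-- The free propagator W_α(t)φ(x) = (2π)⁻¹ ∫ e^{i(xξ + tω(ξ))} φ̂(ξ) dξ. -/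
noncomputable def Wprop (α : ℝ) (φ : ℝ → ℂ) (t x : ℝ) : ℂ :=
  ((2 * Real.pi)⁻¹ : ℝ) *
    ∫ ξ : ℝ, Complex.exp (Complex.I * ((x * ξ + t * omegaBO α ξ : ℝ) : ℂ)) * ft1 φ ξ

/-- Space–time Fourier transform û(ξ,τ) of u(t,x). -/
noncomputable def ft2 (u : ℝ × ℝ → ℂ) (ξ τ : ℝ) : ℂ :=
  ∫ p : ℝ × ℝ, Complex.exp (-Complex.I * ((p.1 * τ + p.2 * ξ : ℝ) : ℂ)) * u p

/-- The Japanese bracket ⟨ξ⟩ = (1+ξ²)^{1/2}. -/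
noncomputable def jap (ξ : ℝ) : ℝ := (1 + ξ ^ 2) ^ ((1 : ℝ) / 2)

/-- The Bourgain norm ‖u‖_{X̂^{s,b}_ρ} adapted to Fourier–Lebesgue spaces;
`ρd` is the dual exponent ρ′. -/
noncomputable def Xnorm (α s b : ℝ) (ρd : ℝ≥0∞) (u : ℝ × ℝ → ℂ) : ℝ≥0∞ :=
  eLpNorm (fun q : ℝ × ℝ =>
    jap q.1 ^ s * jap (q.2 - omegaBO α q.1) ^ b * ‖ft2 u q.1 q.2‖) ρd volume

/-- The Fourier–Lebesgue norm ‖φ‖_{Ĥ^s_r}; `ρd` is the dual exponent r′. -/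
noncomputable def FLnorm (s : ℝ) (ρd : ℝ≥0∞) (φ : ℝ → ℂ) : ℝ≥0∞ :=
  eLpNorm (fun ξ : ℝ => jap ξ ^ s * ‖ft1 φ ξ‖) ρd volume

/-- Mixed norm ‖F‖_{L^q_t L^p_x}. -/
noncomputable def mixedNorm (q p : ℝ≥0∞) (F : ℝ → ℝ → ℂ) : ℝ≥0∞ :=
  eLpNorm (fun t : ℝ => (eLpNorm (F t) p volume).toReal) q volume

/-- |∂_x|^θ W_α(t)φ, the propagator with the extra multiplier |ξ|^θ. -/
noncomputable def WpropD (α θ : ℝ) (φ : ℝ → ℂ) (t x : ℝ) : ℂ :=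
  ((2 * Real.pi)⁻¹ : ℝ) *
    ∫ ξ : ℝ, ((|ξ| ^ θ : ℝ) : ℂ) *
      Complex.exp (Complex.I * ((x * ξ + t * omegaBO α ξ : ℝ) : ℂ)) * ft1 φ ξ

/-! ### Power integrals and the diagonal Hardy–Littlewood–Sobolev inequality -/

lemma bo_lintegral_abs (f : ℝ → ℝ≥0∞) :
    ∫⁻ x : ℝ, f |x| = 2 * ∫⁻ x in Set.Ioi (0:ℝ), f x := by
  have h1 : ∫⁻ x in Set.Ioi (0:ℝ), f |x| = ∫⁻ x in Set.Ioi (0:ℝ), f x :=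
    setLIntegral_congr_fun measurableSet_Ioi (fun x hx => by
      simp only [abs_of_pos (Set.mem_Ioi.1 hx)])
  have h2 : ∫⁻ x in Set.Iio (0:ℝ), f |x| = ∫⁻ x in Set.Ioi (0:ℝ), f x := by
    rw [← h1, ← lintegral_indicator measurableSet_Iio, ← lintegral_indicator measurableSet_Ioi,
      ← lintegral_neg_eq_self]
    congr 1; ext x
    by_cases hx : 0 < x
    · simp [Set.indicator, hx]
    · simp [Set.indicator, hx]
  rw [← lintegral_add_compl _ (measurableSet_Ioi (a := (0:ℝ))), h1]
  have h3 : ∫⁻ x in (Set.Ioi (0:ℝ))ᶜ, f |x| = ∫⁻ x in Set.Iio (0:ℝ), f |x| := by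
    rw [Set.compl_Ioi]
    exact setLIntegral_congr Iio_ae_eq_Iic.symm
  rw [h3, h2, two_mul]

lemma bo_near (κ : ℝ) (h0 : 0 < κ) (h1 : κ < 1) (R : ℝ) (hR : 0 < R) :
    ∫⁻ z in {z : ℝ | |z| < R}, (ENNReal.ofReal |z|) ^ (-κ)
      ≤ ENNReal.ofReal (2 / (1 - κ)) * ENNReal.ofReal (R ^ (1 - κ)) := by
  have hm : MeasurableSet {z : ℝ | |z| < R} := measurableSet_lt measurable_abs measurable_const
  rw [← lintegral_indicator hm]
  have : (Set.indicator {z : ℝ | |z| < R} fun z => (ENNReal.ofReal |z|) ^ (-κ))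
      = fun z => (fun w => Set.indicator (Set.Iio R) (fun w => (ENNReal.ofReal w) ^ (-κ)) w) |z| := by
    ext z; simp [Set.indicator]
  rw [this, bo_lintegral_abs, ← lintegral_indicator measurableSet_Ioi]
  have h2 : (Set.indicator (Set.Ioi (0:ℝ)) fun w => Set.indicator (Set.Iio R) (fun w => (ENNReal.ofReal w) ^ (-κ)) w)
     = Set.indicator (Set.Ioo 0 R) (fun w => ENNReal.ofReal (w ^ (-κ))) := by
    ext w
    by_cases hw : 0 < w
    · by_cases hw2 : w < R
      · simp [Set.indicator, hw, hw2, ENNReal.ofReal_rpow_of_pos hw]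
      · simp [Set.indicator, hw, hw2]
    · simp [Set.indicator, hw]
  rw [h2, lintegral_indicator measurableSet_Ioo]
  have h3 : ∫⁻ w in Set.Ioo 0 R, ENNReal.ofReal (w ^ (-κ)) = ENNReal.ofReal (R ^ (1-κ) / (1-κ)) := by
    rw [← ofReal_integral_eq_lintegral_ofReal, ← integral_Ioc_eq_integral_Ioo,
      ← intervalIntegral.integral_of_le hR.le, integral_rpow (Or.inl (by linarith))]
    · congr 1
      rw [show -κ + 1 = 1 - κ by ring, Real.zero_rpow (by linarith)]; ring
    · have := (intervalIntegral.intervalIntegrable_rpow' (a := 0) (b := R) (r := -κ) (by linarith)).1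
      exact this.mono_set Set.Ioo_subset_Ioc_self
    · filter_upwards [self_mem_ae_restrict measurableSet_Ioo] with w hw
      exact Real.rpow_nonneg hw.1.le _
  rw [h3, ← ENNReal.ofReal_mul (by apply div_nonneg <;> linarith), ← ENNReal.ofReal_ofNat 2,
    ← ENNReal.ofReal_mul (by norm_num)]
  apply le_of_eq; congr 1; ring

lemma bo_far (R : ℝ) (hR : 0 < R) :
    ∫⁻ z in {z : ℝ | R ≤ |z|}, (ENNReal.ofReal |z|) ^ (-2:ℝ)
      ≤ ENNReal.ofReal (2 * R⁻¹) := by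
  have hm : MeasurableSet {z : ℝ | R ≤ |z|} := measurableSet_le measurable_const measurable_abs
  rw [← lintegral_indicator hm]
  have : (Set.indicator {z : ℝ | R ≤ |z|} fun z => (ENNReal.ofReal |z|) ^ (-2:ℝ))
      = fun z => (fun w => Set.indicator (Set.Ici R) (fun w => (ENNReal.ofReal w) ^ (-2:ℝ)) w) |z| := by
    ext z; simp [Set.indicator]
  rw [this, bo_lintegral_abs, ← lintegral_indicator measurableSet_Ioi]
  have h2 : (Set.indicator (Set.Ioi (0:ℝ)) fun w => Set.indicator (Set.Ici R) (fun w => (ENNReal.ofReal w) ^ (-2:ℝ)) w)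
     = Set.indicator (Set.Ici R) (fun w => ENNReal.ofReal (w ^ (-2:ℝ))) := by
    ext w
    by_cases hw2 : R ≤ w
    · have hw : 0 < w := by linarith
      rw [Set.indicator_of_mem (show w ∈ Set.Ioi (0:ℝ) from hw), Set.indicator_of_mem (show w ∈ Set.Ici R from hw2),
       Set.indicator_of_mem (show w ∈ Set.Ici R from hw2), ENNReal.ofReal_rpow_of_pos hw]
    · simp [Set.indicator, hw2]
  rw [h2, lintegral_indicator measurableSet_Ici, setLIntegral_congr Ioi_ae_eq_Ici.symm]
  have h3 : ∫⁻ w in Set.Ioi R, ENNReal.ofReal (w ^ (-2:ℝ)) = ENNReal.ofReal (R⁻¹) := by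
    rw [← ofReal_integral_eq_lintegral_ofReal, integral_Ioi_rpow_of_lt (by norm_num) hR]
    · congr 1
      norm_num [Real.rpow_neg_one]
    · exact integrableOn_Ioi_rpow_of_lt (by norm_num) hR
    · filter_upwards [self_mem_ae_restrict measurableSet_Ioi] with w hw
      exact Real.rpow_nonneg (hR.le.trans (le_of_lt hw)) _
  rw [h3, ENNReal.ofReal_mul (by norm_num)]
  simp

/-- Inner estimate in the HLS inequality. -/
lemma bo_hls_inner (κ : ℝ) (h0 : 0 < κ) (h1 : κ < 1) (F : ℝ → ℝ≥0∞) (hF : Measurable F)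
    (x : ℝ) (R : ℝ) (hR : 0 < R) (A M : ℝ≥0∞) (hA : ∫⁻ y, F y ^ (2 / (2 - κ)) = A) :
    ∫⁻ y in {y | F y ≤ M}, F y * (ENNReal.ofReal |x - y|) ^ (-κ)
     ≤ M * (ENNReal.ofReal (2 / (1 - κ)) * ENNReal.ofReal (R ^ (1 - κ)))
        + A ^ ((2 - κ) / 2) * (ENNReal.ofReal (2 * R⁻¹)) ^ (κ / 2) := by
  have hM : MeasurableSet {y | F y ≤ M} := measurableSet_le hF measurable_const
  have hS : MeasurableSet {y : ℝ | |x - y| < R} := measurableSet_lt (by fun_prop) measurable_const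
  have hS' : MeasurableSet {y : ℝ | R ≤ |x - y|} := measurableSet_le measurable_const (by fun_prop)
  have hk : Measurable fun y : ℝ => (ENNReal.ofReal |x - y|) ^ (-κ) := by fun_prop
  have hsub : ∫⁻ y in {y | F y ≤ M}, F y * (ENNReal.ofReal |x - y|) ^ (-κ)
     ≤ (∫⁻ y in {y : ℝ | |x - y| < R}, M * (ENNReal.ofReal |x - y|) ^ (-κ))
      + ∫⁻ y in {y : ℝ | R ≤ |x - y|}, F y * (ENNReal.ofReal |x - y|) ^ (-κ) := by
    rw [← lintegral_indicator hM, ← lintegral_indicator hS, ← lintegral_indicator hS',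
      ← lintegral_add_left (by exact (measurable_const.mul hk).indicator hS)]
    apply lintegral_mono
    intro y
    simp only [Set.indicator, Set.mem_ofPred_eq]
    by_cases hy : F y ≤ M
    · by_cases hy2 : |x - y| < R
      · simp only [hy, hy2, if_true, not_le.2 hy2, if_false, add_zero]
        gcongr
      · simp only [hy, hy2, if_true, not_lt.1 hy2, if_false, zero_add, le_refl]
    · simp [hy]
  refine hsub.trans (add_le_add ?_ ?_)
  · rw [lintegral_const_mul _ hk]
    gcongr
    have := bo_near κ h0 h1 R hR
    have hm : MeasurableSet {z : ℝ | |z| < R} := measurableSet_lt measurable_abs measurable_const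
    rw [← lintegral_indicator hm, ← lintegral_sub_left_eq_self _ x] at this
    rw [← lintegral_indicator hS]
    exact this
  · have hpq : (2 / (2 - κ)).HolderConjugate (2 / κ) := by
      rw [Real.holderConjugate_iff]
      refine ⟨?_, ?_⟩
      · rw [lt_div_iff₀] <;> linarith
      · have : (2 - κ) ≠ 0 := by linarith
        field_simp; ring
    refine (ENNReal.lintegral_mul_le_Lp_mul_Lq (volume.restrict {y : ℝ | R ≤ |x - y|}) hpq
      hF.aemeasurable hk.aemeasurable).trans ?_
    rw [one_div_div, one_div_div]
    have hk2 : 0 ≤ (2 - κ) / 2 := by linarith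
    refine mul_le_mul' (ENNReal.rpow_le_rpow ?_ hk2) (ENNReal.rpow_le_rpow ?_ (by linarith))
    · rw [← hA]; exact setLIntegral_le_lintegral _ _
    · have := bo_far R hR
      have hm : MeasurableSet {z : ℝ | R ≤ |z|} := measurableSet_le measurable_const measurable_abs
      rw [← lintegral_indicator hm, ← lintegral_sub_left_eq_self _ x] at this
      rw [← lintegral_indicator hS']
      refine le_trans (le_of_eq ?_) this
      congr 1; ext y
      simp only [Set.indicator, Set.mem_ofPred_eq]
      rw [← ENNReal.rpow_mul, show -κ * (2 / κ) = -2 by field_simp]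

/-- Diagonal Hardy–Littlewood–Sobolev inequality in one dimension. -/
lemma bo_hls (κ : ℝ) (h0 : 0 < κ) (h1 : κ < 1) :
    ∃ C : ℝ≥0∞, C ≠ ⊤ ∧ ∀ F : ℝ → ℝ≥0∞, Measurable F →
      ∫⁻ x, ∫⁻ y, F x * F y * (ENNReal.ofReal |x - y|) ^ (-κ)
        ≤ C * (∫⁻ y, F y ^ (2 / (2 - κ))) ^ (2 - κ) := by
  set c1 : ℝ≥0∞ := ENNReal.ofReal (2 / (1 - κ)) with hc1
  set c2 : ℝ≥0∞ := (ENNReal.ofReal 2) ^ (κ/2) with hc2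
  have hc1t : c1 ≠ ⊤ := ENNReal.ofReal_ne_top
  have hc2t : c2 ≠ ⊤ := ENNReal.rpow_ne_top_of_nonneg (by linarith) ENNReal.ofReal_ne_top
  have hc10 : c1 ≠ 0 := by
    rw [hc1]; simp only [ne_eq, ENNReal.ofReal_eq_zero, not_le]; apply div_pos <;> linarith
  have hs0 : 0 < 2 / (2 - κ) := div_pos (by norm_num) (by linarith)
  clear_value c1 c2
  refine ⟨2 * (c1 + c2), by finiteness, fun F hF => ?_⟩
  set s := 2 / (2 - κ) with hs
  set A := ∫⁻ y, F y ^ s with hA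
  have hmk : Measurable fun z : ℝ × ℝ => F z.1 * F z.2 * (ENNReal.ofReal |z.1 - z.2|) ^ (-κ) := by
    fun_prop
  by_cases hAtop : A = ⊤
  · rw [hAtop, ENNReal.top_rpow_of_pos (by linarith), ENNReal.mul_top]
    · exact le_top
    · simp [hc10]
  by_cases hA0 : A = 0
  · have : F =ᵐ[volume] 0 := by
      rw [hA, lintegral_eq_zero_iff (by fun_prop)] at hA0
      filter_upwards [hA0] with y hy
      simpa [hs0, hs0.le, not_lt.2 hs0.le] using hy
    have h2 : ∫⁻ x, ∫⁻ y, F x * F y * (ENNReal.ofReal |x - y|) ^ (-κ) = 0 := by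
      rw [lintegral_eq_zero_iff (by fun_prop)]
      filter_upwards [this] with x hx
      simp [hx]
    rw [h2]; exact zero_le
  -- symmetrisation
  have hsym : ∫⁻ x, ∫⁻ y, F x * F y * (ENNReal.ofReal |x - y|) ^ (-κ)
      ≤ 2 * ∫⁻ x, F x * ∫⁻ y in {y | F y ≤ F x}, F y * (ENNReal.ofReal |x - y|) ^ (-κ) := by
    have e1 : ∀ x, F x * ∫⁻ y in {y | F y ≤ F x}, F y * (ENNReal.ofReal |x - y|) ^ (-κ)
        = ∫⁻ y, {z : ℝ × ℝ | F z.2 ≤ F z.1}.indicator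
          (fun z => F z.1 * F z.2 * (ENNReal.ofReal |z.1 - z.2|) ^ (-κ)) (x, y) := by
      intro x
      rw [← lintegral_const_mul _ (by fun_prop),
        ← lintegral_indicator (measurableSet_le hF measurable_const)]
      congr 1; ext y
      simp only [Set.indicator, Set.mem_ofPred_eq, mul_assoc]
    simp_rw [e1]
    have hms : MeasurableSet {z : ℝ × ℝ | F z.2 ≤ F z.1} :=
      measurableSet_le (by fun_prop) (by fun_prop)
    set G := {z : ℝ × ℝ | F z.2 ≤ F z.1}.indicator
          (fun z => F z.1 * F z.2 * (ENNReal.ofReal |z.1 - z.2|) ^ (-κ)) with hG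
    have hGm : Measurable G := hmk.indicator hms
    have e2 : ∫⁻ x, ∫⁻ y, G (x, y) = ∫⁻ x, ∫⁻ y, G (y, x) :=
      lintegral_lintegral_swap (f := fun x y => G (x, y)) (by exact hGm.aemeasurable)
    rw [two_mul]
    nth_rewrite 2 [e2]
    rw [← lintegral_add_left (by fun_prop)]
    apply lintegral_mono; intro x
    simp only
    rw [← lintegral_add_left (by fun_prop)]
    apply lintegral_mono; intro y
    simp only [hG, Set.indicator, Set.mem_ofPred_eq]
    rcases le_total (F y) (F x) with h | h
    · simp only [h, if_true]; exact le_self_add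
    · simp only [h, if_true]
      rw [mul_comm (F y) (F x), abs_sub_comm y x]; exact le_add_self
  refine hsym.trans ?_
  rw [mul_assoc]
  gcongr
  have hfin : ∀ᵐ x, F x < ⊤ := by
    have : ∀ᵐ x, F x ^ s < ⊤ := ae_lt_top (by fun_prop) hAtop
    filter_upwards [this] with x hx
    by_contra h
    rw [not_lt_top_iff] at h
    rw [h, ENNReal.top_rpow_of_pos hs0] at hx
    exact absurd hx (lt_irrefl _)
  have hpt : ∀ᵐ x, F x * ∫⁻ y in {y | F y ≤ F x}, F y * (ENNReal.ofReal |x - y|) ^ (-κ)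
      ≤ (c1 + c2) * A ^ (1 - κ) * F x ^ s := by
    filter_upwards [hfin] with x hx
    by_cases hx0 : F x = 0
    · simp [hx0]
    -- pass to reals
    obtain ⟨a, ha0, haA⟩ : ∃ a : ℝ, 0 < a ∧ A = ENNReal.ofReal a :=
      ⟨A.toReal, ENNReal.toReal_pos hA0 hAtop, (ENNReal.ofReal_toReal hAtop).symm⟩
    obtain ⟨b, hb0, hbF⟩ : ∃ b : ℝ, 0 < b ∧ F x = ENNReal.ofReal b :=
      ⟨(F x).toReal, ENNReal.toReal_pos hx0 hx.ne, (ENNReal.ofReal_toReal hx.ne).symm⟩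
    have hR : 0 < a / b ^ s := div_pos ha0 (Real.rpow_pos_of_pos hb0 _)
    refine (mul_le_mul_right (bo_hls_inner κ h0 h1 F hF x (a / b ^ s) hR A (F x) rfl) (F x)).trans ?_
    rw [mul_add, ← mul_assoc, ← hc1]
    have hk2 : 2 - κ ≠ 0 := by linarith
    have E1 : F x * F x * (c1 * ENNReal.ofReal ((a / b ^ s) ^ (1 - κ))) = c1 * A ^ (1-κ) * F x ^ s := by
      have e0 : F x * F x * (c1 * ENNReal.ofReal ((a / b ^ s) ^ (1 - κ)))
          = c1 * (F x * F x * ENNReal.ofReal ((a / b ^ s) ^ (1 - κ))) := by ring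
      rw [e0, mul_assoc c1, hbF, haA, ENNReal.ofReal_rpow_of_pos ha0, ENNReal.ofReal_rpow_of_pos hb0,
        ← ENNReal.ofReal_mul hb0.le, ← ENNReal.ofReal_mul (by positivity),
        ← ENNReal.ofReal_mul (by positivity)]
      congr 2
      rw [Real.div_rpow ha0.le (by positivity), ← Real.rpow_mul hb0.le]
      have hpos : b ^ (s * (1 - κ)) ≠ 0 := (Real.rpow_pos_of_pos hb0 _).ne'
      have : b ^ s = b * b / b ^ (s * (1 - κ)) := by
        rw [eq_div_iff hpos, ← Real.rpow_add hb0]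
        rw [show s + s * (1 - κ) = 2 by rw [hs]; field_simp; ring]
        norm_num; ring
      rw [this]; ring
    have E2 : F x * (A ^ ((2 - κ) / 2) * ENNReal.ofReal (2 * (a / b ^ s)⁻¹) ^ (κ / 2))
        = c2 * A ^ (1-κ) * F x ^ s := by
      rw [hbF, haA, hc2, ENNReal.ofReal_rpow_of_pos ha0, ENNReal.ofReal_rpow_of_pos hb0,
        ENNReal.ofReal_rpow_of_pos ha0, ENNReal.ofReal_rpow_of_pos (mul_pos two_pos (inv_pos.2 hR)),
        ENNReal.ofReal_rpow_of_pos two_pos,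
        ← ENNReal.ofReal_mul (by positivity), ← ENNReal.ofReal_mul (by positivity),
        ← ENNReal.ofReal_mul (by positivity), ← ENNReal.ofReal_mul (by positivity)]
      congr 1
      rw [Real.mul_rpow (by norm_num) (inv_pos.2 hR).le, inv_div, Real.div_rpow (by positivity) ha0.le,
        ← Real.rpow_mul hb0.le]
      have e1 : b ^ s = b * b ^ (s * (κ / 2)) := by
        nth_rewrite 2 [← Real.rpow_one b]
        rw [← Real.rpow_add hb0]
        congr 1
        rw [hs]; field_simp; ring
      have e2 : a ^ ((2 - κ) / 2) = a ^ (1 - κ) * a ^ (κ / 2) := by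
        rw [← Real.rpow_add ha0]; congr 1; ring
      rw [e1, e2]
      field_simp
    rw [E1, E2, add_mul, add_mul]
  calc _ ≤ ∫⁻ x, (c1 + c2) * A ^ (1 - κ) * F x ^ s := lintegral_mono_ae hpt
    _ = (c1 + c2) * A ^ (1 - κ) * A := by rw [lintegral_const_mul _ (by fun_prop)]
    _ = (c1 + c2) * A ^ (2 - κ) := by
      rw [mul_assoc]; congr 1
      nth_rewrite 2 [← ENNReal.rpow_one A]
      rw [← ENNReal.rpow_add _ _ hA0 hAtop]
      congr 1; ring

/-! ### Gaussian regularisation, Plancherel and Pitt inequalities -/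

/-- The Fourier integral with positive sign. -/
noncomputable def bft (h : ℝ → ℂ) (a : ℝ) : ℂ := ∫ x : ℝ, Complex.exp (Complex.I * ((x * a : ℝ) : ℂ)) * h x

lemma bo_norm_expI (r : ℝ) : ‖Complex.exp (Complex.I * (r : ℂ))‖ = 1 := by
  rw [mul_comm]; exact Complex.norm_exp_ofReal_mul_I r

lemma bo_enorm_expI (r : ℝ) : ‖Complex.exp (Complex.I * (r : ℂ))‖ₑ = 1 := by
  rw [← ofReal_norm, bo_norm_expI]; simp

lemma bft_measurable (h : ℝ → ℂ) (hm : Measurable h) : Measurable (bft h) := by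
  have : StronglyMeasurable (fun z : ℝ × ℝ => Complex.exp (Complex.I * ((z.2 * z.1 : ℝ) : ℂ)) * h z.2) := by
    apply Measurable.stronglyMeasurable; fun_prop
  exact this.integral_prod_right.measurable

lemma bo_conj_expI (r : ℝ) : (starRingEnd ℂ) (Complex.exp (Complex.I * (r : ℂ)))
    = Complex.exp (Complex.I * ((-r : ℝ) : ℂ)) := by
  rw [← Complex.exp_conj]; simp

lemma bft_sq (h : ℝ → ℂ) (a : ℝ) :
    ((‖bft h a‖ ^ 2 : ℝ) : ℂ) = ∫ z : ℝ × ℝ, Complex.exp (Complex.I * (((z.1 - z.2) * a : ℝ) : ℂ)) *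
      (h z.1 * (starRingEnd ℂ) (h z.2)) := by
  have : ((‖bft h a‖ ^ 2 : ℝ) : ℂ) = bft h a * (starRingEnd ℂ) (bft h a) := by
    rw [Complex.mul_conj, Complex.normSq_eq_norm_sq]
  rw [this]
  unfold bft
  rw [← integral_conj, ← integral_prod_mul]
  congr 1; ext z
  rw [map_mul, bo_conj_expI]
  have : Complex.exp (Complex.I * (((z.1 - z.2) * a : ℝ) : ℂ))
     = Complex.exp (Complex.I * ((z.1 * a : ℝ) : ℂ)) * Complex.exp (Complex.I * ((-(z.2 * a) : ℝ) : ℂ)) := by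
    rw [← Complex.exp_add]; congr 1; push_cast; ring
  rw [this]; ring

lemma bo_gauss_int (τ : ℝ) (hτ : 0 < τ) (d : ℝ) :
    ∫ a : ℝ, Complex.exp (Complex.I * ((d * a : ℝ) : ℂ)) * ((Real.exp (-τ * a ^ 2) : ℝ) : ℂ)
      = ((Real.sqrt (Real.pi / τ) * Real.exp (-d ^ 2 / (4 * τ)) : ℝ) : ℂ) := by
  have := fourierIntegral_gaussian (b := (τ : ℂ)) (by simpa using hτ) (d : ℂ)
  push_cast
  rw [Real.sqrt_eq_rpow, Complex.ofReal_cpow (by positivity)]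
  push_cast
  rw [← this]
  congr 1; ext a; rw [mul_assoc]

lemma bo_gauss_ft (h : ℝ → ℂ) (hi : Integrable h) (τ : ℝ) (hτ : 0 < τ) :
    ∫⁻ a : ℝ, ENNReal.ofReal (Real.exp (-τ * a ^ 2)) * ‖bft h a‖ₑ ^ 2
      ≤ ENNReal.ofReal (Real.sqrt (Real.pi / τ)) *
        ∫⁻ x, ∫⁻ y, ‖h x‖ₑ * ‖h y‖ₑ * ENNReal.ofReal (Real.exp (-(x - y) ^ 2 / (4 * τ))) := by
  have hg : Integrable (fun a : ℝ => ((Real.exp (-τ * a ^ 2) : ℝ) : ℂ)) := (integrable_exp_neg_mul_sq hτ).ofReal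
  have hh : Integrable (fun z : ℝ × ℝ => h z.1 * (starRingEnd ℂ) (h z.2)) (volume.prod volume) := by
    refine hi.mul_prod (g := fun y => (starRingEnd ℂ) (h y)) ?_
    exact (LinearIsometryEquiv.integrable_comp_iff (Complex.conjLIE)).2 hi
  -- triple integrable
  have hT : Integrable (fun w : ℝ × (ℝ × ℝ) => Complex.exp (Complex.I * (((w.2.1 - w.2.2) * w.1 : ℝ) : ℂ)) *
      (((Real.exp (-τ * w.1 ^ 2) : ℝ) : ℂ) * (h w.2.1 * (starRingEnd ℂ) (h w.2.2)))) (volume.prod (volume.prod volume)) := by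
    refine (hg.mul_prod hh).bdd_mul (c := 1) ?_ ?_
    · apply Continuous.aestronglyMeasurable; fun_prop
    · refine Filter.Eventually.of_forall fun w => ?_
      rw [bo_norm_expI]
  have e1 : ∀ a : ℝ, ((Real.exp (-τ * a ^ 2) * ‖bft h a‖ ^ 2 : ℝ) : ℂ) =
      ∫ z : ℝ × ℝ, Complex.exp (Complex.I * (((z.1 - z.2) * a : ℝ) : ℂ)) *
      (((Real.exp (-τ * a ^ 2) : ℝ) : ℂ) * (h z.1 * (starRingEnd ℂ) (h z.2))) := by
    intro a
    rw [Complex.ofReal_mul, bft_sq, ← integral_const_mul]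
    congr 1; ext z; ring
  have hreal : Integrable (fun a : ℝ => Real.exp (-τ * a ^ 2) * ‖bft h a‖ ^ 2) := by
    have := hT.integral_prod_left
    have h2 : Integrable (fun a : ℝ => ((Real.exp (-τ * a ^ 2) * ‖bft h a‖ ^ 2 : ℝ) : ℂ)) := by
      refine this.congr (Filter.Eventually.of_forall fun a => ?_)
      exact (e1 a).symm
    exact h2.re
  have e2 : ((∫ a : ℝ, Real.exp (-τ * a ^ 2) * ‖bft h a‖ ^ 2 : ℝ) : ℂ) =
      ∫ z : ℝ × ℝ, ((Real.sqrt (Real.pi / τ) * Real.exp (-(z.1 - z.2) ^ 2 / (4 * τ)) : ℝ) : ℂ) *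
        (h z.1 * (starRingEnd ℂ) (h z.2)) := by
    rw [← integral_complex_ofReal]
    simp_rw [e1]
    have := integral_integral_swap (f := fun (a : ℝ) (z : ℝ × ℝ) => Complex.exp (Complex.I * (((z.1 - z.2) * a : ℝ) : ℂ)) *
      (((Real.exp (-τ * a ^ 2) : ℝ) : ℂ) * (h z.1 * (starRingEnd ℂ) (h z.2)))) hT
    refine this.trans ?_
    congr 1; ext z
    rw [← bo_gauss_int τ hτ, ← integral_mul_const]
    congr 1; ext a; ring
  have e3 : ∫⁻ a : ℝ, ENNReal.ofReal (Real.exp (-τ * a ^ 2)) * ‖bft h a‖ₑ ^ 2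
      = ‖((∫ a : ℝ, Real.exp (-τ * a ^ 2) * ‖bft h a‖ ^ 2 : ℝ) : ℂ)‖ₑ := by
    have hnn : 0 ≤ ∫ a : ℝ, Real.exp (-τ * a ^ 2) * ‖bft h a‖ ^ 2 := integral_nonneg fun a => by positivity
    rw [← ofReal_norm, Complex.norm_real, Real.norm_of_nonneg hnn,
      ofReal_integral_eq_lintegral_ofReal hreal (Filter.Eventually.of_forall fun a => by positivity)]
    congr 1; ext a
    rw [ENNReal.ofReal_mul (by positivity), ENNReal.ofReal_pow (by positivity), ofReal_norm]
  rw [e3, e2]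
  refine (enorm_integral_le_lintegral_enorm _).trans ?_
  have hha := hi.aestronglyMeasurable.enorm
  have hmm : AEMeasurable (fun z : ℝ × ℝ => ‖h z.1‖ₑ * ‖h z.2‖ₑ * ENNReal.ofReal (Real.exp (-(z.1 - z.2) ^ 2 / (4 * τ))))
      (volume.prod volume) := by
    have m1 : AEMeasurable (fun z : ℝ × ℝ => ‖h z.1‖ₑ) (volume.prod volume) := 
      hha.comp_quasiMeasurePreserving Measure.quasiMeasurePreserving_fst
    have m2 : AEMeasurable (fun z : ℝ × ℝ => ‖h z.2‖ₑ) (volume.prod volume) := 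
      hha.comp_quasiMeasurePreserving Measure.quasiMeasurePreserving_snd
    have m3 : AEMeasurable (fun z : ℝ × ℝ => ENNReal.ofReal (Real.exp (-(z.1 - z.2) ^ 2 / (4 * τ)))) (volume.prod volume) := by
      fun_prop
    exact (m1.mul m2).mul m3
  rw [← lintegral_prod _ hmm, ← lintegral_const_mul'' _ hmm]
  apply lintegral_mono
  intro z
  simp only
  rw [enorm_mul, enorm_mul, RCLike.enorm_conj, ← ofReal_norm (Complex.ofReal _), Complex.norm_real,
    Real.norm_of_nonneg (by positivity), ENNReal.ofReal_mul (by positivity)]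
  apply le_of_eq; ring

lemma bo_gauss_total (τ : ℝ) (hτ : 0 < τ) (x : ℝ) :
    ENNReal.ofReal (Real.sqrt (Real.pi / τ)) * ∫⁻ y : ℝ, ENNReal.ofReal (Real.exp (-(x - y) ^ 2 / (4 * τ)))
      = ENNReal.ofReal (2 * Real.pi) := by
  rw [lintegral_sub_left_eq_self (fun y => ENNReal.ofReal (Real.exp (-y ^ 2 / (4 * τ)))) x]
  have hb : (0:ℝ) < 1 / (4 * τ) := by positivity
  have e : ∀ y : ℝ, Real.exp (-y ^ 2 / (4 * τ)) = Real.exp (-(1 / (4 * τ)) * y ^ 2) := by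
    intro y; congr 1; ring
  simp_rw [e]
  rw [← ofReal_integral_eq_lintegral_ofReal (integrable_exp_neg_mul_sq hb)
    (Filter.Eventually.of_forall fun a => by positivity), integral_gaussian,
    ← ENNReal.ofReal_mul (by positivity)]
  congr 1
  rw [← Real.sqrt_mul (by positivity)]
  rw [show Real.pi / τ * (Real.pi / (1 / (4 * τ))) = (2 * Real.pi) ^ 2 by field_simp; ring]
  exact Real.sqrt_sq (by positivity)

/-- Plancherel inequality. -/
lemma bo_plancherel (h : ℝ → ℂ) (hm : Measurable h) (hi : Integrable h) :
    ∫⁻ a : ℝ, ‖bft h a‖ₑ ^ 2 ≤ ENNReal.ofReal (2 * Real.pi) * ∫⁻ x, ‖h x‖ₑ ^ 2 := by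
  have key : ∀ τ : ℝ, 0 < τ → ∫⁻ a : ℝ, ENNReal.ofReal (Real.exp (-τ * a ^ 2)) * ‖bft h a‖ₑ ^ 2
      ≤ ENNReal.ofReal (2 * Real.pi) * ∫⁻ x, ‖h x‖ₑ ^ 2 := by
    intro τ hτ
    refine (bo_gauss_ft h hi τ hτ).trans ?_
    set G : ℝ → ℝ → ℝ≥0∞ := fun x y => ENNReal.ofReal (Real.exp (-(x - y) ^ 2 / (4 * τ))) with hG
    have hGm : Measurable (fun z : ℝ × ℝ => G z.1 z.2) := by simp only [hG]; fun_prop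
    have hsymm : ∀ x y, G x y = G y x := by
      intro x y; simp only [hG]; congr 2; ring
    have s1 : ∫⁻ x, ∫⁻ y, ‖h x‖ₑ * ‖h y‖ₑ * G x y ≤ ∫⁻ x, ∫⁻ y, ‖h x‖ₑ ^ 2 * G x y := by
      have a1 : ∫⁻ x, ∫⁻ y, 2 * (‖h x‖ₑ * ‖h y‖ₑ * G x y)
          ≤ ∫⁻ x, ∫⁻ y, (‖h x‖ₑ ^ 2 * G x y + ‖h y‖ₑ ^ 2 * G x y) := by
        apply lintegral_mono; intro x; apply lintegral_mono; intro y
        simp only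
        rw [← add_mul, ← mul_assoc, ← mul_assoc]
        gcongr
        have hr := two_mul_le_add_sq ‖h x‖₊ ‖h y‖₊
        have : ((2 * ‖h x‖₊ * ‖h y‖₊ : NNReal) : ℝ≥0∞) ≤ ((‖h x‖₊ ^ 2 + ‖h y‖₊ ^ 2 : NNReal) : ℝ≥0∞) := by
          exact_mod_cast hr
        push_cast at this
        exact this
      have a2 : ∫⁻ x, ∫⁻ y, (‖h x‖ₑ ^ 2 * G x y + ‖h y‖ₑ ^ 2 * G x y)
          = 2 * ∫⁻ x, ∫⁻ y, ‖h x‖ₑ ^ 2 * G x y := by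
        have b1 : ∀ x, ∫⁻ y, (‖h x‖ₑ ^ 2 * G x y + ‖h y‖ₑ ^ 2 * G x y)
          = (∫⁻ y, ‖h x‖ₑ ^ 2 * G x y) + ∫⁻ y, ‖h y‖ₑ ^ 2 * G x y := by
          intro x; rw [lintegral_add_left (by fun_prop)]
        simp_rw [b1]
        rw [lintegral_add_left (by fun_prop), two_mul]
        congr 1
        rw [lintegral_lintegral_swap (by fun_prop)]
        simp_rw [hsymm]
      have a3 : ∫⁻ x, ∫⁻ y, 2 * (‖h x‖ₑ * ‖h y‖ₑ * G x y) = 2 * ∫⁻ x, ∫⁻ y, (‖h x‖ₑ * ‖h y‖ₑ * G x y) := by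
        rw [← lintegral_const_mul _ (by fun_prop)]
        congr 1; ext x
        rw [lintegral_const_mul _ (by fun_prop)]
      rw [a2, a3] at a1
      exact (ENNReal.mul_le_mul_iff_right (by norm_num) (by norm_num)).1 a1
    refine (mul_le_mul_right s1 _).trans ?_
    rw [← lintegral_const_mul _ (by fun_prop), ← lintegral_const_mul _ (by fun_prop)]
    apply le_of_eq; congr 1; ext x
    rw [lintegral_const_mul _ (by fun_prop), mul_left_comm, bo_gauss_total τ hτ x, mul_comm]
  have hlim : Filter.Tendsto (fun n : ℕ => ∫⁻ a : ℝ, ENNReal.ofReal (Real.exp (-(1 / ((n:ℝ) + 1)) * a ^ 2)) * ‖bft h a‖ₑ ^ 2)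
     Filter.atTop (nhds (∫⁻ a : ℝ, ‖bft h a‖ₑ ^ 2)) := by
    have hbm := bft_measurable h hm
    refine lintegral_tendsto_of_tendsto_of_monotone (fun n => by fun_prop) ?_ ?_
    · refine Filter.Eventually.of_forall fun a n m hnm => ?_
      simp only
      gcongr
    · refine Filter.Eventually.of_forall fun a => ?_
      have : Filter.Tendsto (fun n : ℕ => ENNReal.ofReal (Real.exp (-(1 / ((n:ℝ) + 1)) * a ^ 2))) Filter.atTop (nhds (ENNReal.ofReal (Real.exp (-0 * a^2)))) := by
        refine ENNReal.tendsto_ofReal ((Real.continuous_exp.tendsto _).comp ?_)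
        exact (tendsto_one_div_add_atTop_nhds_zero_nat.neg).mul_const _
      simp only [neg_zero, zero_mul, Real.exp_zero, ENNReal.ofReal_one] at this
      have h2 := ENNReal.Tendsto.mul_const (b := ‖bft h a‖ₑ ^ 2) this (Or.inl one_ne_zero)
      simpa using h2
  exact le_of_tendsto' hlim fun n => key _ (by positivity)

lemma bo_gamma_int (σ : ℝ) (hσ : 0 < σ) (r : ℝ) (hr : 0 < r) :
    ∫⁻ τ in Set.Ioi (0:ℝ), ENNReal.ofReal (τ ^ (σ - 1) * Real.exp (-(r * τ)))
      = ENNReal.ofReal ((1 / r) ^ σ * Real.Gamma σ) := by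
  rw [← Real.integral_rpow_mul_exp_neg_mul_Ioi hσ hr, ofReal_integral_eq_lintegral_ofReal]
  · by_contra hcon
    have h1 := Real.integral_rpow_mul_exp_neg_mul_Ioi hσ hr
    rw [integral_undef hcon] at h1
    have : 0 < (1 / r) ^ σ * Real.Gamma σ := mul_pos (by positivity) (Real.Gamma_pos_of_pos hσ)
    linarith
  · filter_upwards [self_mem_ae_restrict measurableSet_Ioi] with τ hτ
    have : (0:ℝ) < τ := hτ
    positivity

lemma bo_gamma_int_inv (ν : ℝ) (hν : 0 < ν) (r : ℝ) (hr : 0 < r) :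
    ∫⁻ τ in Set.Ioi (0:ℝ), ENNReal.ofReal (τ ^ (-ν - 1) * Real.exp (-(r / τ)))
      = ENNReal.ofReal ((1 / r) ^ ν * Real.Gamma ν) := by
  rw [← bo_gamma_int ν hν r hr]
  have himg : (fun τ : ℝ => τ⁻¹) '' Set.Ioi 0 = Set.Ioi 0 := by
    ext y; constructor
    · rintro ⟨x, hx, rfl⟩; exact Set.mem_Ioi.2 (inv_pos.2 (Set.mem_Ioi.1 hx))
    · intro hy; exact ⟨y⁻¹, Set.mem_Ioi.2 (inv_pos.2 (Set.mem_Ioi.1 hy)), inv_inv y⟩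
  have := lintegral_image_eq_lintegral_abs_deriv_mul (s := Set.Ioi (0:ℝ)) (f := fun τ => τ⁻¹)
    (f' := fun τ => -(τ ^ 2)⁻¹) measurableSet_Ioi
    (fun x hx => (hasDerivAt_inv (ne_of_gt hx)).hasDerivWithinAt)
    (inv_injective.injOn) (fun τ => ENNReal.ofReal (τ ^ (ν - 1) * Real.exp (-(r * τ))))
  rw [himg] at this
  rw [this]
  refine setLIntegral_congr_fun measurableSet_Ioi fun τ hτ => ?_
  have hτ' : (0:ℝ) < τ := hτ
  rw [← ENNReal.ofReal_mul (abs_nonneg _), abs_neg, abs_of_pos (by positivity), ← mul_assoc]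
  congr 2
  rw [Real.inv_rpow hτ'.le, ← Real.rpow_neg hτ'.le, ← Real.rpow_natCast, ← Real.rpow_neg hτ'.le, ← Real.rpow_add hτ']
  congr 1; push_cast; ring

/-- Pitt type inequality. -/
lemma bo_pitt (κ : ℝ) (h0 : 0 < κ) (h1 : κ < 1) :
    ∃ C : ℝ≥0∞, C ≠ ⊤ ∧ ∀ h : ℝ → ℂ, Measurable h → Integrable h →
      ∫⁻ a : ℝ, (ENNReal.ofReal |a|) ^ (κ - 1) * ‖bft h a‖ₑ ^ 2
        ≤ C * ∫⁻ x, ∫⁻ y, ‖h x‖ₑ * ‖h y‖ₑ * (ENNReal.ofReal |x - y|) ^ (-κ) := by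
  set σ := (1 - κ) / 2 with hσ
  have hσ0 : 0 < σ := by rw [hσ]; linarith
  have hG0 : 0 < Real.Gamma σ := Real.Gamma_pos_of_pos hσ0
  have hG1 : 0 < Real.Gamma (κ / 2) := Real.Gamma_pos_of_pos (by linarith)
  set c : ℝ := Real.sqrt Real.pi * ((4:ℝ) ^ (κ / 2) * Real.Gamma (κ / 2)) with hc
  refine ⟨ENNReal.ofReal ((Real.Gamma σ)⁻¹) * ENNReal.ofReal c, by finiteness, fun h hm hi => ?_⟩
  have hbm := bft_measurable h hm
  -- step 1
  have s1 : ∀ᵐ a : ℝ, (ENNReal.ofReal |a|) ^ (κ - 1) * ‖bft h a‖ₑ ^ 2 =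
      ENNReal.ofReal ((Real.Gamma σ)⁻¹) * ∫⁻ τ in Set.Ioi (0:ℝ), ENNReal.ofReal (τ ^ (σ - 1)) *
        (ENNReal.ofReal (Real.exp (-τ * a ^ 2)) * ‖bft h a‖ₑ ^ 2) := by
    have : ∀ᵐ a : ℝ, a ≠ 0 := by simp [ae_iff]
    filter_upwards [this] with a ha
    have ha2 : 0 < a ^ 2 := by positivity
    have e1 : ∫⁻ τ in Set.Ioi (0:ℝ), ENNReal.ofReal (τ ^ (σ - 1)) *
        (ENNReal.ofReal (Real.exp (-τ * a ^ 2)) * ‖bft h a‖ₑ ^ 2)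
        = (∫⁻ τ in Set.Ioi (0:ℝ), ENNReal.ofReal (τ ^ (σ - 1) * Real.exp (-(a ^ 2 * τ)))) * ‖bft h a‖ₑ ^ 2 := by
      rw [← lintegral_mul_const _ (by fun_prop)]
      refine setLIntegral_congr_fun measurableSet_Ioi fun τ hτ => ?_
      have : (0:ℝ) < τ := hτ
      rw [ENNReal.ofReal_mul (by positivity), ← mul_assoc]
      congr 4; ring
    rw [e1, bo_gamma_int σ hσ0 _ ha2, ← mul_assoc, ← ENNReal.ofReal_mul (by positivity)]
    congr 1
    have habs : 0 < |a| := abs_pos.2 ha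
    rw [ENNReal.ofReal_rpow_of_pos habs]
    congr 1
    rw [mul_comm ((1 / a ^ 2) ^ σ), inv_mul_cancel_left₀ hG0.ne', ← sq_abs, one_div, Real.inv_rpow (by positivity),
      ← Real.rpow_neg (by positivity), ← Real.rpow_natCast, ← Real.rpow_mul habs.le]
    congr 1; rw [hσ]; push_cast; ring
  rw [lintegral_congr_ae s1, lintegral_const_mul _ (by fun_prop), mul_assoc]
  gcongr
  rw [lintegral_lintegral_swap (by fun_prop)]
  -- step 2
  have s2 : ∫⁻ τ in Set.Ioi (0:ℝ), ∫⁻ a : ℝ, ENNReal.ofReal (τ ^ (σ - 1)) *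
        (ENNReal.ofReal (Real.exp (-τ * a ^ 2)) * ‖bft h a‖ₑ ^ 2)
      ≤ ∫⁻ τ in Set.Ioi (0:ℝ), ∫⁻ z : ℝ × ℝ, ‖h z.1‖ₑ * ‖h z.2‖ₑ *
        ENNReal.ofReal (τ ^ (σ - 1) * (Real.sqrt (Real.pi / τ) * Real.exp (-(z.1 - z.2) ^ 2 / (4 * τ)))) := by
    refine setLIntegral_mono' measurableSet_Ioi fun τ hτ => ?_
    have hτ' : (0:ℝ) < τ := hτ
    rw [lintegral_const_mul _ (by fun_prop)]
    refine (mul_le_mul_right (bo_gauss_ft h hi τ hτ') _).trans ?_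
    have hpr : ∫⁻ x, ∫⁻ y, ‖h x‖ₑ * ‖h y‖ₑ * ENNReal.ofReal (Real.exp (-(x - y) ^ 2 / (4 * τ)))
        = ∫⁻ z : ℝ × ℝ, ‖h z.1‖ₑ * ‖h z.2‖ₑ * ENNReal.ofReal (Real.exp (-(z.1 - z.2) ^ 2 / (4 * τ))) :=
      (lintegral_prod (fun z : ℝ × ℝ => ‖h z.1‖ₑ * ‖h z.2‖ₑ * ENNReal.ofReal (Real.exp (-(z.1 - z.2) ^ 2 / (4 * τ))))
        (by fun_prop)).symm
    rw [hpr, ← lintegral_const_mul _ (by fun_prop), ← lintegral_const_mul _ (by fun_prop)]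
    apply lintegral_mono; intro z
    simp only
    rw [ENNReal.ofReal_mul (by positivity), ENNReal.ofReal_mul (by positivity)]
    apply le_of_eq; ring
  refine s2.trans ?_
  rw [lintegral_lintegral_swap (by fun_prop)]
  have s3 : ∀ x y : ℝ, ‖h x‖ₑ * ‖h y‖ₑ * ∫⁻ τ in Set.Ioi (0:ℝ),
        ENNReal.ofReal (τ ^ (σ - 1) * (Real.sqrt (Real.pi / τ) * Real.exp (-(x - y) ^ 2 / (4 * τ))))
      ≤ ENNReal.ofReal c * (‖h x‖ₑ * ‖h y‖ₑ * (ENNReal.ofReal |x - y|) ^ (-κ)) := by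
    intro x y
    rw [mul_left_comm]
    gcongr
    by_cases hxy : x - y = 0
    · rw [hxy]
      have hc0 : ENNReal.ofReal c ≠ 0 := by
        simp only [ne_eq, ENNReal.ofReal_eq_zero, not_le, hc]; positivity
      simp only [abs_zero, ENNReal.ofReal_zero]
      rw [ENNReal.zero_rpow_of_neg (by linarith), ENNReal.mul_top hc0]
      exact le_top
    have habs : 0 < |x - y| := abs_pos.2 hxy
    have hr : 0 < (x - y) ^ 2 / 4 := by positivity
    have e1 : ∫⁻ τ in Set.Ioi (0:ℝ),
        ENNReal.ofReal (τ ^ (σ - 1) * (Real.sqrt (Real.pi / τ) * Real.exp (-(x - y) ^ 2 / (4 * τ))))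
        = ∫⁻ τ in Set.Ioi (0:ℝ), ENNReal.ofReal (Real.sqrt Real.pi) *
          ENNReal.ofReal (τ ^ (-(κ/2) - 1) * Real.exp (-(((x - y) ^ 2 / 4) / τ))) := by
      refine setLIntegral_congr_fun measurableSet_Ioi fun τ hτ => ?_
      have hτ' : (0:ℝ) < τ := hτ
      rw [← ENNReal.ofReal_mul (by positivity)]
      congr 1
      rw [Real.sqrt_div (by positivity)]
      have p1 : τ ^ (-(κ/2) - 1) = τ ^ (σ - 1) / Real.sqrt τ := by
        rw [Real.sqrt_eq_rpow, ← Real.rpow_sub hτ']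
        congr 1; rw [hσ]; ring
      have p2 : -(x - y) ^ 2 / (4 * τ) = -(((x - y) ^ 2 / 4) / τ) := by field_simp
      rw [p1, p2]; ring
    rw [e1, lintegral_const_mul _ (by fun_prop), bo_gamma_int_inv _ (by linarith) _ hr,
      ENNReal.ofReal_rpow_of_pos habs, ← ENNReal.ofReal_mul (by positivity), ← ENNReal.ofReal_mul (by positivity)]
    apply le_of_eq; congr 1
    rw [hc, one_div_div, Real.div_rpow (by norm_num) (by positivity), ← sq_abs (x - y)]
    have p3 : |x - y| ^ (-κ) = ((|x - y| ^ 2) ^ (κ / 2))⁻¹ := by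
      rw [← Real.rpow_natCast, ← Real.rpow_mul habs.le, ← Real.rpow_neg habs.le]
      congr 1; push_cast; ring
    rw [p3]; ring
  have hm2 : Measurable fun z : ℝ × ℝ => ENNReal.ofReal c * (‖h z.1‖ₑ * ‖h z.2‖ₑ * (ENNReal.ofReal |z.1 - z.2|) ^ (-κ)) := by
    fun_prop
  calc _ ≤ ∫⁻ z : ℝ × ℝ, ENNReal.ofReal c * (‖h z.1‖ₑ * ‖h z.2‖ₑ * (ENNReal.ofReal |z.1 - z.2|) ^ (-κ)) := by
        apply lintegral_mono; intro z
        simp only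
        rw [lintegral_const_mul _ (by fun_prop)]
        exact s3 z.1 z.2
    _ = ENNReal.ofReal c * ∫⁻ x, ∫⁻ y, ‖h x‖ₑ * ‖h y‖ₑ * (ENNReal.ofReal |x - y|) ^ (-κ) := by
        rw [lintegral_const_mul _ (by fun_prop)]
        congr 1
        exact lintegral_prod _ (by fun_prop)

/-! ### The oscillatory kernel bound -/

lemma bo_vdc (a b lam : ℝ) (hab : a ≤ b) (hl : 0 < lam) (ph w ps ps' G G' : ℝ → ℝ)
    (h1 : ∀ s ∈ Set.Icc a b, HasDerivAt ph (w s * ps s) s)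
    (h2 : ∀ s ∈ Set.Icc a b, HasDerivAt ps (ps' s) s)
    (h3 : ∀ s ∈ Set.Icc a b, HasDerivAt G (G' s) s)
    (c1 : ContinuousOn w (Set.Icc a b)) (c2 : ContinuousOn ps' (Set.Icc a b))
    (c3 : ContinuousOn G' (Set.Icc a b)) (hw : ∀ s ∈ Set.Icc a b, 0 ≤ w s)
    (hb : ∀ s ∈ Set.Icc a b, (lam ^ 2 * w s + |ps' s|) / (lam ^ 2 + ps s ^ 2) ≤ G' s) :
    ‖∫ s in a..b, ((w s : ℝ) : ℂ) * Complex.exp (Complex.I * ((ph s : ℝ) : ℂ))‖ ≤ 1 / lam + (G b - G a) := by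
  have hu : Set.uIcc a b = Set.Icc a b := Set.uIcc_of_le hab
  have cps : ContinuousOn ps (Set.Icc a b) := fun s hs => (h2 s hs).continuousAt.continuousWithinAt
  have cph : ContinuousOn ph (Set.Icc a b) := fun s hs => (h1 s hs).continuousAt.continuousWithinAt
  have hden : ∀ s, 0 < lam ^ 2 + ps s ^ 2 := fun s => by positivity
  set U : ℝ → ℂ := fun s => Complex.exp (Complex.I * ((ph s : ℝ) : ℂ)) * ((ps s / (lam ^ 2 + ps s ^ 2) : ℝ) : ℂ) with hU
  set V : ℝ → ℂ := fun s => Complex.exp (Complex.I * ((ph s : ℝ) : ℂ)) *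
     (Complex.I * ((w s * ps s * (ps s / (lam ^ 2 + ps s ^ 2)) : ℝ) : ℂ) +
       ((ps' s * (lam ^ 2 - ps s ^ 2) / (lam ^ 2 + ps s ^ 2) ^ 2 : ℝ) : ℂ)) with hV
  have hUd : ∀ s ∈ Set.Icc a b, HasDerivAt U (V s) s := by
    intro s hs
    have d1 : HasDerivAt (fun s => ps s / (lam ^ 2 + ps s ^ 2))
        (ps' s * (lam ^ 2 - ps s ^ 2) / (lam ^ 2 + ps s ^ 2) ^ 2) s := by
      have := (h2 s hs).div (((h2 s hs).pow 2).const_add (lam ^ 2)) (hden s).ne'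
      refine this.congr_deriv ?_
      congr 1
      simp only [Pi.pow_apply]
      push_cast; ring
    have d2 : HasDerivAt (fun s => Complex.exp (Complex.I * ((ph s : ℝ) : ℂ)))
       (Complex.exp (Complex.I * ((ph s : ℝ) : ℂ)) * (Complex.I * ((w s * ps s : ℝ) : ℂ))) s :=
      ((h1 s hs).ofReal_comp.const_mul Complex.I).cexp
    have := d2.mul d1.ofReal_comp
    refine this.congr_deriv ?_
    simp only [hV]; push_cast; ring
  have cE : ContinuousOn (fun s => Complex.exp (Complex.I * ((ph s : ℝ) : ℂ))) (Set.Icc a b) := by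
    refine Complex.continuous_exp.comp_continuousOn ?_
    exact continuousOn_const.mul (Complex.continuous_ofReal.comp_continuousOn cph)
  have cden : ContinuousOn (fun s => lam ^ 2 + ps s ^ 2) (Set.Icc a b) := continuousOn_const.add (cps.pow 2)
  have cV : ContinuousOn V (Set.Icc a b) := by
    refine cE.mul ((continuousOn_const.mul (Complex.continuous_ofReal.comp_continuousOn ?_)).add
      (Complex.continuous_ofReal.comp_continuousOn ?_))
    · exact (c1.mul cps).mul (cps.div cden fun s _ => (hden s).ne')
    · exact (c2.mul (continuousOn_const.sub (cps.pow 2))).div (cden.pow 2) fun s _ => (pow_pos (hden s) 2).ne'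
  have cF : ContinuousOn (fun s => ((w s : ℝ) : ℂ) * Complex.exp (Complex.I * ((ph s : ℝ) : ℂ))) (Set.Icc a b) :=
    (Complex.continuous_ofReal.comp_continuousOn c1).mul cE
  have iV : IntervalIntegrable V volume a b := (hu ▸ cV : ContinuousOn V (Set.uIcc a b)).intervalIntegrable
  have iF := (hu ▸ cF : ContinuousOn _ (Set.uIcc a b)).intervalIntegrable (μ := volume)
  have iG : IntervalIntegrable G' volume a b := (hu ▸ c3 : ContinuousOn _ (Set.uIcc a b)).intervalIntegrable
  have eV : ∫ s in a..b, V s = U b - U a :=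
    intervalIntegral.integral_eq_sub_of_hasDerivAt (fun s hs => hUd s (hu ▸ hs)) iV
  have eG : ∫ s in a..b, G' s = G b - G a :=
    intervalIntegral.integral_eq_sub_of_hasDerivAt (fun s hs => h3 s (hu ▸ hs)) iG
  have nU : ∀ s, ‖U s‖ ≤ 1 / (2 * lam) := by
    intro s
    simp only [hU]
    rw [norm_mul, bo_norm_expI, one_mul, Complex.norm_real, Real.norm_eq_abs, abs_div, abs_of_pos (hden s),
      div_le_div_iff₀ (hden s) (by positivity)]
    nlinarith [sq_nonneg (lam - |ps s|), sq_abs (ps s)]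
  have split : ∫ s in a..b, ((w s : ℝ) : ℂ) * Complex.exp (Complex.I * ((ph s : ℝ) : ℂ))
     = -Complex.I * (U b - U a) + ∫ s in a..b, (((w s : ℝ) : ℂ) * Complex.exp (Complex.I * ((ph s : ℝ) : ℂ)) - -Complex.I * V s) := by
    rw [intervalIntegral.integral_sub iF (iV.const_mul _), intervalIntegral.integral_const_mul, eV]; ring
  rw [split]
  refine (norm_add_le _ _).trans (add_le_add ?_ ?_)
  · rw [norm_mul, norm_neg, Complex.norm_I, one_mul]
    refine (norm_sub_le _ _).trans ?_
    have := add_le_add (nU b) (nU a)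
    refine this.trans (le_of_eq ?_)
    field_simp; ring
  · rw [← eG]
    refine intervalIntegral.norm_integral_le_of_norm_le hab ?_ iG
    refine Filter.Eventually.of_forall fun s hs => ?_
    have hs' : s ∈ Set.Icc a b := Set.Ioc_subset_Icc_self hs
    refine le_trans ?_ (hb s hs')
    have e : ((w s : ℝ) : ℂ) * Complex.exp (Complex.I * ((ph s : ℝ) : ℂ)) - -Complex.I * V s
       = Complex.exp (Complex.I * ((ph s : ℝ) : ℂ)) * (((w s * (lam ^ 2 / (lam ^ 2 + ps s ^ 2)) : ℝ) : ℂ) +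
          Complex.I * ((ps' s * (lam ^ 2 - ps s ^ 2) / (lam ^ 2 + ps s ^ 2) ^ 2 : ℝ) : ℂ)) := by
      simp only [hV]
      have : lam ^ 2 / (lam ^ 2 + ps s ^ 2) = 1 - ps s * (ps s / (lam ^ 2 + ps s ^ 2)) := by
        have := (hden s).ne'
        field_simp; ring
      rw [this]; push_cast
      linear_combination (Complex.exp (Complex.I * ((ph s : ℝ) : ℂ)) * (w s * ps s * (ps s / (lam ^ 2 + ps s ^ 2)))) * Complex.I_sq
    rw [e, norm_mul, bo_norm_expI, one_mul]
    refine (norm_add_le _ _).trans ?_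
    rw [norm_mul, Complex.norm_I, one_mul, Complex.norm_real, Complex.norm_real, Real.norm_eq_abs, Real.norm_eq_abs, add_div]
    refine add_le_add (le_of_eq ?_) ?_
    · rw [abs_of_nonneg (mul_nonneg (hw s hs') (div_nonneg (by positivity) (hden s).le))]; ring
    · rw [abs_div, abs_mul, abs_of_pos (pow_pos (hden s) 2), div_le_div_iff₀ (pow_pos (hden s) 2) (hden s)]
      have : |lam ^ 2 - ps s ^ 2| ≤ lam ^ 2 + ps s ^ 2 := by
        rw [abs_le]; constructor <;> nlinarith [sq_nonneg lam, sq_nonneg (ps s)]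
      calc |ps' s| * |lam ^ 2 - ps s ^ 2| * (lam ^ 2 + ps s ^ 2)
          ≤ |ps' s| * (lam ^ 2 + ps s ^ 2) * (lam ^ 2 + ps s ^ 2) := by
            have := hden s
            gcongr
        _ = _ := by ring

lemma bo_arctan_bd (x : ℝ) : |Real.arctan x| ≤ 2 := by
  have h1 := Real.arctan_lt_pi_div_two x
  have h2 := Real.neg_pi_div_two_lt_arctan x
  have := Real.pi_lt_four
  rw [abs_le]; constructor <;> linarith

lemma bo_omega_pos (α ξ : ℝ) (hξ : 0 < ξ) : omegaBO α ξ = - ξ ^ (2 + α) := by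
  unfold omegaBO
  have : ξ ^ (2 + α) = ξ * ξ ^ (1 + α) := by
    rw [show 2 + α = 1 + (1 + α) by ring, Real.rpow_add hξ 1 (1 + α), Real.rpow_one]
  rw [abs_of_pos hξ, this]; ring

lemma bo_omega_neg (α ξ : ℝ) : omegaBO α (-ξ) = - omegaBO α ξ := by
  unfold omegaBO; rw [abs_neg]; ring

lemma bo_kernel_pos (α : ℝ) (hα0 : 0 < α) (hα1 : α ≤ 1) (a b : ℝ) (ha : 0 < a) (hab : a ≤ b) (x t : ℝ) (ht : 0 < t) :
    ‖∫ ξ in a..b, ((ξ ^ (α / 2) : ℝ) : ℂ) * Complex.exp (Complex.I * ((x * ξ + t * omegaBO α ξ : ℝ) : ℂ))‖ ≤ 100 / Real.sqrt t := by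
  set lam := Real.sqrt t with hlam
  have hl : 0 < lam := Real.sqrt_pos.2 ht
  have hl2 : lam ^ 2 = t := Real.sq_sqrt ht.le
  set ps : ℝ → ℝ := fun ξ => x * ξ ^ (-(α / 2)) - (2 + α) * t * ξ ^ (1 + α / 2) with hps
  set ps' : ℝ → ℝ := fun ξ => x * (-(α / 2) * ξ ^ (-(α / 2) - 1)) - (2 + α) * t * ((1 + α / 2) * ξ ^ (α / 2)) with hps'
  have hpos : ∀ s ∈ Set.Icc a b, 0 < s := fun s hs => lt_of_lt_of_le ha hs.1
  have h1 : ∀ s ∈ Set.Icc a b, HasDerivAt (fun ξ => x * ξ + t * omegaBO α ξ) (s ^ (α / 2) * ps s) s := by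
    intro s hs
    have hs0 := hpos s hs
    have d : HasDerivAt (fun ξ => x * ξ + t * (-ξ ^ (2 + α))) (x * 1 + t * (- ((2 + α) * s ^ (2 + α - 1)))) s :=
      ((hasDerivAt_id s).const_mul x).add (((Real.hasDerivAt_rpow_const (Or.inl hs0.ne')).neg).const_mul t)
    have e : x * 1 + t * (- ((2 + α) * s ^ (2 + α - 1))) = s ^ (α / 2) * ps s := by
      simp only [hps]
      have e1 : s ^ (α / 2) * s ^ (-(α / 2)) = 1 := by rw [← Real.rpow_add hs0]; simp
      have e2 : s ^ (α / 2) * s ^ (1 + α / 2) = s ^ (2 + α - 1) := by rw [← Real.rpow_add hs0]; congr 1; ring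
      rw [← e2]; linear_combination (-x) * e1
    rw [← e]
    refine d.congr_of_eventuallyEq ?_
    filter_upwards [lt_mem_nhds hs0] with y hy
    rw [bo_omega_pos α y hy]
  have h2 : ∀ s ∈ Set.Icc a b, HasDerivAt ps (ps' s) s := by
    intro s hs
    have hs0 := hpos s hs
    have d1 : HasDerivAt (fun ξ : ℝ => ξ ^ (-(α / 2))) (-(α / 2) * s ^ (-(α / 2) - 1)) s := Real.hasDerivAt_rpow_const (Or.inl hs0.ne')
    have d2 : HasDerivAt (fun ξ : ℝ => ξ ^ (1 + α / 2)) ((1 + α / 2) * s ^ (α / 2)) s := by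
      convert Real.hasDerivAt_rpow_const (x := s) (p := 1 + α / 2) (Or.inl hs0.ne') using 2; congr 1; ring
    exact (d1.const_mul x).sub (d2.const_mul ((2 + α) * t))
  have cpw : ∀ e : ℝ, ContinuousOn (fun ξ : ℝ => ξ ^ e) (Set.Icc a b) := fun e s hs =>
    (Real.continuousAt_rpow_const _ _ (Or.inl (hpos s hs).ne')).continuousWithinAt
  have c2 : ContinuousOn ps' (Set.Icc a b) :=
    (continuousOn_const.mul (continuousOn_const.mul (cpw _))).sub (continuousOn_const.mul (continuousOn_const.mul (cpw _)))
  have cps : ContinuousOn ps (Set.Icc a b) := fun s hs => (h2 s hs).continuousAt.continuousWithinAt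
  have hden : ∀ s, 0 < lam ^ 2 + ps s ^ 2 := fun s => by positivity
  have cden : ContinuousOn (fun s => lam ^ 2 + ps s ^ 2) (Set.Icc a b) := continuousOn_const.add (cps.pow 2)
  have dat : ∀ s ∈ Set.Icc a b, HasDerivAt (fun ξ => Real.arctan (ps ξ / lam) / lam) (ps' s / (lam ^ 2 + ps s ^ 2)) s := by
    intro s hs
    have := (((h2 s hs).div_const lam).arctan).div_const lam
    refine this.congr_deriv ?_
    have := (hden s).ne'
    field_simp
  have fin : ∀ G : ℝ → ℝ, (∀ s, |G s| ≤ 44 / lam) → 1 / lam + (G b - G a) ≤ 100 / lam := by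
    intro G hG
    have := abs_le.1 (hG a); have := abs_le.1 (hG b)
    have e : 100 / lam = 1 / lam + (44 / lam + 44 / lam) + 11 / lam := by ring
    have : 0 ≤ 11 / lam := by positivity
    rw [e]; linarith
  rcases le_or_gt 0 x with hx | hx
  · set G : ℝ → ℝ := fun ξ => -2 * (Real.arctan (ps ξ / lam) / lam) with hG
    refine (bo_vdc a b lam hab hl _ (fun ξ => ξ ^ (α / 2)) ps ps' G (fun s => -2 * (ps' s / (lam ^ 2 + ps s ^ 2))) h1 h2 
      (fun s hs => (dat s hs).const_mul (-2)) (cpw _) c2 ?_ ?_ ?_).trans (fin G ?_)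
    · exact continuousOn_const.mul (c2.div cden fun s _ => (hden s).ne')
    · intro s hs; have := hpos s hs; positivity
    · intro s hs
      have hs0 := hpos s hs
      rw [← mul_div_assoc]
      gcongr
      have p1 : 0 < s ^ (α / 2) := by positivity
      have p2 : 0 ≤ x * (α / 2 * s ^ (-(α / 2) - 1)) := by positivity
      have p3 : t * s ^ (α / 2) ≤ (2 + α) * t * ((1 + α / 2) * s ^ (α / 2)) := by
        have : t * s ^ (α / 2) * 1 ≤ t * s ^ (α / 2) * ((2 + α) * (1 + α / 2)) := by
          gcongr; nlinarith
        linarith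
      have p4 : 0 < t * s ^ (α / 2) := by positivity
      have hneg : ps' s ≤ - (t * s ^ (α / 2)) := by simp only [hps']; linarith
      rw [abs_of_nonpos (by linarith), hl2]
      linarith
    · intro s
      simp only [hG]
      rw [abs_mul, abs_div, abs_of_pos hl]
      have := bo_arctan_bd (ps s / lam)
      rw [← mul_div_assoc]
      gcongr
      norm_num; linarith
  · set G : ℝ → ℝ := fun ξ => Real.arctan (ps ξ / lam) / lam + 20 * (Real.arctan (lam * ξ ^ (1 + α / 2)) / lam) with hG
    have dv : ∀ s ∈ Set.Icc a b, HasDerivAt (fun ξ : ℝ => Real.arctan (lam * ξ ^ (1 + α / 2)) / lam)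
        ((1 + α / 2) * s ^ (α / 2) / (1 + t * (s ^ (1 + α / 2)) ^ 2)) s := by
      intro s hs
      have hs0 := hpos s hs
      have d2 : HasDerivAt (fun ξ : ℝ => ξ ^ (1 + α / 2)) ((1 + α / 2) * s ^ (α / 2)) s := by
        convert Real.hasDerivAt_rpow_const (x := s) (p := 1 + α / 2) (Or.inl hs0.ne') using 2; congr 1; ring
      have := ((d2.const_mul lam).arctan).div_const lam
      refine this.congr_deriv ?_
      rw [mul_pow, hl2]
      field_simp
    refine (bo_vdc a b lam hab hl _ (fun ξ => ξ ^ (α / 2)) ps ps' G (fun s => ps' s / (lam ^ 2 + ps s ^ 2) +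
        20 * ((1 + α / 2) * s ^ (α / 2) / (1 + t * (s ^ (1 + α / 2)) ^ 2))) h1 h2 
      (fun s hs => (dat s hs).add ((dv s hs).const_mul 20)) (cpw _) c2 ?_ ?_ ?_).trans (fin G ?_)
    · refine (c2.div cden fun s _ => (hden s).ne').add (continuousOn_const.mul ((continuousOn_const.mul (cpw _)).div
        (continuousOn_const.add (continuousOn_const.mul ((cpw _).pow 2))) fun s _ => by positivity))
    · intro s hs; have := hpos s hs; positivity
    · intro s hs
      have hs0 := hpos s hs
      set w := s ^ (α / 2) with hw
      set v := s ^ (1 + α / 2) with hv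
      have p1 : 0 < w := by positivity
      have p1v : 0 < v := by positivity
      have p2 : 0 ≤ (-x) * (α / 2 * s ^ (-(α / 2) - 1)) := mul_nonneg (by linarith) (by positivity)
      have c1 : (2 + α) * (1 + α / 2) ≤ 5 := by nlinarith
      have p3 : (2 + α) * t * ((1 + α / 2) * w) ≤ 5 * (t * w) := by
        have : t * w * ((2 + α) * (1 + α / 2)) ≤ t * w * 5 := by gcongr
        linarith
      have p3' : 0 ≤ (2 + α) * t * ((1 + α / 2) * w) := by positivity
      have p4 : 0 < t * w := by positivity
      have q1 : t * w + |ps' s| ≤ ps' s + 20 * (t * w) := by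
        have : |ps' s| ≤ (-x) * (α / 2 * s ^ (-(α / 2) - 1)) + (2 + α) * t * ((1 + α / 2) * w) := by
          simp only [hps']
          rw [abs_le]; constructor <;> linarith
        have e : ps' s = (-x) * (α / 2 * s ^ (-(α / 2) - 1)) - (2 + α) * t * ((1 + α / 2) * w) := by
          simp only [hps']; ring
        linarith
      have q2 : t * v ≤ - ps s := by
        simp only [hps]
        have : 0 ≤ (-x) * s ^ (-(α / 2)) := mul_nonneg (by linarith) (by positivity)
        have : t * v * 1 ≤ t * v * (2 + α) := by gcongr; linarith
        linarith
      have q3 : (t * v) ^ 2 ≤ ps s ^ 2 := by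
        rw [← neg_sq (ps s)]; gcongr
      rw [hl2]
      calc (t * w + |ps' s|) / (t + ps s ^ 2) ≤ (ps' s + 20 * (t * w)) / (t + ps s ^ 2) := by gcongr
        _ = ps' s / (t + ps s ^ 2) + 20 * ((t * w) / (t + ps s ^ 2)) := by ring
        _ ≤ ps' s / (t + ps s ^ 2) + 20 * ((t * w) / (t + (t * v) ^ 2)) := by gcongr
        _ = ps' s / (t + ps s ^ 2) + 20 * (w / (1 + t * v ^ 2)) := by
            congr 2
            rw [div_eq_div_iff (by positivity) (by positivity)]; ring
        _ ≤ _ := by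
            gcongr
            have : 1 * w ≤ (1 + α / 2) * w := by gcongr; linarith
            linarith
    · intro s
      simp only [hG]
      have b1 := bo_arctan_bd (ps s / lam)
      have b2 := bo_arctan_bd (lam * s ^ (1 + α / 2))
      rw [show Real.arctan (ps s / lam) / lam + 20 * (Real.arctan (lam * s ^ (1 + α / 2)) / lam)
        = (Real.arctan (ps s / lam) + 20 * Real.arctan (lam * s ^ (1 + α / 2))) / lam by ring, abs_div, abs_of_pos hl]
      gcongr
      rw [abs_le] at *
      constructor <;> linarith

lemma bo_kernel (α : ℝ) (hα0 : 0 < α) (hα1 : α ≤ 1) (a b : ℝ) (ha : 0 < a) (hab : a ≤ b) (x t : ℝ) (ht : t ≠ 0) :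
    ‖∫ ξ in a..b, ((ξ ^ (α / 2) : ℝ) : ℂ) * Complex.exp (Complex.I * ((x * ξ + t * omegaBO α ξ : ℝ) : ℂ))‖ ≤ 100 / Real.sqrt |t| := by
  rcases lt_or_gt_of_ne ht with h | h
  · have := bo_kernel_pos α hα0 hα1 a b ha hab (-x) (-t) (by linarith)
    rw [abs_of_neg h]
    refine le_trans (le_of_eq ?_) this
    rw [← Complex.norm_conj, intervalIntegral.integral_of_le hab, intervalIntegral.integral_of_le hab, ← integral_conj]
    congr 1
    congr 1; ext ξ
    rw [map_mul, bo_conj_expI, Complex.conj_ofReal]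
    congr 4; ring
  · rw [abs_of_pos h]
    exact bo_kernel_pos α hα0 hα1 a b ha hab x t h

/-! ### The bilinear form and good test functions -/

/-- The plane wave. -/
noncomputable def bE (α : ℝ) (z : ℝ × ℝ) (ξ : ℝ) : ℂ :=
  Complex.exp (Complex.I * ((z.2 * ξ + z.1 * omegaBO α ξ : ℝ) : ℂ))

/-- The bilinear form. -/
noncomputable def bB (α : ℝ) (f : ℝ → ℂ) (g : ℝ × ℝ → ℂ) : ℂ :=
  ∫ w : (ℝ × ℝ) × ℝ, g w.1 * f w.2 * bE α w.1 w.2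

/-- The weight. -/
noncomputable def bW (e : ℝ) (f : ℝ → ℂ) (ξ : ℝ) : ℂ := ((|ξ| ^ e : ℝ) : ℂ) * f ξ

/-- Good frequency functions. -/
def goodF (M : ℝ) (f : ℝ → ℂ) : Prop :=
  Measurable f ∧ ∀ ξ, f ξ ≠ 0 → M⁻¹ ≤ ξ ∧ ξ ≤ M ∧ M⁻¹ ≤ ‖f ξ‖ ∧ ‖f ξ‖ ≤ M

/-- Good space-time functions. -/
def goodG (M : ℝ) (g : ℝ × ℝ → ℂ) : Prop :=
  Measurable g ∧ ∀ z, g z ≠ 0 → |z.1| ≤ M ∧ |z.2| ≤ M ∧ M⁻¹ ≤ ‖g z‖ ∧ ‖g z‖ ≤ M ∧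
    ENNReal.ofReal M⁻¹ ≤ volume {x : ℝ | g (z.1, x) ≠ 0}

/-- The dual estimate. -/
def bD (α Y Z : ℝ) : Prop :=
  ∃ C : ℝ, ∀ (M : ℝ) (f : ℝ → ℂ) (g : ℝ × ℝ → ℂ), 1 ≤ M → goodF M f → goodG M g →
    ∫⁻ ξ, ‖f ξ‖ₑ ^ (1 / (Y + 2 * Z - 2)) ≤ 1 →
    ∫⁻ t : ℝ, (∫⁻ x : ℝ, ‖g (t, x)‖ₑ ^ (1 / Y)) ^ (Y / Z) ≤ 1 →
    ‖bB α (bW (α * (1 - Z)) f) g‖ ≤ C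

lemma bo_omega_meas (α : ℝ) : Measurable (omegaBO α) := by
  unfold omegaBO; fun_prop

lemma bE_meas (α : ℝ) : Measurable (fun w : (ℝ × ℝ) × ℝ => bE α w.1 w.2) := by
  have := bo_omega_meas α
  unfold bE; fun_prop

lemma bE_norm (α : ℝ) (z : ℝ × ℝ) (ξ : ℝ) : ‖bE α z ξ‖ = 1 := bo_norm_expI _

lemma bE_enorm (α : ℝ) (z : ℝ × ℝ) (ξ : ℝ) : ‖bE α z ξ‖ₑ = 1 := bo_enorm_expI _

lemma bW_meas (e : ℝ) (f : ℝ → ℂ) (hf : Measurable f) : Measurable (bW e f) := by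
  unfold bW; fun_prop

lemma bo_integrable_of_bdd {A : Type*} [MeasurableSpace A] (μ : Measure A) (f : A → ℂ) (hf : Measurable f) (S : Set A)
    (hS : MeasurableSet S) (hS' : μ S ≠ ⊤) (K : ℝ) (h0 : ∀ a, a ∉ S → f a = 0) (hb : ∀ a ∈ S, ‖f a‖ ≤ K) : Integrable f μ := by
  have h1 : IntegrableOn f S μ := by
    refine Measure.integrableOn_of_bounded (M := K) hS' hf.aestronglyMeasurable ?_
    filter_upwards [self_mem_ae_restrict hS] with a ha using hb a ha
  have : f = S.indicator f := by
    ext a; by_cases h : a ∈ S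
    · simp [h]
    · simp [h, h0 a h]
  rw [this]
  exact (integrable_indicator_iff hS).2 h1

lemma goodF.bW_integrable {M : ℝ} {f : ℝ → ℂ} (hM : 1 ≤ M) (hf : goodF M f) (e : ℝ) : Integrable (bW e f) := by
  have hM0 : 0 < M := by linarith
  refine bo_integrable_of_bdd volume _ (bW_meas e f hf.1) (Set.Icc M⁻¹ M) measurableSet_Icc (by simp) (M ^ |e| * M) ?_ ?_
  · intro a ha
    unfold bW
    by_cases h : f a = 0
    · simp [h]
    · exact absurd ⟨(hf.2 a h).1, (hf.2 a h).2.1⟩ ha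
  · intro a ha
    unfold bW
    have ha0 : 0 < a := lt_of_lt_of_le (by positivity) ha.1
    by_cases h : f a = 0
    · simp [h]; positivity
    have hn := (hf.2 a h).2.2.2
    rw [norm_mul, Complex.norm_real, Real.norm_of_nonneg (by positivity), abs_of_pos ha0]
    have : a ^ e ≤ M ^ |e| := by
      rcases le_or_gt 0 e with he | he
      · rw [abs_of_nonneg he]; exact Real.rpow_le_rpow ha0.le ha.2 he
      · rw [abs_of_neg he, Real.rpow_neg hM0.le, ← Real.inv_rpow hM0.le]
        exact Real.rpow_le_rpow_of_nonpos (by positivity) ha.1 he.le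
    gcongr

lemma bW_zero (f : ℝ → ℂ) : bW 0 f = f := by
  ext ξ; simp [bW]

lemma goodG.integrable {M : ℝ} {g : ℝ × ℝ → ℂ} (hg : goodG M g) : Integrable g := by
  refine bo_integrable_of_bdd volume _ hg.1 (Set.Icc (-M) M ×ˢ Set.Icc (-M) M) (measurableSet_Icc.prod measurableSet_Icc) ?_ M ?_ ?_
  · rw [Measure.volume_eq_prod, Measure.prod_prod]; simp only [Real.volume_Icc]; finiteness
  · intro z hz
    by_contra h
    have := hg.2 z h
    exact hz ⟨abs_le.1 this.1, abs_le.1 this.2.1⟩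
  · intro z hz
    by_cases h : g z = 0
    · have h1 : |z.1| ≤ M := abs_le.2 hz.1
      simp [h]; exact (abs_nonneg _).trans h1
    · exact (hg.2 z h).2.2.2.1

lemma bB_int (α : ℝ) (f : ℝ → ℂ) (g : ℝ × ℝ → ℂ) (hf : Integrable f) (hg : Integrable g) :
    Integrable (fun w : (ℝ × ℝ) × ℝ => g w.1 * f w.2 * bE α w.1 w.2) := by
  refine (hg.mul_prod hf).mul_bdd (c := 1) (bE_meas α).aestronglyMeasurable ?_
  exact Filter.Eventually.of_forall fun w => (bE_norm α _ _).le

lemma bB_left (α : ℝ) (f : ℝ → ℂ) (g : ℝ × ℝ → ℂ) (hf : Integrable f) (hg : Integrable g) :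
    bB α f g = ∫ z : ℝ × ℝ, g z * ∫ ξ, f ξ * bE α z ξ := by
  unfold bB
  rw [Measure.volume_eq_prod, integral_prod _ (bB_int α f g hf hg)]
  congr 1; ext z
  rw [← integral_const_mul]; congr 1; ext ξ; ring

lemma bB_right (α : ℝ) (f : ℝ → ℂ) (g : ℝ × ℝ → ℂ) (hf : Integrable f) (hg : Integrable g) :
    bB α f g = ∫ ξ, f ξ * ∫ z : ℝ × ℝ, g z * bE α z ξ := by
  unfold bB
  rw [Measure.volume_eq_prod, integral_prod_symm _ (bB_int α f g hf hg)]
  congr 1; ext z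
  rw [← integral_const_mul]; congr 1; ext ξ; ring

lemma bB_left_le (α : ℝ) (f : ℝ → ℂ) (g : ℝ × ℝ → ℂ) (hf : Integrable f) (hg : Integrable g) :
    ‖bB α f g‖ₑ ≤ ∫⁻ z : ℝ × ℝ, ‖g z‖ₑ * ‖∫ ξ, f ξ * bE α z ξ‖ₑ := by
  rw [bB_left α f g hf hg]
  refine (enorm_integral_le_lintegral_enorm _).trans (le_of_eq ?_)
  congr 1; ext z; rw [enorm_mul]

/-- The `TT*` expansion. -/
lemma bo_TT {A B : Type*} [MeasurableSpace A] [MeasurableSpace B] (μ : Measure A) (ν : Measure B) [SFinite μ] [SFinite ν]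
    (F : A → ℂ) (hFm : Measurable F) (hF : Integrable F μ) (m : B → ℝ) (hmm : Measurable m) (hm0 : ∀ b, 0 ≤ m b) (hm : Integrable m ν)
    (e : A → B → ℂ) (he : Measurable (fun w : A × B => e w.1 w.2)) (he1 : ∀ a b, ‖e a b‖ = 1) :
    ∫⁻ b, ENNReal.ofReal (m b) * ‖∫ a, F a * e a b ∂μ‖ₑ ^ 2 ∂ν
      ≤ ∫⁻ a, ∫⁻ a', ‖F a‖ₑ * ‖F a'‖ₑ * ‖∫ b, (m b : ℂ) * (e a b * (starRingEnd ℂ) (e a' b)) ∂ν‖ₑ ∂μ ∂μ := by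
  have hh : Integrable (fun z : A × A => F z.1 * (starRingEnd ℂ) (F z.2)) (μ.prod μ) := by
    refine hF.mul_prod (g := fun y => (starRingEnd ℂ) (F y)) ?_
    exact (LinearIsometryEquiv.integrable_comp_iff (Complex.conjLIE)).2 hF
  have hconj : Measurable (starRingEnd ℂ) := Complex.continuous_conj.measurable
  have hmC : Integrable (fun b => (m b : ℂ)) ν := hm.ofReal
  have hT : Integrable (fun w : B × (A × A) => (e w.2.1 w.1 * (starRingEnd ℂ) (e w.2.2 w.1)) *
      ((m w.1 : ℂ) * (F w.2.1 * (starRingEnd ℂ) (F w.2.2)))) (ν.prod (μ.prod μ)) := by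
    refine (hmC.mul_prod hh).bdd_mul (c := 1) ?_ ?_
    · apply Measurable.aestronglyMeasurable
      have e1 : Measurable (fun w : B × (A × A) => e w.2.1 w.1) := he.comp (f := fun w : B × (A × A) => (w.2.1, w.1)) (by fun_prop)
      have e2 : Measurable (fun w : B × (A × A) => e w.2.2 w.1) := he.comp (f := fun w : B × (A × A) => (w.2.2, w.1)) (by fun_prop)
      exact e1.mul (hconj.comp e2)
    · refine Filter.Eventually.of_forall fun w => ?_
      rw [norm_mul, RCLike.norm_conj, he1, he1]; norm_num
  set T : B → ℂ := fun b => ∫ a, F a * e a b ∂μ with hTdef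
  have e1 : ∀ b, ((m b * ‖T b‖ ^ 2 : ℝ) : ℂ) =
      ∫ z : A × A, (e z.1 b * (starRingEnd ℂ) (e z.2 b)) *
      ((m b : ℂ) * (F z.1 * (starRingEnd ℂ) (F z.2))) ∂(μ.prod μ) := by
    intro b
    have : ((‖T b‖ ^ 2 : ℝ) : ℂ) = T b * (starRingEnd ℂ) (T b) := by
      rw [Complex.mul_conj, Complex.normSq_eq_norm_sq]
    rw [Complex.ofReal_mul, this]
    simp only [hTdef]
    rw [← integral_conj, ← integral_prod_mul, ← integral_const_mul]
    congr 1; ext z; rw [map_mul]; ring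
  have hreal : Integrable (fun b => m b * ‖T b‖ ^ 2) ν := by
    have h2 : Integrable (fun b => ((m b * ‖T b‖ ^ 2 : ℝ) : ℂ)) ν := by
      refine hT.integral_prod_left.congr (Filter.Eventually.of_forall fun a => ?_)
      exact (e1 a).symm
    exact h2.re
  have e2 : ((∫ b, m b * ‖T b‖ ^ 2 ∂ν : ℝ) : ℂ) =
      ∫ z : A × A, (∫ b, (m b : ℂ) * (e z.1 b * (starRingEnd ℂ) (e z.2 b)) ∂ν) *
        (F z.1 * (starRingEnd ℂ) (F z.2)) ∂(μ.prod μ) := by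
    rw [← integral_complex_ofReal]
    simp_rw [e1]
    have := integral_integral_swap (f := fun (b : B) (z : A × A) => (e z.1 b * (starRingEnd ℂ) (e z.2 b)) *
      ((m b : ℂ) * (F z.1 * (starRingEnd ℂ) (F z.2)))) hT
    refine this.trans ?_
    congr 1; ext z
    rw [← integral_mul_const]
    congr 1; ext a; ring
  have e3 : ∫⁻ b, ENNReal.ofReal (m b) * ‖T b‖ₑ ^ 2 ∂ν
      = ‖((∫ b, m b * ‖T b‖ ^ 2 ∂ν : ℝ) : ℂ)‖ₑ := by
    have hnn : 0 ≤ ∫ b, m b * ‖T b‖ ^ 2 ∂ν := integral_nonneg fun a => mul_nonneg (hm0 a) (by positivity)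
    rw [← ofReal_norm, Complex.norm_real, Real.norm_of_nonneg hnn,
      ofReal_integral_eq_lintegral_ofReal hreal (Filter.Eventually.of_forall fun a => mul_nonneg (hm0 a) (by positivity))]
    congr 1; ext a
    rw [ENNReal.ofReal_mul (hm0 a), ENNReal.ofReal_pow (by positivity), ofReal_norm]
  rw [e3, e2]
  refine (enorm_integral_le_lintegral_enorm _).trans ?_
  have hk : Measurable (fun z : A × A => ∫ b, (m b : ℂ) * (e z.1 b * (starRingEnd ℂ) (e z.2 b)) ∂ν) := by
    have : StronglyMeasurable (fun w : (A × A) × B => (m w.2 : ℂ) * (e w.1.1 w.2 * (starRingEnd ℂ) (e w.1.2 w.2))) := by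
      apply Measurable.stronglyMeasurable
      have e1 : Measurable (fun w : (A × A) × B => e w.1.1 w.2) := he.comp (f := fun w : (A × A) × B => (w.1.1, w.2)) (by fun_prop)
      have e2 : Measurable (fun w : (A × A) × B => e w.1.2 w.2) := he.comp (f := fun w : (A × A) × B => (w.1.2, w.2)) (by fun_prop)
      exact (by fun_prop : Measurable (fun w : (A × A) × B => (m w.2 : ℂ))).mul (e1.mul (hconj.comp e2))
    exact this.integral_prod_right.measurable
  have hpr : ∫⁻ a, ∫⁻ a', ‖F a‖ₑ * ‖F a'‖ₑ * ‖∫ b, (m b : ℂ) * (e a b * (starRingEnd ℂ) (e a' b)) ∂ν‖ₑ ∂μ ∂μ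
     = ∫⁻ z : A × A, ‖F z.1‖ₑ * ‖F z.2‖ₑ * ‖∫ b, (m b : ℂ) * (e z.1 b * (starRingEnd ℂ) (e z.2 b)) ∂ν‖ₑ ∂(μ.prod μ) :=
    (lintegral_prod (fun z : A × A => ‖F z.1‖ₑ * ‖F z.2‖ₑ * ‖∫ b, (m b : ℂ) * (e z.1 b * (starRingEnd ℂ) (e z.2 b)) ∂ν‖ₑ) 
      (by fun_prop)).symm
  rw [hpr]
  apply lintegral_mono
  intro z
  beta_reduce
  rw [enorm_mul, enorm_mul, RCLike.enorm_conj]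
  apply le_of_eq; ring

lemma bo_le_of_enorm {z : ℂ} {C : ℝ≥0∞} (hC : C ≠ ⊤) (h : ‖z‖ₑ ≤ C) : ‖z‖ ≤ C.toReal := by
  rw [← toReal_enorm]; exact ENNReal.toReal_mono hC h

lemma bU_meas (α : ℝ) (f : ℝ → ℂ) (hfm : Measurable f) : Measurable (fun z : ℝ × ℝ => ∫ ξ, f ξ * bE α z ξ) := by
  have : StronglyMeasurable (fun w : (ℝ × ℝ) × ℝ => f w.2 * bE α w.1 w.2) := by
    apply Measurable.stronglyMeasurable
    have := bE_meas α
    fun_prop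
  exact this.integral_prod_right.measurable

/-- Base point A. -/
lemma bD_A (α : ℝ) : bD α 1 1 := by
  refine ⟨1, fun M f g hM hf hg h1 h2 => ?_⟩
  norm_num at h1 h2
  have hF := hf.bW_integrable hM 0
  rw [bW_zero] at hF
  norm_num
  rw [bW_zero]
  have : ‖bB α f g‖ₑ ≤ 1 := by
    refine (bB_left_le α f g hF hg.integrable).trans ?_
    have e : ∀ z, ‖∫ ξ, f ξ * bE α z ξ‖ₑ ≤ 1 := by
      intro z
      refine (enorm_integral_le_lintegral_enorm _).trans ?_
      simp_rw [enorm_mul, bE_enorm, mul_one]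
      exact h1
    calc _ ≤ ∫⁻ z : ℝ × ℝ, ‖g z‖ₑ * 1 := by
          apply lintegral_mono; intro z; beta_reduce; gcongr; exact e z
      _ ≤ 1 := by
          simp_rw [mul_one]
          have hgm := hg.1
          rw [Measure.volume_eq_prod, lintegral_prod _ (by fun_prop)]; exact h2
  simpa using bo_le_of_enorm (by simp) this

/-- Base point B. -/
lemma bD_B (α : ℝ) : bD α (1/2) 1 := by
  refine ⟨(ENNReal.ofReal (2 * Real.pi) ^ (1/2 : ℝ)).toReal, fun M f g hM hf hg h1 h2 => ?_⟩
  norm_num at h1 h2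
  have hF := hf.bW_integrable hM 0
  rw [bW_zero] at hF
  norm_num
  rw [bW_zero]
  have hgm := hg.1
  have hfm := hf.1
  have hom := bo_omega_meas α
  refine bo_le_of_enorm (by finiteness) ?_
  refine (bB_left_le α f g hF hg.integrable).trans ?_
  set ft : ℝ → ℝ → ℂ := fun t ξ => Complex.exp (Complex.I * ((t * omegaBO α ξ : ℝ) : ℂ)) * f ξ with hft
  have e : ∀ t x, ∫ ξ, f ξ * bE α (t, x) ξ = bft (ft t) x := by
    intro t x
    unfold bft bE
    congr 1; ext ξ
    simp only [hft]
    rw [← mul_assoc, ← Complex.exp_add, mul_comm (f ξ)]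
    congr 2; push_cast; ring
  have hum := bU_meas α f hfm
  rw [Measure.volume_eq_prod, lintegral_prod _ (by fun_prop)]
  have key : ∀ t, ∫⁻ x, ‖g (t, x)‖ₑ * ‖∫ ξ, f ξ * bE α (t, x) ξ‖ₑ ≤
      (∫⁻ x, ‖g (t, x)‖ₑ ^ 2) ^ (1/2 : ℝ) * ENNReal.ofReal (2 * Real.pi) ^ (1/2 : ℝ) := by
    intro t
    have := ENNReal.lintegral_mul_le_Lp_mul_Lq volume (p := 2) (q := 2) (by constructor <;> norm_num)
      (f := fun x => ‖g (t, x)‖ₑ) (g := fun x => ‖∫ ξ, f ξ * bE α (t, x) ξ‖ₑ) (by fun_prop)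
      ((hum.comp (by fun_prop : Measurable fun x : ℝ => (t, x))).enorm.aemeasurable)
    refine this.trans ?_
    simp only [ENNReal.rpow_two]
    gcongr
    simp_rw [e]
    refine (bo_plancherel (ft t) (by fun_prop) ?_).trans ?_
    · refine hF.bdd_mul (c := 1) ?_ ?_
      · apply Measurable.aestronglyMeasurable; fun_prop
      · exact Filter.Eventually.of_forall fun ξ => (bo_norm_expI _).le
    · have : ∀ ξ, ‖ft t ξ‖ₑ = ‖f ξ‖ₑ := by
        intro ξ; simp only [hft]; rw [enorm_mul, bo_enorm_expI, one_mul]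
      simp_rw [this]
      refine (mul_le_mul_right h1 _).trans (by simp)
  refine (lintegral_mono key).trans ?_
  rw [lintegral_mul_const _ (by fun_prop)]
  refine (mul_le_mul_left h2 _).trans (by simp)

lemma bo_amgm (a b : ℝ≥0∞) : a * b ≤ a ^ 2 + b ^ 2 := by
  rcases le_total a b with h | h
  · calc a * b ≤ b * b := by gcongr
      _ = b ^ 2 := by ring
      _ ≤ _ := le_add_self
  · calc a * b ≤ a * a := by gcongr
      _ = a ^ 2 := by ring
      _ ≤ _ := le_self_add

lemma bE_mul_conj (α : ℝ) (z z' : ℝ × ℝ) (ξ : ℝ) : bE α z ξ * (starRingEnd ℂ) (bE α z' ξ) =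
    Complex.exp (Complex.I * (((z.2 - z'.2) * ξ + (z.1 - z'.1) * omegaBO α ξ : ℝ) : ℂ)) := by
  unfold bE
  rw [bo_conj_expI, ← Complex.exp_add]
  congr 1; push_cast; ring

lemma bE_mul_conj' (α : ℝ) (z : ℝ × ℝ) (ξ η : ℝ) : bE α z ξ * (starRingEnd ℂ) (bE α z η) =
    Complex.exp (Complex.I * ((z.2 * (ξ - η) + z.1 * (omegaBO α ξ - omegaBO α η) : ℝ) : ℂ)) := by
  unfold bE
  rw [bo_conj_expI, ← Complex.exp_add]
  congr 1; push_cast; ring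

/-- Base point C. -/
lemma bD_C (α : ℝ) (hα0 : 0 < α) (hα1 : α ≤ 1) : bD α 1 (3/4) := by
  obtain ⟨C, hC, hls⟩ := bo_hls (1/2) (by norm_num) (by norm_num)
  refine ⟨(1 + ENNReal.ofReal 100 * C).toReal, fun M f g hM hf hg h1 h2 => ?_⟩
  norm_num at h1 h2
  have hM0 : 0 < M := by linarith
  have hMi : M⁻¹ ≤ M := (inv_le_one_of_one_le₀ hM).trans hM
  have hF := hf.bW_integrable hM (α * (1 - 3/4))
  have hgm := hg.1
  have hfm := hf.1
  have hgi := hg.integrable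
  have hom := bo_omega_meas α
  have hEm := bE_meas α
  refine bo_le_of_enorm (by finiteness) ?_
  rw [bB_right α _ g hF hgi]
  refine (enorm_integral_le_lintegral_enorm _).trans ?_
  set G : ℝ → ℂ := fun ξ => ∫ z : ℝ × ℝ, g z * bE α z ξ with hG
  have hGm : Measurable G := by
    have : StronglyMeasurable (fun w : ℝ × (ℝ × ℝ) => g w.2 * bE α w.2 w.1) := by
      apply Measurable.stronglyMeasurable
      exact (hgm.comp measurable_snd).mul (hEm.comp (f := fun w : ℝ × (ℝ × ℝ) => (w.2, w.1)) (by fun_prop))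
    exact this.integral_prod_right.measurable
  set m : ℝ → ℝ := (Set.Ioc M⁻¹ M).indicator (fun ξ => ξ ^ (α / 2)) with hm
  have hmm : Measurable m := (by fun_prop : Measurable fun ξ : ℝ => ξ ^ (α / 2)).indicator measurableSet_Ioc
  have hm0 : ∀ ξ, 0 ≤ m ξ := by
    intro ξ
    refine Set.indicator_nonneg (fun ξ hξ => ?_) ξ
    have : 0 < ξ := lt_trans (by positivity) hξ.1
    positivity
  have hmi : Integrable m := by
    rw [hm, integrable_indicator_iff measurableSet_Ioc, ← intervalIntegrable_iff_integrableOn_Ioc_of_le hMi]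
    exact intervalIntegral.intervalIntegrable_rpow' (by linarith)
  have hae : ∀ᵐ ξ : ℝ, ξ ≠ M⁻¹ := by simp [ae_iff]
  have step1 : ∫⁻ ξ, ‖bW (α * (1 - 3/4)) f ξ * G ξ‖ₑ ≤ ∫⁻ ξ, (‖f ξ‖ₑ ^ 2 + ENNReal.ofReal (m ξ) * ‖G ξ‖ₑ ^ 2) := by
    apply lintegral_mono_ae
    filter_upwards [hae] with ξ hξ
    by_cases h : f ξ = 0
    · simp [bW, h]
    obtain ⟨b1, b2, -, -⟩ := hf.2 ξ h
    have hξ0 : 0 < ξ := lt_of_lt_of_le (by positivity) b1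
    have hmξ : m ξ = (ξ ^ (α * (1 - 3/4))) ^ 2 := by
      rw [hm, Set.indicator_of_mem (show ξ ∈ Set.Ioc M⁻¹ M from ⟨lt_of_le_of_ne b1 (Ne.symm hξ), b2⟩), ← Real.rpow_natCast, ← Real.rpow_mul hξ0.le]
      congr 1; push_cast; ring
    rw [hmξ, ENNReal.ofReal_pow (by positivity), ← mul_pow]
    refine le_trans (le_of_eq ?_) (bo_amgm _ _)
    unfold bW
    rw [enorm_mul, enorm_mul, abs_of_pos hξ0, ← ofReal_norm (Complex.ofReal _), Complex.norm_real,
      Real.norm_of_nonneg (by positivity)]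
    ring
  refine step1.trans ?_
  rw [lintegral_add_left (by fun_prop)]
  refine add_le_add h1 ?_
  refine (bo_TT volume volume g hgm hgi m hmm hm0 hmi (bE α) hEm (bE_norm α)).trans ?_
  have hker : ∀ z z' : ℝ × ℝ, ‖∫ ξ, (m ξ : ℂ) * (bE α z ξ * (starRingEnd ℂ) (bE α z' ξ))‖ₑ
      ≤ ENNReal.ofReal 100 * (ENNReal.ofReal |z.1 - z'.1|) ^ (-(1/2 : ℝ)) := by
    intro z z'
    by_cases hz : z.1 - z'.1 = 0
    · rw [hz]; simp
    have : ∫ ξ, (m ξ : ℂ) * (bE α z ξ * (starRingEnd ℂ) (bE α z' ξ)) =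
        ∫ ξ in M⁻¹..M, ((ξ ^ (α / 2) : ℝ) : ℂ) * Complex.exp (Complex.I * (((z.2 - z'.2) * ξ + (z.1 - z'.1) * omegaBO α ξ : ℝ) : ℂ)) := by
      rw [intervalIntegral.integral_of_le hMi, ← integral_indicator measurableSet_Ioc]
      congr 1; ext ξ
      rw [bE_mul_conj, hm]
      by_cases h : ξ ∈ Set.Ioc M⁻¹ M
      · simp [h]
      · simp [h]
    rw [this]
    have hk := bo_kernel α hα0 hα1 M⁻¹ M (by positivity) hMi (z.2 - z'.2) (z.1 - z'.1) hz
    have habs : 0 < |z.1 - z'.1| := abs_pos.2 hz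
    rw [ENNReal.ofReal_rpow_of_pos habs, ← ENNReal.ofReal_mul (by norm_num), ← ofReal_norm]
    refine ENNReal.ofReal_le_ofReal (hk.trans (le_of_eq ?_))
    rw [Real.sqrt_eq_rpow, Real.rpow_neg habs.le]; rfl
  set N : ℝ → ℝ≥0∞ := fun t => ∫⁻ x, ‖g (t, x)‖ₑ with hN
  have hNm : Measurable N := by
    simp only [hN]; fun_prop
  calc ∫⁻ z, ∫⁻ z', ‖g z‖ₑ * ‖g z'‖ₑ * ‖∫ ξ, (m ξ : ℂ) * (bE α z ξ * (starRingEnd ℂ) (bE α z' ξ))‖ₑ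
      ≤ ∫⁻ z : ℝ × ℝ, ∫⁻ z' : ℝ × ℝ, ‖g z‖ₑ * ‖g z'‖ₑ * (ENNReal.ofReal 100 * (ENNReal.ofReal |z.1 - z'.1|) ^ (-(1/2 : ℝ))) := by
        refine lintegral_mono fun z => lintegral_mono fun z' => ?_
        beta_reduce
        gcongr; exact hker z z'
    _ = ∫⁻ z : ℝ × ℝ, ‖g z‖ₑ * ∫⁻ t', N t' * (ENNReal.ofReal 100 * (ENNReal.ofReal |z.1 - t'|) ^ (-(1/2 : ℝ))) := by
        congr 1; ext z
        rw [← lintegral_const_mul _ (by fun_prop), Measure.volume_eq_prod, lintegral_prod _ (by fun_prop)]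
        congr 1; ext t'
        simp only [hN]
        rw [← lintegral_mul_const _ (by fun_prop), ← lintegral_const_mul _ (by fun_prop)]
        simp_rw [mul_assoc]
    _ = ∫⁻ t, N t * ∫⁻ t', N t' * (ENNReal.ofReal 100 * (ENNReal.ofReal |t - t'|) ^ (-(1/2 : ℝ))) := by
        rw [Measure.volume_eq_prod, lintegral_prod _ (by fun_prop)]
        congr 1; ext t
        dsimp only
        rw [lintegral_mul_const _ (by fun_prop)]
    _ = ENNReal.ofReal 100 * ∫⁻ t, ∫⁻ t', N t * N t' * (ENNReal.ofReal |t - t'|) ^ (-(1/2 : ℝ)) := by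
        rw [← lintegral_const_mul _ (by fun_prop)]
        congr 1; ext t
        rw [← lintegral_const_mul _ (by fun_prop), ← lintegral_const_mul _ (by fun_prop)]
        congr 1; ext t'; ring
    _ ≤ ENNReal.ofReal 100 * (C * 1) := by
        gcongr
        refine (hls N hNm).trans ?_
        gcongr
        refine ENNReal.rpow_le_one ?_ (by norm_num)
        norm_num
        exact h2
    _ = _ := by rw [mul_one]

/-! ### Base point E -/

lemma bo_omega_deriv (α s : ℝ) (hs : 0 < s) : HasDerivAt (omegaBO α) (-((2 + α) * s ^ (1 + α))) s := by
  have d : HasDerivAt (fun ξ : ℝ => -ξ ^ (2 + α)) (-((2 + α) * s ^ (2 + α - 1))) s :=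
    (Real.hasDerivAt_rpow_const (Or.inl hs.ne')).neg
  rw [show 2 + α - 1 = 1 + α by ring] at d
  refine d.congr_of_eventuallyEq ?_
  filter_upwards [lt_mem_nhds hs] with y hy
  rw [bo_omega_pos α y hy]

lemma bo_cov (α : ℝ) (hα : 0 < α) (a : ℝ) (ha : a ≠ 0) (Φ : ℝ → ℝ≥0∞) :
    ∫⁻ η in Set.Ioi (max 0 (-a)), ENNReal.ofReal ((2 + α) * |(η + a) ^ (1 + α) - η ^ (1 + α)|) *
      Φ (omegaBO α (η + a) - omegaBO α η) ≤ ∫⁻ b, Φ b := by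
  set S := Set.Ioi (max 0 (-a)) with hS
  have hS1 : ∀ η ∈ S, 0 < η := fun η h => lt_of_le_of_lt (le_max_left _ _) h
  have hS2 : ∀ η ∈ S, 0 < η + a := fun η h => by
    have := lt_of_le_of_lt (le_max_right 0 (-a)) (Set.mem_Ioi.1 h); linarith
  set F : ℝ → ℝ := fun η => omegaBO α (η + a) - omegaBO α η with hF
  set F' : ℝ → ℝ := fun η => -((2 + α) * (η + a) ^ (1 + α)) - -((2 + α) * η ^ (1 + α)) with hF'
  have hd : ∀ η ∈ S, HasDerivAt F (F' η) η := by
    intro η h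
    exact ((bo_omega_deriv α (η + a) (hS2 η h)).comp_add_const η a).sub (bo_omega_deriv α η (hS1 η h))
  have hcont : ContinuousOn F S := fun η h => (hd η h).continuousAt.continuousWithinAt
  have hinter : interior S = S := isOpen_Ioi.interior_eq
  have hinj : Set.InjOn F S := by
    rcases lt_or_gt_of_ne ha with h | h
    · refine (strictMonoOn_of_deriv_pos (convex_Ioi _) hcont fun η hη => ?_).injOn
      rw [hinter] at hη
      rw [(hd η hη).deriv]
      have : (η + a) ^ (1 + α) < η ^ (1 + α) := Real.rpow_lt_rpow (hS2 η hη).le (by linarith) (by linarith)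
      simp only [hF']; nlinarith
    · refine (strictAntiOn_of_deriv_neg (convex_Ioi _) hcont fun η hη => ?_).injOn
      rw [hinter] at hη
      rw [(hd η hη).deriv]
      have : η ^ (1 + α) < (η + a) ^ (1 + α) := Real.rpow_lt_rpow (hS1 η hη).le (by linarith) (by linarith)
      simp only [hF']; nlinarith
  have := lintegral_image_eq_lintegral_abs_deriv_mul (s := S) (f := F) (f' := F') measurableSet_Ioi
    (fun η h => (hd η h).hasDerivWithinAt) hinj Φ
  calc _ = ∫⁻ η in S, ENNReal.ofReal |F' η| * Φ (F η) := by
        refine setLIntegral_congr_fun measurableSet_Ioi fun η hη => ?_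
        congr 2
        simp only [hF']
        rw [show -((2 + α) * (η + a) ^ (1 + α)) - -((2 + α) * η ^ (1 + α)) = -((2 + α) * ((η + a) ^ (1 + α) - η ^ (1 + α))) by ring,
          abs_neg, abs_mul, abs_of_pos (by linarith : 0 < 2 + α)]
    _ = ∫⁻ b in F '' S, Φ b := this.symm
    _ ≤ _ := setLIntegral_le_lintegral _ _

lemma bo_jac_aux (α : ℝ) (hα : 0 < α) (x y : ℝ) (hx : 0 < x) (hy : 0 < y) (h : y ≤ x) :
    (x * y) ^ (α / 2) * (x - y) ≤ x ^ (1 + α) - y ^ (1 + α) := by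
  have e1 : x ^ (1 + α) = x * x ^ α := by rw [Real.rpow_add hx, Real.rpow_one]
  have e2 : y ^ (1 + α) = y * y ^ α := by rw [Real.rpow_add hy, Real.rpow_one]
  have e3 : y ^ α ≤ x ^ α := Real.rpow_le_rpow hy.le h hα.le
  have e4 : (x * y) ^ (α / 2) ≤ x ^ α := by
    calc (x * y) ^ (α / 2) ≤ (x * x) ^ (α / 2) := Real.rpow_le_rpow (by positivity) (by gcongr) (by linarith)
      _ = x ^ α := by rw [Real.mul_rpow hx.le hx.le, ← Real.rpow_add hx]; congr 1; ring
  have e5 : 0 ≤ x - y := by linarith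
  have : (x * y) ^ (α / 2) * (x - y) ≤ x ^ α * (x - y) := by gcongr
  have : y * y ^ α ≤ y * x ^ α := by gcongr
  rw [e1, e2]; linarith

lemma bo_jac (α : ℝ) (hα : 0 < α) (x y : ℝ) (hx : 0 < x) (hy : 0 < y) :
    (x * y) ^ (α / 2) * |x - y| ≤ (2 + α) * |x ^ (1 + α) - y ^ (1 + α)| := by
  have h2 : |x ^ (1 + α) - y ^ (1 + α)| ≤ (2 + α) * |x ^ (1 + α) - y ^ (1 + α)| := by
    have := abs_nonneg (x ^ (1 + α) - y ^ (1 + α)); nlinarith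
  refine le_trans ?_ h2
  rcases le_total y x with h | h
  · rw [abs_of_nonneg (by linarith : 0 ≤ x - y)]
    exact (bo_jac_aux α hα x y hx hy h).trans (le_abs_self _)
  · rw [abs_sub_comm x y, abs_sub_comm (x ^ _), mul_comm x y, abs_of_nonneg (by linarith : 0 ≤ y - x)]
    exact (bo_jac_aux α hα y x hy hx h).trans (le_abs_self _)

lemma bo_E1 (α : ℝ) (hα : 0 < α) (κ : ℝ) (Q : ℝ × ℝ → ℝ≥0∞) (hQ : Measurable Q) :
    ∫⁻ ξ in Set.Ioi (0:ℝ), ∫⁻ η in Set.Ioi (0:ℝ), ENNReal.ofReal ((ξ * η) ^ (α / 2)) * (ENNReal.ofReal |ξ - η|) ^ κ *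
      Q (ξ - η, omegaBO α ξ - omegaBO α η) ≤ ∫⁻ a, (ENNReal.ofReal |a|) ^ (κ - 1) * ∫⁻ b, Q (a, b) := by
  have hom := bo_omega_meas α
  set J : ℝ → ℝ → ℝ≥0∞ := fun ξ η => (ENNReal.ofReal |ξ - η|) ^ (κ - 1) *
      (ENNReal.ofReal ((2 + α) * |ξ ^ (1 + α) - η ^ (1 + α)|) * Q (ξ - η, omegaBO α ξ - omegaBO α η)) with hJ
  set P : ℝ → ℝ → ℝ≥0∞ := fun ξ η => (Set.Ioi (0:ℝ)).indicator 1 ξ * ((Set.Ioi (0:ℝ)).indicator 1 η * J ξ η) with hP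
  have hind : Measurable ((Set.Ioi (0:ℝ)).indicator (1 : ℝ → ℝ≥0∞)) := measurable_one.indicator measurableSet_Ioi
  have hJm : Measurable (fun w : ℝ × ℝ => J w.1 w.2) := by simp only [hJ]; fun_prop
  have hPm : Measurable (fun w : ℝ × ℝ => P w.1 w.2) := by simp only [hP]; fun_prop
  have step1 : ∫⁻ ξ in Set.Ioi (0:ℝ), ∫⁻ η in Set.Ioi (0:ℝ), ENNReal.ofReal ((ξ * η) ^ (α / 2)) * (ENNReal.ofReal |ξ - η|) ^ κ *
      Q (ξ - η, omegaBO α ξ - omegaBO α η) ≤ ∫⁻ ξ, ∫⁻ η, P ξ η := by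
    rw [← lintegral_indicator measurableSet_Ioi]
    refine lintegral_mono fun ξ => ?_
    by_cases hξ : ξ ∈ Set.Ioi (0:ℝ)
    swap
    · simp [hξ]
    rw [Set.indicator_of_mem hξ, ← lintegral_indicator measurableSet_Ioi]
    have hne : ∀ᵐ η : ℝ, η ≠ ξ := by simp [ae_iff]
    refine lintegral_mono_ae ?_
    filter_upwards [hne] with η hηξ
    by_cases hη : η ∈ Set.Ioi (0:ℝ)
    swap
    · simp [hη]
    simp only [hP]
    rw [Set.indicator_of_mem hη, Set.indicator_of_mem hξ, Set.indicator_of_mem hη]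
    simp only [Pi.one_apply, one_mul, hJ]
    rw [← mul_assoc]
    refine mul_le_mul_left ?_ _
    have hd : 0 < |ξ - η| := abs_pos.2 (sub_ne_zero.2 (Ne.symm hηξ))
    have hξ0 : 0 < ξ := hξ
    have hη0 : 0 < η := hη
    rw [ENNReal.ofReal_rpow_of_pos hd, ENNReal.ofReal_rpow_of_pos hd, ← ENNReal.ofReal_mul (by positivity),
      ← ENNReal.ofReal_mul (by positivity)]
    refine ENNReal.ofReal_le_ofReal ?_
    have := bo_jac α hα ξ η hξ0 hη0
    calc (ξ * η) ^ (α / 2) * |ξ - η| ^ κ = |ξ - η| ^ (κ - 1) * ((ξ * η) ^ (α / 2) * |ξ - η|) := by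
          rw [show |ξ - η| ^ κ = |ξ - η| ^ (κ - 1) * |ξ - η| by
            rw [Real.rpow_sub hd, Real.rpow_one]; field_simp]
          ring
      _ ≤ _ := by gcongr
  refine step1.trans ?_
  rw [lintegral_lintegral_swap hPm.aemeasurable]
  have step2 : ∀ η, ∫⁻ ξ, P ξ η = ∫⁻ a, P (η + a) η := fun η => (lintegral_add_left_eq_self (fun ξ => P ξ η) η).symm
  simp_rw [step2]
  have hsw : Measurable (Function.uncurry fun η a : ℝ => P (η + a) η) :=
    hPm.comp (by fun_prop : Measurable (fun w : ℝ × ℝ => (w.1 + w.2, w.1)))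
  rw [lintegral_lintegral_swap hsw.aemeasurable]
  have hne : ∀ᵐ a : ℝ, a ≠ 0 := by simp [ae_iff]
  refine lintegral_mono_ae ?_
  filter_upwards [hne] with a ha
  calc ∫⁻ η, P (η + a) η = ∫⁻ η in Set.Ioi (max 0 (-a)), (ENNReal.ofReal |a|) ^ (κ - 1) *
         (ENNReal.ofReal ((2 + α) * |(η + a) ^ (1 + α) - η ^ (1 + α)|) * Q (a, omegaBO α (η + a) - omegaBO α η)) := by
        rw [← lintegral_indicator measurableSet_Ioi]
        congr 1; ext η
        simp only [hP, hJ]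
        by_cases h1 : η ∈ Set.Ioi (0:ℝ)
        · by_cases h2 : η + a ∈ Set.Ioi (0:ℝ)
          · have h3 : η ∈ Set.Ioi (max 0 (-a)) := by
              refine Set.mem_Ioi.2 (max_lt h1 ?_); have := Set.mem_Ioi.1 h2; linarith
            rw [Set.indicator_of_mem h1, Set.indicator_of_mem h2, Set.indicator_of_mem h3]
            simp [add_sub_cancel_left]
          · have h3 : η ∉ Set.Ioi (max 0 (-a)) := by
              intro h; apply h2; have := lt_of_le_of_lt (le_max_right 0 (-a)) (Set.mem_Ioi.1 h)
              refine Set.mem_Ioi.2 (by linarith)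
            rw [Set.indicator_of_notMem h2, Set.indicator_of_notMem h3, zero_mul]
        · have h3 : η ∉ Set.Ioi (max 0 (-a)) := fun h => h1 (lt_of_le_of_lt (le_max_left 0 (-a)) (Set.mem_Ioi.1 h))
          rw [Set.indicator_of_notMem h1, Set.indicator_of_notMem h3, zero_mul, mul_zero]
    _ = (ENNReal.ofReal |a|) ^ (κ - 1) * ∫⁻ η in Set.Ioi (max 0 (-a)), 
         (ENNReal.ofReal ((2 + α) * |(η + a) ^ (1 + α) - η ^ (1 + α)|) * Q (a, omegaBO α (η + a) - omegaBO α η)) := by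
        rw [lintegral_const_mul _ (by fun_prop)]
    _ ≤ _ := by
        exact mul_le_mul_right (bo_cov α hα a ha (fun b => Q (a, b))) _

/-- Space-time Fourier integral. -/
noncomputable def bH (h : ℝ × ℝ → ℂ) (w : ℝ × ℝ) : ℂ :=
  ∫ z : ℝ × ℝ, Complex.exp (Complex.I * ((z.2 * w.1 + z.1 * w.2 : ℝ) : ℂ)) * h z

lemma bH_meas (h : ℝ × ℝ → ℂ) (hm : Measurable h) : Measurable (bH h) := by
  have : StronglyMeasurable (fun w : (ℝ × ℝ) × (ℝ × ℝ) => Complex.exp (Complex.I * ((w.2.2 * w.1.1 + w.2.1 * w.1.2 : ℝ) : ℂ)) * h w.2) := by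
    apply Measurable.stronglyMeasurable; fun_prop
  exact this.integral_prod_right.measurable

lemma bH_eq (h : ℝ × ℝ → ℂ) (hi : Integrable h) (a b : ℝ) :
    bH h (a, b) = bft (fun t => bft (fun x => h (t, x)) a) b := by
  unfold bH bft
  rw [Measure.volume_eq_prod, integral_prod]
  · congr 1; ext t
    rw [← integral_const_mul]
    congr 1; ext x
    rw [← mul_assoc, ← Complex.exp_add]
    congr 2; push_cast; ring
  · refine Integrable.bdd_mul hi (c := 1) ?_ ?_
    · apply Measurable.aestronglyMeasurable; fun_prop
    · exact Filter.Eventually.of_forall fun ξ => (bo_norm_expI _).le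

lemma bo_E2 (α : ℝ) (hα : 0 < α) (κ : ℝ) (hκ0 : 0 < κ) (hκ1 : κ < 1) :
    ∃ C : ℝ≥0∞, C ≠ ⊤ ∧ ∀ h : ℝ × ℝ → ℂ, Measurable h → Integrable h →
      ∫⁻ ξ in Set.Ioi (0:ℝ), ∫⁻ η in Set.Ioi (0:ℝ), ENNReal.ofReal ((ξ * η) ^ (α / 2)) * (ENNReal.ofReal |ξ - η|) ^ κ *
      ‖bH h (ξ - η, omegaBO α ξ - omegaBO α η)‖ₑ ^ 2 ≤ C * ∫⁻ t, (∫⁻ x, ‖h (t, x)‖ₑ ^ (2 / (2 - κ))) ^ (2 - κ) := by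
  obtain ⟨C1, hC1, hls⟩ := bo_hls κ hκ0 hκ1
  obtain ⟨C2, hC2, hpitt⟩ := bo_pitt κ hκ0 hκ1
  refine ⟨ENNReal.ofReal (2 * Real.pi) * (C2 * C1), by finiteness, fun h hm hi => ?_⟩
  have hHm := bH_meas h hm
  refine (bo_E1 α hα κ (fun w => ‖bH h w‖ₑ ^ 2) (by fun_prop)).trans ?_
  have hbm : Measurable (fun w : ℝ × ℝ => bft (fun x => h (w.1, x)) w.2) := by
    have : StronglyMeasurable (fun w : (ℝ × ℝ) × ℝ => Complex.exp (Complex.I * ((w.2 * w.1.2 : ℝ) : ℂ)) * h (w.1.1, w.2)) := by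
      apply Measurable.stronglyMeasurable; fun_prop
    exact this.integral_prod_right.measurable
  have hplan : ∀ a, ∫⁻ b, ‖bH h (a, b)‖ₑ ^ 2 ≤ ENNReal.ofReal (2 * Real.pi) * ∫⁻ t, ‖bft (fun x => h (t, x)) a‖ₑ ^ 2 := by
    intro a
    simp_rw [bH_eq h hi]
    refine bo_plancherel _ (hbm.comp (by fun_prop : Measurable fun t : ℝ => (t, a))) ?_
    have : Integrable (fun z : ℝ × ℝ => Complex.exp (Complex.I * ((z.2 * a : ℝ) : ℂ)) * h z) := by
      refine Integrable.bdd_mul hi (c := 1) ?_ ?_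
      · apply Measurable.aestronglyMeasurable; fun_prop
      · exact Filter.Eventually.of_forall fun ξ => (bo_norm_expI _).le
    exact this.integral_prod_left
  have hae : ∀ᵐ t : ℝ, Integrable (fun x => h (t, x)) := by
    have : Integrable h (volume.prod volume) := hi
    exact this.prod_right_ae
  calc ∫⁻ a, (ENNReal.ofReal |a|) ^ (κ - 1) * ∫⁻ b, ‖bH h (a, b)‖ₑ ^ 2
      ≤ ∫⁻ a, ENNReal.ofReal (2 * Real.pi) * ∫⁻ t, (ENNReal.ofReal |a|) ^ (κ - 1) * ‖bft (fun x => h (t, x)) a‖ₑ ^ 2 := by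
        refine lintegral_mono fun a => ?_
        beta_reduce
        have m1 : Measurable (fun t : ℝ => ‖bft (fun x => h (t, x)) a‖ₑ ^ 2) :=
          (hbm.comp (by fun_prop : Measurable fun t : ℝ => (t, a))).enorm.pow_const 2
        rw [lintegral_const_mul _ m1, ← mul_assoc,
          mul_comm (ENNReal.ofReal (2 * Real.pi)), mul_assoc]
        gcongr
        exact hplan a
    _ = ENNReal.ofReal (2 * Real.pi) * ∫⁻ t, ∫⁻ a, (ENNReal.ofReal |a|) ^ (κ - 1) * ‖bft (fun x => h (t, x)) a‖ₑ ^ 2 := by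
        rw [lintegral_const_mul, lintegral_lintegral_swap]
        · refine AEMeasurable.mul (by fun_prop) ?_
          exact ((hbm.comp (by fun_prop : Measurable fun w : ℝ × ℝ => (w.2, w.1))).enorm.pow_const 2).aemeasurable
        · refine Measurable.lintegral_prod_right' (f := fun w : ℝ × ℝ => (ENNReal.ofReal |w.1|) ^ (κ - 1) * ‖bft (fun x => h (w.2, x)) w.1‖ₑ ^ 2) ?_
          refine Measurable.mul (by fun_prop) ?_
          exact ((hbm.comp (by fun_prop : Measurable fun w : ℝ × ℝ => (w.2, w.1))).enorm.pow_const 2)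
    _ ≤ ENNReal.ofReal (2 * Real.pi) * ∫⁻ t, C2 * (C1 * (∫⁻ x, ‖h (t, x)‖ₑ ^ (2 / (2 - κ))) ^ (2 - κ)) := by
        refine mul_le_mul_right (lintegral_mono_ae ?_) _
        filter_upwards [hae] with t ht
        refine (hpitt _ (by fun_prop) ht).trans ?_
        gcongr
        exact hls (fun x => ‖h (t, x)‖ₑ) (by fun_prop)
    _ = _ := by
        simp_rw [← mul_assoc C2 C1]
        rw [lintegral_const_mul _ (by fun_prop)]; ring

lemma goodG.slice {M : ℝ} {g : ℝ × ℝ → ℂ} (hM : 1 ≤ M) (hg : goodG M g) (e : ℝ) (he : 0 < e) :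
    ∃ K : ℝ, 1 ≤ K ∧ (∀ t, ∫⁻ x, ‖g (t, x)‖ₑ ^ e ≤ ENNReal.ofReal K) ∧
      ∀ z, g z ≠ 0 → ENNReal.ofReal K⁻¹ ≤ ∫⁻ x, ‖g (z.1, x)‖ₑ ^ e := by
  have hM0 : 0 < M := by linarith
  have hgm := hg.1
  have h1 : 1 ≤ M ^ e := Real.one_le_rpow hM he.le
  refine ⟨M ^ e * (2 * M), by nlinarith, fun t => ?_, fun z hz => ?_⟩
  · calc ∫⁻ x, ‖g (t, x)‖ₑ ^ e ≤ ∫⁻ x, (Set.Icc (-M) M).indicator (fun _ => ENNReal.ofReal (M ^ e)) x := by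
          refine lintegral_mono fun x => ?_
          by_cases h : g (t, x) = 0
          · simp [h, he]
          have := hg.2 _ h
          rw [Set.indicator_of_mem (show x ∈ Set.Icc (-M) M from abs_le.1 this.2.1), ← ofReal_norm,
            ENNReal.ofReal_rpow_of_nonneg (by positivity) he.le]
          exact ENNReal.ofReal_le_ofReal (Real.rpow_le_rpow (by positivity) this.2.2.2.1 he.le)
      _ = ENNReal.ofReal (M ^ e * (2 * M)) := by
          rw [lintegral_indicator measurableSet_Icc, setLIntegral_const, Real.volume_Icc, ENNReal.ofReal_mul (by positivity)]
          congr 2; ring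
  · have hz2 := (hg.2 z hz).2.2.2.2
    have hSm : MeasurableSet {x : ℝ | g (z.1, x) ≠ 0} := by
      have : Measurable fun x : ℝ => g (z.1, x) := by fun_prop
      exact this (measurableSet_singleton 0).compl
    calc ENNReal.ofReal (M ^ e * (2 * M))⁻¹ ≤ ENNReal.ofReal (M⁻¹ ^ e) * ENNReal.ofReal M⁻¹ := by
          rw [← ENNReal.ofReal_mul (by positivity)]
          refine ENNReal.ofReal_le_ofReal ?_
          rw [Real.inv_rpow hM0.le, ← mul_inv]
          gcongr
          linarith
      _ ≤ ENNReal.ofReal (M⁻¹ ^ e) * volume {x : ℝ | g (z.1, x) ≠ 0} := by gcongr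
      _ = ∫⁻ x, ({x : ℝ | g (z.1, x) ≠ 0}).indicator (fun _ => ENNReal.ofReal (M⁻¹ ^ e)) x := by
          rw [lintegral_indicator hSm, setLIntegral_const]
      _ ≤ _ := by
          refine lintegral_mono fun x => ?_
          by_cases h : g (z.1, x) = 0
          · rw [Set.indicator_of_notMem (by simpa using h)]; exact zero_le
          rw [Set.indicator_of_mem (by simpa using h), ← ofReal_norm, ENNReal.ofReal_rpow_of_nonneg (by positivity) he.le]
          exact ENNReal.ofReal_le_ofReal (Real.rpow_le_rpow (by positivity) (hg.2 _ h).2.2.1 he.le)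

lemma bD_E (α : ℝ) (hα0 : 0 < α) (y : ℝ) (hy0 : 3/4 < y) (hy1 : y < 1) : bD α y (3/4) := by
  set κ := 4 * (1 - y) with hκ
  have hκ0 : 0 < κ := by rw [hκ]; linarith
  have hκ1 : κ < 1 := by rw [hκ]; linarith
  have hy : 0 < y := by linarith
  obtain ⟨C1, hC1, hls⟩ := bo_hls κ hκ0 hκ1
  obtain ⟨C2, hC2, hE2⟩ := bo_E2 α hα0 κ hκ0 hκ1
  refine ⟨(1 + (C1 + C2)).toReal, fun M f g hM hf hg h1 h2 => ?_⟩
  have hM0 : 0 < M := by linarith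
  have hF := hf.bW_integrable hM (α * (1 - 3/4))
  have hgm := hg.1
  have hfm := hf.1
  have hgi := hg.integrable
  have hom := bo_omega_meas α
  have hEm := bE_meas α
  have hWm := bW_meas (α * (1 - 3/4)) f hfm
  obtain ⟨K, hK1, hKu, hKl⟩ := hg.slice hM (1 / y) (by positivity)
  have hK0 : 0 < K := by linarith
  refine bo_le_of_enorm (by finiteness) ?_
  set Ie : ℝ → ℝ≥0∞ := fun t => ∫⁻ x, ‖g (t, x)‖ₑ ^ (1 / y) with hIe
  have hIem : Measurable Ie := by simp only [hIe]; fun_prop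
  set Ir : ℝ → ℝ := fun t => (Ie t).toReal with hIr
  have hIrm : Measurable Ir := by simp only [hIr]; fun_prop
  have hIfin : ∀ t, Ie t ≠ ⊤ := fun t => ne_top_of_le_ne_top (by finiteness) (hKu t)
  have hIeq : ∀ t, Ie t = ENNReal.ofReal (Ir t) := fun t => (ENNReal.ofReal_toReal (hIfin t)).symm
  have hIlow : ∀ z, g z ≠ 0 → K⁻¹ ≤ Ir z.1 := by
    intro z hz
    have := hKl z hz
    exact (ENNReal.ofReal_le_iff_le_toReal (hIfin z.1)).1 this
  have hIpos : ∀ z, g z ≠ 0 → 0 < Ir z.1 := fun z hz => lt_of_lt_of_le (by positivity) (hIlow z hz)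
  have hyi : 1 / y < 4 / 3 := by rw [div_lt_div_iff₀ hy (by norm_num)]; linarith
  set hr : ℝ × ℝ → ℝ := fun z => ‖g z‖ ^ (2 - 1 / y) * (Ir z.1) ^ (1 - 4 * y / 3) with hhr
  have hrm : Measurable hr := by simp only [hhr]; fun_prop
  have hr0 : ∀ z, 0 ≤ hr z := fun z => by simp only [hhr]; positivity
  have hrz : ∀ z, g z = 0 → hr z = 0 := by
    intro z hz; simp only [hhr]; rw [hz, norm_zero, Real.zero_rpow (by linarith), zero_mul]
  set h : ℝ × ℝ → ℂ := fun z => (hr z : ℂ) with hh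
  have hhm : Measurable h := by simp only [hh]; fun_prop
  have hhi : Integrable h := by
    refine bo_integrable_of_bdd volume _ hhm (Set.Icc (-M) M ×ˢ Set.Icc (-M) M) (measurableSet_Icc.prod measurableSet_Icc) ?_
      (M ^ (2 - 1 / y) * (K⁻¹) ^ (1 - 4 * y / 3)) ?_ ?_
    · rw [Measure.volume_eq_prod, Measure.prod_prod]; simp only [Real.volume_Icc]; finiteness
    · intro z hz
      simp only [hh]
      rw [hrz z, Complex.ofReal_zero]
      by_contra hc
      have := hg.2 z hc
      exact hz ⟨abs_le.1 this.1, abs_le.1 this.2.1⟩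
    · intro z hz
      simp only [hh]
      rw [Complex.norm_real, Real.norm_of_nonneg (hr0 z)]
      by_cases hc : g z = 0
      · rw [hrz z hc]; positivity
      simp only [hhr]
      have := (hg.2 z hc).2.2.2.1
      gcongr ?_ * ?_
      · exact Real.rpow_le_rpow (by positivity) this (by linarith)
      · exact Real.rpow_le_rpow_of_nonpos (by positivity) (hIlow z hc) (by linarith)
  have hri : Integrable hr := by simpa [hh] using hhi.re
  set u : ℝ × ℝ → ℂ := fun z => ∫ ξ, bW (α * (1 - 3/4)) f ξ * bE α z ξ with hu
  have hum : Measurable u := bU_meas α _ hWm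
  have step1 : ‖bB α (bW (α * (1 - 3/4)) f) g‖ₑ ≤
      ∫⁻ z, (‖g z‖ₑ ^ (1 / y) * Ie z.1 ^ (4 * y / 3 - 1) + ENNReal.ofReal (hr z) * ‖u z‖ₑ ^ 2) := by
    refine (bB_left_le α _ g hF hgi).trans (lintegral_mono fun z => ?_)
    beta_reduce
    by_cases hz : g z = 0
    · simp [hz]
    have hI := hIpos z hz
    have hgz : 0 < ‖g z‖ := norm_pos_iff.2 hz
    have hrpos : 0 < hr z := by simp only [hhr]; positivity
    set a : ℝ≥0∞ := ENNReal.ofReal (‖g z‖ * (hr z) ^ (-(1/2) : ℝ)) with ha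
    set b : ℝ≥0∞ := ENNReal.ofReal ((hr z) ^ (1/2 : ℝ)) * ‖u z‖ₑ with hb
    have e1 : ‖g z‖ₑ * ‖u z‖ₑ = a * b := by
      rw [ha, hb, ← mul_assoc, ← ENNReal.ofReal_mul (by positivity), mul_assoc, ← Real.rpow_add hrpos]
      norm_num
    have e2 : a ^ 2 = ‖g z‖ₑ ^ (1 / y) * Ie z.1 ^ (4 * y / 3 - 1) := by
      rw [ha, hIeq, ← ofReal_norm, ENNReal.ofReal_rpow_of_pos hgz, ENNReal.ofReal_rpow_of_pos hI,
        ← ENNReal.ofReal_mul (by positivity), ← ENNReal.ofReal_pow (by positivity)]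
      congr 1
      rw [mul_pow, ← Real.rpow_natCast (hr z ^ _), ← Real.rpow_mul hrpos.le]
      simp only [hhr]
      rw [Real.mul_rpow (by positivity) (by positivity), ← Real.rpow_mul hgz.le, ← Real.rpow_mul hI.le, ← mul_assoc,
        ← Real.rpow_natCast, ← Real.rpow_add hgz]
      congr 2 <;> (push_cast; ring)
    have e3 : b ^ 2 = ENNReal.ofReal (hr z) * ‖u z‖ₑ ^ 2 := by
      rw [hb, mul_pow, ← ENNReal.ofReal_pow (by positivity), ← Real.rpow_natCast, ← Real.rpow_mul hrpos.le]
      norm_num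
    rw [← e2, ← e3]
    exact (le_of_eq e1).trans (bo_amgm a b)
  refine step1.trans ?_
  rw [lintegral_add_left (by fun_prop)]
  refine add_le_add ?_ ?_
  · rw [Measure.volume_eq_prod, lintegral_prod _ (by fun_prop)]
    refine le_trans (le_of_eq ?_) h2
    congr 1; ext t
    dsimp only
    rw [lintegral_mul_const _ (by fun_prop)]
    show Ie t * Ie t ^ (4 * y / 3 - 1) = Ie t ^ (y / (3 / 4))
    nth_rewrite 1 [← ENNReal.rpow_one (Ie t)]
    rw [← ENNReal.rpow_add_of_nonneg _ _ (by norm_num) (by linarith)]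
    congr 1; ring
  refine (bo_TT volume volume _ hWm hF hr hrm hr0 hri (fun ξ z => bE α z ξ) 
    (hEm.comp (by fun_prop : Measurable fun w : ℝ × (ℝ × ℝ) => (w.2, w.1))) (fun ξ z => bE_norm α z ξ)).trans ?_
  have hker : ∀ ξ η, ∫ z, (hr z : ℂ) * (bE α z ξ * (starRingEnd ℂ) (bE α z η)) = bH h (ξ - η, omegaBO α ξ - omegaBO α η) := by
    intro ξ η
    unfold bH
    congr 1; ext z
    rw [bE_mul_conj', mul_comm]
  simp_rw [hker]
  set Bt : ℝ → ℝ → ℝ≥0∞ := fun ξ η => ENNReal.ofReal ((ξ * η) ^ (α / 2)) * (ENNReal.ofReal |ξ - η|) ^ κ *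
      ‖bH h (ξ - η, omegaBO α ξ - omegaBO α η)‖ₑ ^ 2 with hBt
  set At : ℝ → ℝ → ℝ≥0∞ := fun ξ η => ‖f ξ‖ₑ ^ 2 * ‖f η‖ₑ ^ 2 * (ENNReal.ofReal |ξ - η|) ^ (-κ) with hAt
  have hAm : Measurable (fun w : ℝ × ℝ => At w.1 w.2) := by simp only [hAt]; fun_prop
  set T : ℝ → ℝ → ℝ≥0∞ := fun ξ η => (Set.Ioi (0:ℝ)).indicator (fun ξ => (Set.Ioi (0:ℝ)).indicator (fun η => Bt ξ η) η) ξ with hT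
  have step2 : ∫⁻ ξ, ∫⁻ η, ‖bW (α * (1 - 3/4)) f ξ‖ₑ * ‖bW (α * (1 - 3/4)) f η‖ₑ * ‖bH h (ξ - η, omegaBO α ξ - omegaBO α η)‖ₑ
      ≤ ∫⁻ ξ, ∫⁻ η, (At ξ η + T ξ η) := by
    refine lintegral_mono fun ξ => ?_
    have hne : ∀ᵐ η : ℝ, η ≠ ξ := by simp [ae_iff]
    refine lintegral_mono_ae ?_
    filter_upwards [hne] with η hηξ
    by_cases c1 : f ξ = 0
    · simp [bW, c1]
    by_cases c2 : f η = 0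
    · simp [bW, c2]
    have hξ0 : 0 < ξ := lt_of_lt_of_le (by positivity) (hf.2 ξ c1).1
    have hη0 : 0 < η := lt_of_lt_of_le (by positivity) (hf.2 η c2).1
    have hd : 0 < |ξ - η| := abs_pos.2 (sub_ne_zero.2 (Ne.symm hηξ))
    have hTe : T ξ η = Bt ξ η := by
      simp only [hT]
      rw [Set.indicator_of_mem (Set.mem_Ioi.2 hξ0), Set.indicator_of_mem (Set.mem_Ioi.2 hη0)]
    rw [hTe]
    set a : ℝ≥0∞ := ‖f ξ‖ₑ * ‖f η‖ₑ * ENNReal.ofReal (|ξ - η| ^ (-(κ / 2))) with ha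
    set b : ℝ≥0∞ := ENNReal.ofReal ((ξ * η) ^ (α / 4)) * ENNReal.ofReal (|ξ - η| ^ (κ / 2)) * 
      ‖bH h (ξ - η, omegaBO α ξ - omegaBO α η)‖ₑ with hb
    have e2 : a ^ 2 = At ξ η := by
      simp only [ha, hAt]
      rw [mul_pow, mul_pow, ← ENNReal.ofReal_pow (by positivity), ENNReal.ofReal_rpow_of_pos hd, ← Real.rpow_natCast,
        ← Real.rpow_mul hd.le]
      congr 3; push_cast; ring
    have e3 : b ^ 2 = Bt ξ η := by
      simp only [hb, hBt]
      rw [mul_pow, mul_pow, ← ENNReal.ofReal_pow (by positivity), ← ENNReal.ofReal_pow (by positivity),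
        ENNReal.ofReal_rpow_of_pos hd, ← Real.rpow_natCast, ← Real.rpow_natCast,
        ← Real.rpow_mul hd.le, ← Real.rpow_mul (by positivity)]
      have q1 : α / 4 * ((2:ℕ):ℝ) = α / 2 := by push_cast; ring
      have q2 : κ / 2 * ((2:ℕ):ℝ) = κ := by push_cast; ring
      simp only [q1, q2]
    have e1 : ‖bW (α * (1 - 3/4)) f ξ‖ₑ * ‖bW (α * (1 - 3/4)) f η‖ₑ * ‖bH h (ξ - η, omegaBO α ξ - omegaBO α η)‖ₑ = a * b := by
      unfold bW
      rw [enorm_mul, enorm_mul, abs_of_pos hξ0, abs_of_pos hη0, ← ofReal_norm (Complex.ofReal _), Complex.norm_real,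
        ← ofReal_norm (Complex.ofReal _), Complex.norm_real, Real.norm_of_nonneg (by positivity), Real.norm_of_nonneg (by positivity),
        ha, hb]
      have q1 : ENNReal.ofReal (|ξ - η| ^ (-(κ / 2))) * ENNReal.ofReal (|ξ - η| ^ (κ / 2)) = 1 := by
        rw [← ENNReal.ofReal_mul (by positivity), ← Real.rpow_add hd]; simp
      have q2 : ENNReal.ofReal ((ξ * η) ^ (α / 4)) = ENNReal.ofReal (ξ ^ (α * (1 - 3/4))) * ENNReal.ofReal (η ^ (α * (1 - 3/4))) := by
        rw [← ENNReal.ofReal_mul (by positivity), Real.mul_rpow hξ0.le hη0.le, show α * (1 - 3/4) = α / 4 by ring]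
      rw [q2]
      calc _ = (ENNReal.ofReal (ξ ^ (α * (1 - 3/4))) * ENNReal.ofReal (η ^ (α * (1 - 3/4))) * ‖f ξ‖ₑ * ‖f η‖ₑ *
              ‖bH h (ξ - η, omegaBO α ξ - omegaBO α η)‖ₑ) * 1 := by ring
        _ = _ := by rw [← q1]; ring
    rw [← e2, ← e3, e1]
    exact bo_amgm a b
  refine step2.trans ?_
  have step3 : ∫⁻ ξ, ∫⁻ η, (At ξ η + T ξ η) = (∫⁻ ξ, ∫⁻ η, At ξ η) + ∫⁻ ξ, ∫⁻ η, T ξ η := by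
    rw [← lintegral_add_left (by fun_prop)]
    congr 1; ext ξ
    rw [lintegral_add_left (by fun_prop)]
  rw [step3]
  refine add_le_add ?_ ?_
  · refine (hls (fun ξ => ‖f ξ‖ₑ ^ 2) (by fun_prop)).trans ?_
    have : (∫⁻ ξ, (‖f ξ‖ₑ ^ 2) ^ (2 / (2 - κ))) ^ (2 - κ) ≤ 1 := by
      refine ENNReal.rpow_le_one ?_ (by linarith)
      refine le_trans (le_of_eq ?_) h1
      congr 1; ext ξ
      rw [← ENNReal.rpow_two, ← ENNReal.rpow_mul]
      congr 1
      rw [hκ]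
      have : 4 * y - 2 ≠ 0 := by linarith
      rw [← mul_div_assoc, div_eq_div_iff (by linarith) (by linarith)]; ring
    refine (mul_le_mul_right this _).trans (by simp)
  · have : ∫⁻ ξ, ∫⁻ η, T ξ η = ∫⁻ ξ in Set.Ioi (0:ℝ), ∫⁻ η in Set.Ioi (0:ℝ), Bt ξ η := by
      rw [← lintegral_indicator measurableSet_Ioi]
      congr 1; ext ξ
      by_cases hξ : ξ ∈ Set.Ioi (0:ℝ)
      · rw [Set.indicator_of_mem hξ, ← lintegral_indicator measurableSet_Ioi]
        congr 1; ext η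
        simp only [hT]; rw [Set.indicator_of_mem hξ]
      · rw [Set.indicator_of_notMem hξ]
        simp only [hT]; simp [Set.indicator_of_notMem hξ]
    rw [this]
    refine (hE2 h hhm hhi).trans ?_
    have : ∫⁻ t, (∫⁻ x, ‖h (t, x)‖ₑ ^ (2 / (2 - κ))) ^ (2 - κ) ≤ 1 := by
      refine le_trans (lintegral_mono fun t => ?_) h2
      beta_reduce
      have hκ2 : 0 < 2 - κ := by linarith
      by_cases hex : ∃ x, g (t, x) ≠ 0
      · obtain ⟨x0, hx0⟩ := hex
        have hI : 0 < Ir t := hIpos _ hx0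
        have e : ∀ x, ‖h (t, x)‖ₑ ^ (2 / (2 - κ)) = ENNReal.ofReal (Ir t ^ ((1 - 4 * y / 3) * (2 / (2 - κ)))) * ‖g (t, x)‖ₑ ^ (1 / y) := by
          intro x
          simp only [hh]
          rw [← ofReal_norm, Complex.norm_real, Real.norm_of_nonneg (hr0 _), ENNReal.ofReal_rpow_of_nonneg (hr0 _) (by positivity)]
          simp only [hhr]
          rw [Real.mul_rpow (by positivity) (by positivity), ← Real.rpow_mul (by positivity), ← Real.rpow_mul hI.le, 
            ENNReal.ofReal_mul (by positivity), mul_comm, ← ofReal_norm, ENNReal.ofReal_rpow_of_nonneg (by positivity) (by positivity)]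
          congr 3
          rw [hκ]
          have : 2 - 4 * (1 - y) ≠ 0 := by linarith
          field_simp
          ring
        simp_rw [e]
        rw [lintegral_const_mul _ (by fun_prop)]
        change (_ * Ie t) ^ (2 - κ) ≤ Ie t ^ (y / (3/4))
        rw [hIeq t, ← ENNReal.ofReal_mul (by positivity), ENNReal.ofReal_rpow_of_pos (by positivity), ENNReal.ofReal_rpow_of_pos hI]
        apply le_of_eq
        congr 1
        nth_rewrite 2 [← Real.rpow_one (Ir t)]
        rw [← Real.rpow_add hI, ← Real.rpow_mul hI.le]
        congr 1
        have : (2 / (2 - κ)) * (2 - κ) = 2 := by field_simp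
        rw [add_mul, mul_assoc, this, hκ]; ring
      · push Not at hex
        have : ∀ x, ‖h (t, x)‖ₑ ^ (2 / (2 - κ)) = 0 := by
          intro x
          simp only [hh]
          rw [hrz _ (hex x)]
          simp [hκ2]
        simp_rw [this]
        simp [hκ2]
    refine (mul_le_mul_right this _).trans (by simp)

lemma bo_strip {W : Type*} [MeasurableSpace W] (μ : Measure W) (H : W → ℂ) (hH : Integrable H μ)
    (A B : W → ℝ) (hA : Measurable A) (hB : Measurable B) (K : ℝ)
    (hK : ∀ w, H w ≠ 0 → |A w| ≤ K ∧ |B w| ≤ K) (C : ℝ)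
    (h0 : ∀ s : ℝ, ‖∫ w, H w * cexp ((A w : ℂ) + ((0:ℝ) + s * I) * (B w : ℂ)) ∂μ‖ ≤ C)
    (h1 : ∀ s : ℝ, ‖∫ w, H w * cexp ((A w : ℂ) + ((1:ℝ) + s * I) * (B w : ℂ)) ∂μ‖ ≤ C)
    (θ : ℝ) (hθ0 : 0 ≤ θ) (hθ1 : θ ≤ 1) :
    ‖∫ w, H w * cexp ((A w : ℂ) + (θ : ℂ) * (B w : ℂ)) ∂μ‖ ≤ C := by
  set Φ : ℂ → ℂ := fun z => ∫ w, H w * cexp ((A w : ℂ) + z * (B w : ℂ)) ∂μ with hΦ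
  have hbd : ∀ z w, ‖H w * cexp ((A w : ℂ) + z * (B w : ℂ))‖ ≤ ‖H w‖ * Real.exp (K + |z.re| * K) := by
    intro z w
    by_cases hw : H w = 0
    · simp [hw]
    obtain ⟨ha, hb⟩ := hK w hw
    rw [norm_mul, Complex.norm_exp]
    refine mul_le_mul_of_nonneg_left ?_ (norm_nonneg _)
    rw [Real.exp_le_exp]
    have e : ((A w : ℂ) + z * (B w : ℂ)).re = A w + z.re * B w := by simp
    rw [e]
    have := le_abs_self (A w)
    have h2 := le_abs_self (z.re * B w)
    rw [abs_mul] at h2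
    have h3 := mul_le_mul_of_nonneg_left hb (abs_nonneg z.re)
    linarith
  have hm : ∀ z, AEStronglyMeasurable (fun w => H w * cexp ((A w : ℂ) + z * (B w : ℂ))) μ := by
    intro z
    refine hH.aestronglyMeasurable.mul (Measurable.aestronglyMeasurable ?_)
    fun_prop
  have hd : Differentiable ℂ Φ := by
    intro z0
    have key := hasDerivAt_integral_of_dominated_loc_of_deriv_le (μ := μ) (𝕜 := ℂ)
      (F := fun z w => H w * cexp ((A w : ℂ) + z * (B w : ℂ)))
      (F' := fun z w => H w * cexp ((A w : ℂ) + z * (B w : ℂ)) * (B w : ℂ))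
      (x₀ := z0) (s := Metric.ball z0 1) (bound := fun w => ‖H w‖ * Real.exp (K + (|z0.re| + 1) * K) * K)
      (Metric.ball_mem_nhds z0 one_pos) (Filter.Eventually.of_forall hm)
      ((hH.norm.mul_const _).mono' (hm z0) (Filter.Eventually.of_forall (hbd z0)))
      ((hm z0).mul (by fun_prop : Measurable fun w => (B w : ℂ)).aestronglyMeasurable)
      (Filter.Eventually.of_forall ?_) ((hH.norm.mul_const _).mul_const _)
      (Filter.Eventually.of_forall ?_)
    · exact key.2.differentiableAt
    · intro w z hz
      by_cases hw : H w = 0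
      · simp [hw]
      obtain ⟨ha, hb⟩ := hK w hw
      have hK0 : 0 ≤ K := (abs_nonneg _).trans ha
      rw [norm_mul]
      refine mul_le_mul ((hbd z w).trans ?_) (by simpa using hb) (norm_nonneg _) (by positivity)
      refine mul_le_mul_of_nonneg_left ?_ (norm_nonneg _)
      rw [Real.exp_le_exp]
      have : |z.re| ≤ |z0.re| + 1 := by
        have h1 : |(z - z0).re| ≤ 1 := (Complex.abs_re_le_norm _).trans (by
          rw [← dist_eq_norm]; exact (Metric.mem_ball.1 hz).le)
        have h2 : z.re = z0.re + (z - z0).re := by simp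
        rw [h2]; exact (abs_add_le _ _).trans (by linarith)
      have := mul_le_mul_of_nonneg_right this hK0
      linarith
    · intro w z hz
      have := (((hasDerivAt_id z).mul_const (B w : ℂ)).const_add (A w : ℂ)).cexp.const_mul (H w)
      refine this.congr_deriv ?_
      simp; ring
  have := PhragmenLindelof.vertical_strip (f := Φ) (a := 0) (b := 1) (C := C) (z := (θ:ℂ)) hd.diffContOnCl 
    ⟨0, by simp [Real.pi_pos], 0, ?_⟩ ?_ ?_ (by simpa) (by simpa)
  · exact this
  · refine Asymptotics.IsBigO.of_bound (∫ w, ‖H w‖ * Real.exp (K + |K|) ∂μ) ?_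
    rw [Filter.eventually_inf_principal]
    refine Filter.Eventually.of_forall fun z hz => ?_
    simp only [zero_mul, Real.exp_zero, norm_one, mul_one]
    refine norm_integral_le_of_norm_le (hH.norm.mul_const _) (Filter.Eventually.of_forall fun w => (hbd z w).trans ?_)
    refine mul_le_mul_of_nonneg_left ?_ (norm_nonneg _)
    rw [Real.exp_le_exp]
    have hz' : 0 < z.re ∧ z.re < 1 := by simpa using hz
    have : |z.re| ≤ 1 := by rw [abs_of_pos hz'.1]; exact hz'.2.le
    have h2 : |z.re| * K ≤ |z.re| * |K| := mul_le_mul_of_nonneg_left (le_abs_self _) (abs_nonneg _)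
    nlinarith [abs_nonneg K]
  · intro z hz
    have e : z = ((0:ℝ):ℂ) + z.im * I := by rw [← hz]; simp
    rw [e]; exact h0 _
  · intro z hz
    have e : z = ((1:ℝ):ℂ) + z.im * I := by rw [← hz]; simp
    rw [e]; exact h1 _

lemma bo_tw_norm (a : ℂ) (c u v : ℝ) (ha : a ≠ 0) : 
    ‖a * cexp ((((c - 1) * Real.log ‖a‖ + u : ℝ) : ℂ) + (v : ℂ) * I)‖ = ‖a‖ ^ c * Real.exp u := by
  have h := norm_pos_iff.2 ha
  rw [norm_mul, Complex.norm_exp]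
  have e : (((((c - 1) * Real.log ‖a‖ + u : ℝ) : ℂ) + (v : ℂ) * I)).re = (c - 1) * Real.log ‖a‖ + u := by simp
  rw [e, Real.exp_add, Real.rpow_def_of_pos h, ← mul_assoc]
  congr 1
  nth_rewrite 1 [← Real.exp_log h]
  rw [← Real.exp_add]; congr 1; ring

lemma bo_rpow_bounds {M : ℝ} (hM : 1 ≤ M) {a : ℝ} (h1 : M⁻¹ ≤ a) (h2 : a ≤ M) (c : ℝ) :
    (M ^ |c|)⁻¹ ≤ a ^ c ∧ a ^ c ≤ M ^ |c| := by
  have hM0 : 0 < M := by linarith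
  have ha : 0 < a := lt_of_lt_of_le (by positivity) h1
  have hl : |Real.log a| ≤ Real.log M := by
    rw [abs_le]; constructor
    · rw [← Real.log_inv]; exact Real.log_le_log (by positivity) h1
    · exact Real.log_le_log ha h2
  have hc : |Real.log a * c| ≤ Real.log M * |c| := by
    rw [abs_mul]; exact mul_le_mul_of_nonneg_right hl (abs_nonneg _)
  rw [Real.rpow_def_of_pos ha, Real.rpow_def_of_pos hM0, ← Real.exp_neg, Real.exp_le_exp, Real.exp_le_exp]
  exact ⟨(abs_le.1 hc).1, (abs_le.1 hc).2⟩

lemma bo_log_bounds {M : ℝ} (hM : 1 ≤ M) {a : ℝ} (h1 : M⁻¹ ≤ a) (h2 : a ≤ M) :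
    |Real.log a| ≤ Real.log M := by
  have hM0 : 0 < M := by linarith
  have ha : 0 < a := lt_of_lt_of_le (by positivity) h1
  rw [abs_le]; constructor
  · rw [← Real.log_inv]; exact Real.log_le_log (by positivity) h1
  · exact Real.log_le_log ha h2

lemma bD_line (α C Y Z Yj Zj M K : ℝ) (f : ℝ → ℂ) (g : ℝ × ℝ → ℂ) (Ir : ℝ → ℝ) (hIm : Measurable Ir)
    (hY : 0 < Y) (hZ : 0 < Z) (hX : 0 < Y + 2 * Z - 2) (hYj : 0 < Yj) (hZj : 0 < Zj) (hXj : 0 < Yj + 2 * Zj - 2)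
    (hC : ∀ M f g, 1 ≤ M → goodF M f → goodG M g → ∫⁻ ξ, ‖f ξ‖ₑ^(1/(Yj+2*Zj-2)) ≤ 1 → 
      ∫⁻ t, (∫⁻ x, ‖g (t,x)‖ₑ^(1/Yj))^(Yj/Zj) ≤ 1 → ‖bB α (bW (α*(1-Zj)) f) g‖ ≤ C)
    (hM : 1 ≤ M) (hf : goodF M f) (hg : goodG M g) (hK : 1 ≤ K)
    (hI : ∀ t, ∫⁻ x, ‖g (t,x)‖ₑ^(1/Y) = ENNReal.ofReal (Ir t))
    (hIK : ∀ z, g z ≠ 0 → K⁻¹ ≤ Ir z.1 ∧ Ir z.1 ≤ K)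
    (h1 : ∫⁻ ξ, ‖f ξ‖ₑ^(1/(Y+2*Z-2)) ≤ 1)
    (h2 : ∫⁻ t, (∫⁻ x, ‖g (t,x)‖ₑ^(1/Y))^(Y/Z) ≤ 1)
    (v1 : ℝ → ℝ) (hv1 : Measurable v1) (v2 : ℝ × ℝ → ℝ) (hv2 : Measurable v2) :
    ‖∫ w : (ℝ × ℝ) × ℝ, g w.1 * f w.2 * bE α w.1 w.2 * 
      cexp ((((Yj/Y - 1) * Real.log ‖g w.1‖ + (Y * Zj / Z - Yj) * Real.log (Ir w.1.1) + 
        ((Yj + 2 * Zj - 2)/(Y + 2 * Z - 2) - 1) * Real.log ‖f w.2‖ + α * (1 - Zj) * Real.log |w.2| : ℝ) : ℂ) +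
        ((v1 w.2 + v2 w.1 : ℝ) : ℂ) * I)‖ ≤ C := by
  set X := Y + 2 * Z - 2 with hXd
  set Xj := Yj + 2 * Zj - 2 with hXjd
  set b := Y * Zj / Z - Yj with hb
  set F : ℝ → ℂ := fun ξ => f ξ * cexp ((((Xj / X - 1) * Real.log ‖f ξ‖ + 0 : ℝ) : ℂ) + (v1 ξ : ℂ) * I) with hF
  set G : ℝ × ℝ → ℂ := fun z => g z * cexp ((((Yj / Y - 1) * Real.log ‖g z‖ + b * Real.log (Ir z.1) : ℝ) : ℂ) + (v2 z : ℂ) * I) with hG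
  have hM0 : 0 < M := by linarith
  have hK0 : 0 < K := by linarith
  have hfm := hf.1
  have hgm := hg.1
  have hFm : Measurable F := by simp only [hF]; fun_prop
  have hGm : Measurable G := by simp only [hG]; fun_prop
  have hF0 : ∀ ξ, F ξ = 0 ↔ f ξ = 0 := by intro ξ; simp [hF]
  have hG0 : ∀ z, G z = 0 ↔ g z = 0 := by intro z; simp [hG]
  have hFn : ∀ ξ, f ξ ≠ 0 → ‖F ξ‖ = ‖f ξ‖ ^ (Xj / X) := by
    intro ξ h
    simp only [hF]; rw [bo_tw_norm _ _ _ _ h]; simp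
  have hGn : ∀ z, g z ≠ 0 → ‖G z‖ = ‖g z‖ ^ (Yj / Y) * Ir z.1 ^ b := by
    intro z h
    simp only [hG]; rw [bo_tw_norm _ _ _ _ h]
    have : 0 < Ir z.1 := lt_of_lt_of_le (by positivity) (hIK z h).1
    rw [Real.rpow_def_of_pos this, mul_comm b]
  set M1 := M ^ |Xj / X| with hM1
  set M2 := M ^ |Yj / Y| * K ^ |b| with hM2
  have hM11 : 1 ≤ M1 := Real.one_le_rpow hM (abs_nonneg _)
  have hM21 : 1 ≤ M2 := by
    have q1 : 1 ≤ M ^ |Yj / Y| := Real.one_le_rpow hM (abs_nonneg _)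
    have q2 : 1 ≤ K ^ |b| := Real.one_le_rpow hK (abs_nonneg _)
    nlinarith
  set N := max M (max M1 M2) with hN
  have hNM : M ≤ N := le_max_left _ _
  have hN1 : M1 ≤ N := (le_max_left _ _).trans (le_max_right _ _)
  have hN2 : M2 ≤ N := (le_max_right _ _).trans (le_max_right _ _)
  have hNM' : N⁻¹ ≤ M⁻¹ := inv_anti₀ hM0 hNM
  have hN1' : N⁻¹ ≤ M1⁻¹ := inv_anti₀ (by linarith) hN1
  have hN2' : N⁻¹ ≤ M2⁻¹ := inv_anti₀ (by linarith) hN2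
  have gF : goodF N F := by
    refine ⟨hFm, fun ξ h => ?_⟩
    have h' : f ξ ≠ 0 := fun e => h ((hF0 ξ).2 e)
    obtain ⟨a1, a2, a3, a4⟩ := hf.2 ξ h'
    obtain ⟨b1, b2⟩ := bo_rpow_bounds hM a3 a4 (Xj / X)
    rw [hFn ξ h']
    exact ⟨hNM'.trans a1, a2.trans hNM, hN1'.trans b1, b2.trans hN1⟩
  have gG : goodG N G := by
    refine ⟨hGm, fun z h => ?_⟩
    have h' : g z ≠ 0 := fun e => h ((hG0 z).2 e)
    obtain ⟨a1, a2, a3, a4, a5⟩ := hg.2 z h'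
    obtain ⟨b1, b2⟩ := bo_rpow_bounds hM a3 a4 (Yj / Y)
    obtain ⟨c1, c2⟩ := bo_rpow_bounds hK (hIK z h').1 (hIK z h').2 b
    rw [hGn z h']
    refine ⟨a1.trans hNM, a2.trans hNM, hN2'.trans ?_, le_trans ?_ hN2, ?_⟩
    · rw [hM2, mul_inv]
      exact mul_le_mul b1 c1 (by positivity) (by positivity)
    · have : 0 < Ir z.1 := lt_of_lt_of_le (by positivity) (hIK z h').1
      exact mul_le_mul b2 c2 (by positivity) (by positivity)
    · refine (ENNReal.ofReal_le_ofReal hNM').trans (a5.trans (le_of_eq ?_))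
      congr 1; ext x; simp only [Set.mem_ofPred_eq, ne_eq, hG0]
  have key := hC N F G (hM.trans hNM) gF gG ?_ ?_
  · refine le_trans (le_of_eq ?_) key
    congr 1
    unfold bB
    congr 1; ext w
    by_cases hz : f w.2 = 0
    · simp [hz, hF, bW]
    have hpos : 0 < w.2 := lt_of_lt_of_le (by positivity) (hf.2 _ hz).1
    simp only [hF, hG, bW]
    rw [Real.rpow_def_of_pos (abs_pos.2 hpos.ne')]
    push_cast
    have e : ∀ (a b c d e : ℂ), a * (b * (c * d)) * e = a * c * e * (b * d) := by intros; ring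
    rw [show ∀ a b c d e f' : ℂ, a * b * (c * (d * e)) * f' = a * d * f' * (b * c * e) by intros; ring,
      ← Complex.exp_add, ← Complex.exp_add]
    congr 2
    ring
  · refine le_trans (le_of_eq ?_) h1
    congr 1; ext ξ
    by_cases hz : f ξ = 0
    · rw [(hF0 ξ).2 hz, hz]; simp [hX, hXj]
    · rw [← ofReal_norm, hFn ξ hz, ← ofReal_norm, ← ENNReal.ofReal_rpow_of_pos (norm_pos_iff.2 hz), ← ENNReal.rpow_mul]
      congr 1; field_simp
  · refine le_trans (lintegral_mono fun t => ?_) h2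
    beta_reduce
    by_cases hex : ∃ x, g (t, x) ≠ 0
    · obtain ⟨x0, hx0⟩ := hex
      have hIp : 0 < Ir t := lt_of_lt_of_le (by positivity) (hIK _ hx0).1
      have e : ∀ x, ‖G (t, x)‖ₑ ^ (1 / Yj) = ENNReal.ofReal (Ir t ^ (b * (1 / Yj))) * ‖g (t, x)‖ₑ ^ (1 / Y) := by
        intro x
        by_cases hz : g (t, x) = 0
        · rw [(hG0 _).2 hz, hz]; simp [hY, hYj]
        rw [← ofReal_norm, hGn _ hz, ← ofReal_norm, ENNReal.ofReal_rpow_of_pos (by positivity), 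
          ENNReal.ofReal_rpow_of_pos (by positivity), ← ENNReal.ofReal_mul (by positivity),
          Real.mul_rpow (by positivity) (by positivity), ← Real.rpow_mul (by positivity), ← Real.rpow_mul hIp.le, mul_comm]
        congr 3; field_simp
      simp_rw [e]
      rw [lintegral_const_mul _ (by fun_prop), hI t, ← ENNReal.ofReal_mul (by positivity), 
        ENNReal.ofReal_rpow_of_pos (by positivity), ENNReal.ofReal_rpow_of_pos hIp]
      apply le_of_eq
      congr 1
      nth_rewrite 2 [← Real.rpow_one (Ir t)]
      rw [← Real.rpow_add hIp, ← Real.rpow_mul hIp.le]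
      congr 1
      rw [hb]; field_simp; ring
    · push Not at hex
      have : ∀ x, ‖G (t, x)‖ₑ ^ (1 / Yj) = 0 := by
        intro x; rw [(hG0 _).2 (hex x)]; simp [hYj]
      simp_rw [this]
      have : 0 < Yj / Zj := by positivity
      simp [this]

lemma bD_interp (α Y0 Z0 Y1 Z1 θ : ℝ) (hY0 : 0 < Y0) (hZ0 : 0 < Z0) (hX0 : 0 < Y0 + 2 * Z0 - 2)
    (hY1 : 0 < Y1) (hZ1 : 0 < Z1) (hX1 : 0 < Y1 + 2 * Z1 - 2) (hθ0 : 0 ≤ θ) (hθ1 : θ ≤ 1)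
    (h0 : bD α Y0 Z0) (h1 : bD α Y1 Z1) : bD α (Y0 + θ * (Y1 - Y0)) (Z0 + θ * (Z1 - Z0)) := by
  obtain ⟨C0, hC0⟩ := h0
  obtain ⟨C1, hC1⟩ := h1
  refine ⟨max C0 C1, ?_⟩
  intro M f g hM hf hg n1 n2
  set Y := Y0 + θ * (Y1 - Y0) with hYd
  set Z := Z0 + θ * (Z1 - Z0) with hZd
  have hY : 0 < Y := by
    rcases hθ0.eq_or_lt with h | h
    · rw [hYd, ← h]; linarith
    · rw [hYd]; nlinarith [mul_pos h hY1, mul_nonneg (sub_nonneg.2 hθ1) hY0.le]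
  have hZ : 0 < Z := by
    rcases hθ0.eq_or_lt with h | h
    · rw [hZd, ← h]; linarith
    · rw [hZd]; nlinarith [mul_pos h hZ1, mul_nonneg (sub_nonneg.2 hθ1) hZ0.le]
  have hX : 0 < Y + 2 * Z - 2 := by
    rcases hθ0.eq_or_lt with h | h
    · rw [hYd, hZd, ← h]; linarith
    · rw [hYd, hZd]; nlinarith [mul_pos h hX1, mul_nonneg (sub_nonneg.2 hθ1) hX0.le]
  have hM0 : 0 < M := by linarith
  have hfm := hf.1
  have hgm := hg.1
  obtain ⟨K, hK1, hKu, hKl⟩ := goodG.slice hM hg (1 / Y) (by positivity)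
  have hK0 : 0 < K := by linarith
  set Ir : ℝ → ℝ := fun t => (∫⁻ x, ‖g (t,x)‖ₑ^(1/Y)).toReal with hIr
  have hIm : Measurable Ir := by
    refine Measurable.ennreal_toReal ?_
    exact Measurable.lintegral_prod_right' (f := fun z : ℝ × ℝ => ‖g z‖ₑ ^ (1 / Y)) (by fun_prop)
  have hI : ∀ t, ∫⁻ x, ‖g (t,x)‖ₑ^(1/Y) = ENNReal.ofReal (Ir t) := by
    intro t; rw [ENNReal.ofReal_toReal]; exact ((hKu t).trans_lt ENNReal.ofReal_lt_top).ne
  have hIK : ∀ z, g z ≠ 0 → K⁻¹ ≤ Ir z.1 ∧ Ir z.1 ≤ K := by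
    intro z hz
    have a := hKl z hz
    have b := hKu z.1
    rw [hI] at a b
    have hb : Ir z.1 ≤ K := (ENNReal.ofReal_le_ofReal_iff hK0.le).1 b
    refine ⟨(ENNReal.ofReal_le_ofReal_iff ENNReal.toReal_nonneg).1 a, hb⟩
  -- the exponent functions
  set ℓ : ℝ → ℝ → (ℝ × ℝ) × ℝ → ℝ := fun Yj Zj w => (Yj/Y - 1) * Real.log ‖g w.1‖ + (Y * Zj / Z - Yj) * Real.log (Ir w.1.1) + 
        ((Yj + 2 * Zj - 2)/(Y + 2 * Z - 2) - 1) * Real.log ‖f w.2‖ + α * (1 - Zj) * Real.log |w.2| with hℓ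
  have hℓm : ∀ a b, Measurable (ℓ a b) := by
    intro a b; simp only [hℓ]; fun_prop
  set H : (ℝ × ℝ) × ℝ → ℂ := fun w => g w.1 * f w.2 * bE α w.1 w.2 with hH
  have hHi : Integrable H := by
    have := bB_int α f g (by have := hf.bW_integrable hM 0; rwa [bW_zero] at this) hg.integrable
    exact this
  have hℓb : ∀ a b, ∃ L, ∀ w, H w ≠ 0 → |ℓ a b w| ≤ L := by
    intro a b
    refine ⟨|a/Y - 1| * Real.log M + |Y * b / Z - a| * Real.log K + |(a + 2 * b - 2)/(Y + 2 * Z - 2) - 1| * Real.log M + 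
      |α * (1 - b)| * Real.log M, fun w hw => ?_⟩
    have hg0 : g w.1 ≠ 0 := by intro h; apply hw; simp [hH, h]
    have hf0 : f w.2 ≠ 0 := by intro h; apply hw; simp [hH, h]
    obtain ⟨a1, a2, a3, a4⟩ := hf.2 _ hf0
    obtain ⟨_, _, b3, b4, _⟩ := hg.2 _ hg0
    have hpos : 0 < w.2 := lt_of_lt_of_le (by positivity) a1
    simp only [hℓ]
    refine (abs_add_le _ _).trans (add_le_add ((abs_add_le _ _).trans (add_le_add ((abs_add_le _ _).trans (add_le_add ?_ ?_)) ?_)) ?_)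
    all_goals rw [abs_mul]; refine mul_le_mul_of_nonneg_left ?_ (abs_nonneg _)
    · exact bo_log_bounds hM b3 b4
    · exact bo_log_bounds hK1 (hIK _ hg0).1 (hIK _ hg0).2
    · exact bo_log_bounds hM a3 a4
    · rw [abs_of_pos hpos]; exact bo_log_bounds hM a1 a2
  obtain ⟨L0, hL0⟩ := hℓb Y0 Z0
  obtain ⟨L1, hL1⟩ := hℓb Y1 Z1
  have key := bo_strip volume H hHi (ℓ Y0 Z0) (fun w => ℓ Y1 Z1 w - ℓ Y0 Z0 w) (hℓm _ _) ((hℓm _ _).sub (hℓm _ _))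
    (max L0 (L0 + L1)) (fun w hw => ⟨(hL0 w hw).trans (le_max_left _ _), (abs_sub _ _).trans (le_trans (by linarith [hL0 w hw, hL1 w hw]) (le_max_right _ _))⟩) (max C0 C1) ?_ ?_ θ hθ0 hθ1
  · refine le_trans (le_of_eq ?_) key
    congr 1
    unfold bB
    congr 1; ext w
    by_cases hz : f w.2 = 0
    · simp [hz, hH, bW]
    have hpos : 0 < w.2 := lt_of_lt_of_le (by positivity) (hf.2 _ hz).1
    have e : ((ℓ Y0 Z0 w : ℝ) : ℂ) + (θ : ℂ) * ((ℓ Y1 Z1 w - ℓ Y0 Z0 w : ℝ) : ℂ) = ((Real.log |w.2| * (α * (1 - Z)) : ℝ) : ℂ) := by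
      rw [← Complex.ofReal_mul, ← Complex.ofReal_add]
      congr 1
      simp only [hℓ]
      have k1 : (Y0/Y - 1) + θ * ((Y1/Y - 1) - (Y0/Y - 1)) = 0 := by
        field_simp; rw [hYd]; ring
      have k2 : (Y * Z0 / Z - Y0) + θ * ((Y * Z1 / Z - Y1) - (Y * Z0 / Z - Y0)) = 0 := by
        have : Y * Z0 / Z + θ * (Y * Z1 / Z - Y * Z0 / Z) = Y := by field_simp; rw [hZd]
        rw [hYd] at this ⊢; linarith
      have k3 : ((Y0 + 2 * Z0 - 2)/(Y + 2 * Z - 2) - 1) + θ * (((Y1 + 2 * Z1 - 2)/(Y + 2 * Z - 2) - 1) - ((Y0 + 2 * Z0 - 2)/(Y + 2 * Z - 2) - 1)) = 0 := by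
        have hX' := hX.ne'
        field_simp; rw [hYd, hZd]; ring
      have k4 : α * (1 - Z0) + θ * (α * (1 - Z1) - α * (1 - Z0)) = α * (1 - Z) := by rw [hZd]; ring
      linear_combination (Real.log ‖g w.1‖) * k1 + (Real.log (Ir w.1.1)) * k2 + (Real.log ‖f w.2‖) * k3 + (Real.log |w.2|) * k4
    rw [e, hH, bW, Real.rpow_def_of_pos (abs_pos.2 hpos.ne')]
    push_cast
    ring
  · intro s
    refine le_trans (le_of_eq ?_) ((bD_line α C0 Y Z Y0 Z0 M K f g Ir hIm hY hZ hX hY0 hZ0 hX0 hC0 hM hf hg hK1 hI hIK n1 n2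
      (fun ξ => s * ((((Y1 + 2 * Z1 - 2)/(Y + 2 * Z - 2) - 1) - ((Y0 + 2 * Z0 - 2)/(Y + 2 * Z - 2) - 1)) * Real.log ‖f ξ‖ + 
        (α * (1 - Z1) - α * (1 - Z0)) * Real.log |ξ|)) (by fun_prop) 
      (fun z => s * (((Y1/Y - 1) - (Y0/Y - 1)) * Real.log ‖g z‖ + ((Y * Z1 / Z - Y1) - (Y * Z0 / Z - Y0)) * Real.log (Ir z.1))) (by fun_prop)).trans
      (le_max_left _ _))
    congr 2; ext w
    simp only [hH, hℓ]
    congr 2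
    push_cast; ring
  · intro s
    refine le_trans (le_of_eq ?_) ((bD_line α C1 Y Z Y1 Z1 M K f g Ir hIm hY hZ hX hY1 hZ1 hX1 hC1 hM hf hg hK1 hI hIK n1 n2
      (fun ξ => s * ((((Y1 + 2 * Z1 - 2)/(Y + 2 * Z - 2) - 1) - ((Y0 + 2 * Z0 - 2)/(Y + 2 * Z - 2) - 1)) * Real.log ‖f ξ‖ + 
        (α * (1 - Z1) - α * (1 - Z0)) * Real.log |ξ|)) (by fun_prop) 
      (fun z => s * (((Y1/Y - 1) - (Y0/Y - 1)) * Real.log ‖g z‖ + ((Y * Z1 / Z - Y1) - (Y * Z0 / Z - Y0)) * Real.log (Ir z.1))) (by fun_prop)).trans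
      (le_max_right _ _))
    congr 2; ext w
    simp only [hH, hℓ]
    congr 2
    push_cast; ring

lemma bD_AB (α Y : ℝ) (h1 : 1/2 ≤ Y) (h2 : Y ≤ 1) : bD α Y 1 := by
  have := bD_interp α (1/2) 1 1 1 (2 * Y - 1) (by norm_num) (by norm_num) (by norm_num) (by norm_num) (by norm_num) (by norm_num)
    (by linarith) (by linarith) (bD_B α) (bD_A α)
  convert this using 1 <;> ring

lemma bD_CE (α : ℝ) (hα0 : 0 < α) (hα1 : α ≤ 1) (Y : ℝ) (h1 : 3/4 < Y) (h2 : Y ≤ 1) : bD α Y (3/4) := by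
  rcases h2.eq_or_lt with h | h
  · rw [h]; exact bD_C α hα0 hα1
  · exact bD_E α hα0 Y h1 h

lemma bD_all (α : ℝ) (hα0 : 0 < α) (hα1 : α ≤ 1) (Y Z : ℝ) (hZ : Z ≤ 1) (hY : Y ≤ 1)
    (h : (3/4 ≤ Z ∧ 3/4 < Y) ∨ (Y ≤ 3/4 ∧ 3/2 < Y + Z) ∨ (Z = 1 ∧ Y = 1/2)) : bD α Y Z := by
  rcases h with ⟨h1, h2⟩ | ⟨h1, h2⟩ | ⟨h1, h2⟩
  · have := bD_interp α Y 1 Y (3/4) (4 * (1 - Z)) (by linarith) (by norm_num) (by linarith) (by linarith) (by norm_num) (by linarith)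
      (by linarith) (by linarith) (bD_AB α Y (by linarith) hY) (bD_CE α hα0 hα1 Y h2 hY)
    convert this using 1 <;> ring
  · rcases hZ.eq_or_lt with hz | hz
    · rw [hz]; exact bD_AB α Y (by linarith) hY
    set θ := 4 * (1 - Z) with hθ
    have ht0 : 0 < θ := by linarith
    have ht1 : θ < 1 := by linarith
    by_cases hc : Y - 1/2 ≤ θ / 2
    · have a1 : 3/4 < 1/2 + (Y - 1/2) / θ := by
        have : 1/4 < (Y - 1/2) / θ := by rw [lt_div_iff₀ ht0]; linarith
        linarith
      have a2 : 1/2 + (Y - 1/2) / θ ≤ 1 := by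
        have : (Y - 1/2) / θ ≤ 1/2 := by rw [div_le_iff₀ ht0]; linarith
        linarith
      have := bD_interp α (1/2) 1 (1/2 + (Y - 1/2) / θ) (3/4) θ (by norm_num) (by norm_num) (by norm_num)
        (by linarith) (by norm_num) (by linarith) ht0.le ht1.le (bD_AB α _ (by linarith) (by norm_num)) (bD_CE α hα0 hα1 _ a1 a2)
      convert this using 1
      · field_simp; ring
      · rw [hθ]; ring
    · push Not at hc
      have h1t : 0 < 1 - θ := by linarith
      have a1 : 1/2 ≤ (Y - θ * (7/8)) / (1 - θ) := by rw [le_div_iff₀ h1t]; linarith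
      have a2 : (Y - θ * (7/8)) / (1 - θ) ≤ 1 := by rw [div_le_iff₀ h1t]; linarith
      have := bD_interp α ((Y - θ * (7/8)) / (1 - θ)) 1 (7/8) (3/4) θ (by linarith) (by norm_num) (by linarith)
        (by norm_num) (by norm_num) (by norm_num) ht0.le ht1.le (bD_AB α _ a1 a2) (bD_CE α hα0 hα1 _ (by norm_num) (by norm_num))
      convert this using 1
      · field_simp; ring
      · rw [hθ]; ring
  · rw [h1, h2]; exact bD_B α

lemma bW_smul (e : ℝ) (f : ℝ → ℂ) (a : ℂ) : bW e (fun ξ => a * f ξ) = fun ξ => a * bW e f ξ := by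
  ext ξ; simp only [bW]; ring

lemma bo_scale_lint {A : Type*} [MeasurableSpace A] (μ : Measure A) (f : A → ℂ) (hf : Measurable f) (a e : ℝ) (ha : 0 < a) (he : 0 < e) :
    ∫⁻ ξ, ‖((a⁻¹ : ℝ) : ℂ) * f ξ‖ₑ ^ e ∂μ = ENNReal.ofReal a ^ (-e) * ∫⁻ ξ, ‖f ξ‖ₑ ^ e ∂μ := by
  rw [← lintegral_const_mul _ (by fun_prop)]
  congr 1; ext ξ
  rw [enorm_mul, ENNReal.mul_rpow_of_nonneg _ _ he.le, ← ofReal_norm (Complex.ofReal _), Complex.norm_real, 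
    Real.norm_of_nonneg (by positivity), ENNReal.ofReal_inv_of_pos ha, ENNReal.inv_rpow, ENNReal.rpow_neg]

lemma bo_scale_one (N : ℝ≥0∞) (a X : ℝ) (ha : 0 < a) (hX : 0 < X) (h : N ^ X ≤ ENNReal.ofReal a) :
    ENNReal.ofReal a ^ (-(1 / X)) * N ≤ 1 := by
  have h1 : N ≤ ENNReal.ofReal a ^ (1 / X) := by
    have := ENNReal.rpow_le_rpow h (by positivity : 0 ≤ 1 / X)
    rwa [← ENNReal.rpow_mul, mul_one_div_cancel hX.ne', ENNReal.rpow_one] at this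
  have ha' : ENNReal.ofReal a ≠ 0 := by simpa using ha
  refine (mul_le_mul_right h1 _).trans (le_of_eq ?_)
  rw [← ENNReal.rpow_add _ _ ha' ENNReal.ofReal_ne_top]
  simp

lemma bo_hom (α Y Z : ℝ) (hY : 0 < Y) (hZ : 0 < Z) (hX : 0 < Y + 2 * Z - 2) (h : bD α Y Z) :
    ∃ C : ℝ, 0 < C ∧ ∀ M f g a b, 1 ≤ M → goodF M f → goodG M g → 0 < a → 0 < b →
      (∫⁻ ξ, ‖f ξ‖ₑ^(1/(Y+2*Z-2))) ^ (Y + 2 * Z - 2) ≤ ENNReal.ofReal a →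
      (∫⁻ t, (∫⁻ x, ‖g (t,x)‖ₑ^(1/Y))^(Y/Z)) ^ Z ≤ ENNReal.ofReal b → ‖bB α (bW (α*(1-Z)) f) g‖ ≤ C * a * b := by
  obtain ⟨C, hC⟩ := h
  refine ⟨|C| + 1, by positivity, ?_⟩
  intro M f g a b hM hf hg ha hb h1 h2
  have hfm := hf.1
  have hgm := hg.1
  have hM0 : 0 < M := by linarith
  set N := M * (1 + a + a⁻¹ + b + b⁻¹) with hN
  have hinva : 0 < a⁻¹ := by positivity
  have hinvb : 0 < b⁻¹ := by positivity
  have q : ∀ c : ℝ, 1 ≤ c → c ≤ 1 + a + a⁻¹ + b + b⁻¹ → M * c ≤ N ∧ N⁻¹ ≤ M⁻¹ := by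
    intro c hc hc'
    have e1 : M * c ≤ N := mul_le_mul_of_nonneg_left hc' hM0.le
    exact ⟨e1, inv_anti₀ hM0 (by nlinarith)⟩
  have hNM : M ≤ N := by have := (q 1 le_rfl (by linarith)).1; linarith
  have hNM' := (q 1 le_rfl (by linarith)).2
  have hN0 : 0 < N := by linarith
  have qq : ∀ c, 0 < c → c ≤ 1 + a + a⁻¹ + b + b⁻¹ → c⁻¹ ≤ 1 + a + a⁻¹ + b + b⁻¹ → ∀ x : ℂ, M⁻¹ ≤ ‖x‖ → ‖x‖ ≤ M → 
      N⁻¹ ≤ ‖((c⁻¹ : ℝ) : ℂ) * x‖ ∧ ‖((c⁻¹ : ℝ) : ℂ) * x‖ ≤ N := by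
    intro c hc hc1 hc2 x hx1 hx2
    rw [norm_mul, Complex.norm_real, Real.norm_of_nonneg (by positivity)]
    constructor
    · rw [hN, mul_inv, mul_comm]
      exact mul_le_mul (inv_anti₀ hc hc1) hx1 (by positivity) (by positivity)
    · rw [hN, mul_comm]
      exact mul_le_mul hx2 hc2 (by positivity) (by positivity)
  have key := hC N (fun ξ => ((a⁻¹ : ℝ) : ℂ) * f ξ) (fun z => ((b⁻¹ : ℝ) : ℂ) * g z) (hM.trans hNM) ?_ ?_ ?_ ?_
  · have e : bB α (bW (α*(1-Z)) (fun ξ => ((a⁻¹ : ℝ) : ℂ) * f ξ)) (fun z => ((b⁻¹ : ℝ) : ℂ) * g z) = 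
        ((a⁻¹ * b⁻¹ : ℝ) : ℂ) * bB α (bW (α*(1-Z)) f) g := by
      rw [bW_smul]
      unfold bB
      rw [← integral_const_mul]
      congr 1; ext w; push_cast; ring
    rw [e, norm_mul, Complex.norm_real, Real.norm_of_nonneg (by positivity)] at key
    have : ‖bB α (bW (α*(1-Z)) f) g‖ = a * b * (a⁻¹ * b⁻¹ * ‖bB α (bW (α*(1-Z)) f) g‖) := by field_simp
    rw [this]
    calc a * b * (a⁻¹ * b⁻¹ * ‖bB α (bW (α*(1-Z)) f) g‖) ≤ a * b * (|C| + 1) := 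
          mul_le_mul_of_nonneg_left (by linarith [le_abs_self C]) (by positivity)
      _ = _ := by ring
  · refine ⟨by fun_prop, fun ξ hξ => ?_⟩
    obtain ⟨a1, a2, a3, a4⟩ := hf.2 ξ (right_ne_zero_of_mul hξ)
    obtain ⟨b1, b2⟩ := qq a ha (by linarith) (by linarith) _ a3 a4
    exact ⟨hNM'.trans a1, a2.trans hNM, b1, b2⟩
  · refine ⟨by fun_prop, fun ξ hξ => ?_⟩
    obtain ⟨a1, a2, a3, a4, a5⟩ := hg.2 ξ (right_ne_zero_of_mul hξ)
    obtain ⟨b1, b2⟩ := qq b hb (by linarith) (by linarith) _ a3 a4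
    refine ⟨a1.trans hNM, a2.trans hNM, b1, b2, (ENNReal.ofReal_le_ofReal hNM').trans (a5.trans (le_of_eq ?_))⟩
    congr 1; ext x
    have : ((b⁻¹ : ℝ) : ℂ) ≠ 0 := by exact_mod_cast hinvb.ne'
    simp only [Set.mem_ofPred_eq, ne_eq, mul_eq_zero, this, false_or]
  · rw [bo_scale_lint _ _ hfm _ _ ha (by positivity)]
    exact bo_scale_one _ _ _ ha hX h1
  · have e : ∀ t, (∫⁻ x, ‖((b⁻¹ : ℝ) : ℂ) * g (t, x)‖ₑ^(1/Y))^(Y/Z) = ENNReal.ofReal b ^ (-(1/Z)) * (∫⁻ x, ‖g (t,x)‖ₑ^(1/Y))^(Y/Z) := by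
      intro t
      rw [bo_scale_lint _ _ (by fun_prop) _ _ hb (by positivity), ENNReal.mul_rpow_of_nonneg _ _ (by positivity), ← ENNReal.rpow_mul]
      congr 2; field_simp
    simp_rw [e]
    rw [lintegral_const_mul]
    · exact bo_scale_one _ _ _ hb hZ h2
    · exact (Measurable.lintegral_prod_right' (f := fun z : ℝ × ℝ => ‖g z‖ₑ ^ (1 / Y)) (by fun_prop)).pow_const _

lemma bo_pos (α Y Z C : ℝ) (hX : 0 < Y + 2 * Z - 2) 
    (hC : ∀ M f g a b, 1 ≤ M → goodF M f → goodG M g → 0 < a → 0 < b →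
      (∫⁻ ξ, ‖f ξ‖ₑ^(1/(Y+2*Z-2))) ^ (Y + 2 * Z - 2) ≤ ENNReal.ofReal a →
      (∫⁻ t, (∫⁻ x, ‖g (t,x)‖ₑ^(1/Y))^(Y/Z)) ^ Z ≤ ENNReal.ofReal b → ‖bB α (bW (α*(1-Z)) f) g‖ ≤ C * a * b)
    (M : ℝ) (F : ℝ → ℂ) (g : ℝ × ℝ → ℂ) (a b : ℝ) (hM : 1 ≤ M) (hF : Measurable F) (hF0 : ∀ ξ, ξ ≤ 0 → F ξ = 0)
    (hFi : Integrable (bW (α * (1 - Z)) F)) (hg : goodG M g) (ha : 0 < a) (hb : 0 < b)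
    (h1 : (∫⁻ ξ, ‖F ξ‖ₑ^(1/(Y+2*Z-2))) ^ (Y + 2 * Z - 2) ≤ ENNReal.ofReal a)
    (h2 : (∫⁻ t, (∫⁻ x, ‖g (t,x)‖ₑ^(1/Y))^(Y/Z)) ^ Z ≤ ENNReal.ofReal b) :
    ‖bB α (bW (α*(1-Z)) F) g‖ ≤ C * a * b := by
  have hgm := hg.1
  set S : ℕ → Set ℝ := fun k => {ξ | ((k:ℝ) + M)⁻¹ ≤ ξ ∧ ξ ≤ k + M ∧ ((k:ℝ) + M)⁻¹ ≤ ‖F ξ‖ ∧ ‖F ξ‖ ≤ k + M} with hS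
  have hSm : ∀ k, MeasurableSet (S k) := by
    intro k
    refine (measurableSet_le measurable_const measurable_id).inter ((measurableSet_le measurable_id measurable_const).inter 
      ((measurableSet_le measurable_const hF.norm).inter (measurableSet_le hF.norm measurable_const)))
  set Fk : ℕ → ℝ → ℂ := fun k => (S k).indicator F with hFk
  have hkM : ∀ k : ℕ, 1 ≤ (k:ℝ) + M := by
    intro k
    have : (0:ℝ) ≤ k := Nat.cast_nonneg k
    linarith
  have hle : ∀ k ξ, ‖Fk k ξ‖ ≤ ‖F ξ‖ := fun k ξ => norm_indicator_le_norm_self _ _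
  have hgF : ∀ k : ℕ, goodF (k + M) (Fk k) := by
    intro k
    refine ⟨hF.indicator (hSm k), fun ξ hξ => ?_⟩
    have hmem : ξ ∈ S k := Set.mem_of_indicator_ne_zero hξ
    simp only [hFk]; rw [Set.indicator_of_mem hmem]; exact hmem
  have hg' : ∀ k : ℕ, goodG (k + M) g := by
    intro k
    have hk0 : (0:ℝ) ≤ k := Nat.cast_nonneg k
    have : M ≤ k + M := by linarith
    have h' : ((k:ℝ) + M)⁻¹ ≤ M⁻¹ := inv_anti₀ (by linarith) this
    refine ⟨hgm, fun z hz => ?_⟩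
    obtain ⟨a1, a2, a3, a4, a5⟩ := hg.2 z hz
    exact ⟨a1.trans this, a2.trans this, h'.trans a3, a4.trans this, (ENNReal.ofReal_le_ofReal h').trans a5⟩
  have hbk : ∀ k : ℕ, ‖bB α (bW (α*(1-Z)) (Fk k)) g‖ ≤ C * a * b := by
    intro k
    refine hC _ _ _ _ _ (hkM k) (hgF k) (hg' k) ha hb (le_trans ?_ h1) h2
    refine ENNReal.rpow_le_rpow (lintegral_mono fun ξ => ENNReal.rpow_le_rpow ?_ (by positivity)) hX.le
    exact enorm_le_iff_norm_le.2 (hle k ξ)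
  have hlim : Filter.Tendsto (fun k : ℕ => bB α (bW (α*(1-Z)) (Fk k)) g) Filter.atTop (nhds (bB α (bW (α*(1-Z)) F) g)) := by
    unfold bB
    have hBi := bB_int α _ g hFi hg.integrable
    refine tendsto_integral_of_dominated_convergence (fun w => ‖g w.1 * bW (α*(1-Z)) F w.2 * bE α w.1 w.2‖) ?_ hBi.norm ?_ ?_
    · intro k
      have := bW_meas (α*(1-Z)) _ (hgF k).1
      have := bE_meas α
      refine Measurable.aestronglyMeasurable ?_
      fun_prop
    · intro k
      refine Filter.Eventually.of_forall fun w => ?_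
      rw [norm_mul, norm_mul, norm_mul, norm_mul]
      simp only [bW, norm_mul]
      have := hle k w.2
      gcongr
    · refine Filter.Eventually.of_forall fun w => ?_
      by_cases h0 : F w.2 = 0
      · refine tendsto_const_nhds.congr fun k => ?_
        have : Fk k w.2 = 0 := by
          have := hle k w.2; rw [h0, norm_zero] at this; exact norm_le_zero_iff.1 this
        simp [bW, h0, this]
      · have hpos : 0 < w.2 := by
          by_contra hh; exact h0 (hF0 _ (not_lt.1 hh))
        have hn : 0 < ‖F w.2‖ := norm_pos_iff.2 h0
        refine Filter.Tendsto.congr' ?_ tendsto_const_nhds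
        obtain ⟨K, hK⟩ := exists_nat_ge (w.2 + w.2⁻¹ + ‖F w.2‖ + ‖F w.2‖⁻¹)
        filter_upwards [Filter.eventually_ge_atTop K] with k hk
        have hkr : (K:ℝ) ≤ k := by exact_mod_cast hk
        have i1 : 0 < w.2⁻¹ := by positivity
        have i2 : 0 < ‖F w.2‖⁻¹ := by positivity
        have : Fk k w.2 = F w.2 := by
          simp only [hFk]; apply Set.indicator_of_mem
          refine ⟨?_, by linarith, ?_, by linarith⟩
          · exact inv_le_of_inv_le₀ hpos (by linarith)
          · exact inv_le_of_inv_le₀ hn (by linarith)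
        simp only [bW, this]
  exact le_of_tendsto hlim.norm (Filter.Eventually.of_forall hbk)

lemma bE_neg (α : ℝ) (z : ℝ × ℝ) (ξ : ℝ) : bE α z (-ξ) = (starRingEnd ℂ) (bE α z ξ) := by
  unfold bE
  rw [← Complex.exp_conj, bo_omega_neg]
  congr 1
  simp only [map_mul, Complex.conj_I, Complex.conj_ofReal]
  push_cast; ring

lemma bo_full (α Y Z : ℝ) (hY : 0 < Y) (hZ : 0 < Z) (hX : 0 < Y + 2 * Z - 2) (h : bD α Y Z) :
    ∃ C : ℝ, 0 < C ∧ ∀ (M : ℝ) (F : ℝ → ℂ) (g : ℝ × ℝ → ℂ) (a b : ℝ), 1 ≤ M → Measurable F → Integrable (bW (α * (1 - Z)) F) → 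
      goodG M g → 0 < a → 0 < b →
      (∫⁻ ξ, ‖F ξ‖ₑ^(1/(Y+2*Z-2))) ^ (Y + 2 * Z - 2) ≤ ENNReal.ofReal a →
      (∫⁻ t, (∫⁻ x, ‖g (t,x)‖ₑ^(1/Y))^(Y/Z)) ^ Z ≤ ENNReal.ofReal b → 
      ‖∫ z, g z * ∫ ξ, bW (α*(1-Z)) F ξ * bE α z ξ‖ ≤ C * a * b := by
  obtain ⟨C, hC0, hC⟩ := bo_hom α Y Z hY hZ hX h
  refine ⟨2 * C, by positivity, ?_⟩
  intro M F g a b hM hF hFi hg ha hb h1 h2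
  have hgm := hg.1
  set F1 : ℝ → ℂ := (Set.Ioi 0).indicator F with hF1
  set F2 : ℝ → ℂ := (Set.Iic 0).indicator F with hF2
  set F3 : ℝ → ℂ := (Set.Ioi 0).indicator (fun ξ => (starRingEnd ℂ) (F (-ξ))) with hF3
  have hF1m : Measurable F1 := hF.indicator measurableSet_Ioi
  have hF3m : Measurable F3 := (continuous_star.measurable.comp (hF.comp measurable_neg)).indicator measurableSet_Ioi
  have hi1 : Integrable (bW (α*(1-Z)) F1) := by
    refine (hFi.indicator (measurableSet_Ioi (a := (0:ℝ)))).congr (Filter.Eventually.of_forall fun ξ => ?_)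
    simp only [hF1, bW, Set.indicator]; split_ifs <;> simp
  have hi2 : Integrable (bW (α*(1-Z)) F2) := by
    refine (hFi.indicator (measurableSet_Iic (a := (0:ℝ)))).congr (Filter.Eventually.of_forall fun ξ => ?_)
    simp only [hF2, bW, Set.indicator]; split_ifs <;> simp
  have hn3 : ∀ ξ, ‖F3 ξ‖ ≤ ‖F (-ξ)‖ := by
    intro ξ
    refine (norm_indicator_le_norm_self _ _).trans (le_of_eq ?_)
    simp
  have hi3 : Integrable (bW (α*(1-Z)) F3) := by
    refine hFi.comp_neg.mono (bW_meas _ _ hF3m).aestronglyMeasurable (Filter.Eventually.of_forall fun ξ => ?_)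
    simp only [bW, norm_mul, abs_neg]
    exact mul_le_mul_of_nonneg_left (hn3 ξ) (norm_nonneg _)
  have p1 := bo_pos α Y Z C hX hC M F1 g a b hM hF1m (fun ξ hξ => Set.indicator_of_notMem (by simpa using hξ) _) hi1 hg ha hb 
    (le_trans (ENNReal.rpow_le_rpow (lintegral_mono fun ξ => ENNReal.rpow_le_rpow 
      (enorm_le_iff_norm_le.2 (norm_indicator_le_norm_self _ _)) (by positivity)) hX.le) h1) h2
  have hg3 : goodG M (fun z => (starRingEnd ℂ) (g z)) := by
    refine ⟨continuous_star.measurable.comp hgm, fun z hz => ?_⟩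
    have := hg.2 z (by simpa using hz)
    simpa using this
  have p3 := bo_pos α Y Z C hX hC M F3 (fun z => (starRingEnd ℂ) (g z)) a b hM hF3m 
    (fun ξ hξ => Set.indicator_of_notMem (by simpa using hξ) _) hi3 hg3 ha hb 
    (by
      refine le_trans (ENNReal.rpow_le_rpow ?_ hX.le) h1
      rw [← lintegral_neg_eq_self]
      refine lintegral_mono fun ξ => ENNReal.rpow_le_rpow (enorm_le_iff_norm_le.2 ?_) (by positivity)
      simpa using hn3 (-ξ)) (by simpa [← ofReal_norm] using h2)
  have key : (∫ z, g z * ∫ ξ, bW (α*(1-Z)) F ξ * bE α z ξ) = bB α (bW (α*(1-Z)) F1) g + 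
      (starRingEnd ℂ) (bB α (bW (α*(1-Z)) F3) (fun z => (starRingEnd ℂ) (g z))) := by
    rw [bB_left _ _ _ hi1 hg.integrable, bB_left _ _ _ hi3 hg3.integrable, ← integral_conj]
    have e2 : ∀ z, (starRingEnd ℂ) ((starRingEnd ℂ) (g z) * ∫ ξ, bW (α*(1-Z)) F3 ξ * bE α z ξ) = g z * ∫ ξ, bW (α*(1-Z)) F2 ξ * bE α z ξ := by
      intro z
      rw [map_mul, Complex.conj_conj, ← integral_conj]
      congr 1
      rw [← integral_neg_eq_self]
      refine integral_congr_ae ?_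
      have hne : ∀ᵐ ξ : ℝ, ξ ≠ 0 := by simp [ae_iff]
      filter_upwards [hne] with ξ hξ
      rw [map_mul, bE_neg, Complex.conj_conj]
      congr 1
      simp only [bW, map_mul, Complex.conj_ofReal, abs_neg]
      congr 1
      simp only [hF3, hF2, Set.indicator, Set.mem_Ioi, Set.mem_Iic, neg_neg]
      rcases lt_or_gt_of_ne hξ with h | h
      · rw [if_pos (by linarith), if_pos h.le]; simp
      · rw [if_neg (by linarith), if_neg (by linarith)]; simp
    simp_rw [e2]
    rw [← bB_left _ _ _ hi1 hg.integrable, ← bB_left _ _ _ hi2 hg.integrable, ← bB_left _ _ _ hFi hg.integrable]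
    unfold bB
    rw [← integral_add (bB_int α _ g hi1 hg.integrable) (bB_int α _ g hi2 hg.integrable)]
    congr 1; ext w
    have : bW (α*(1-Z)) F w.2 = bW (α*(1-Z)) F1 w.2 + bW (α*(1-Z)) F2 w.2 := by
      simp only [bW, hF1, hF2, Set.indicator, Set.mem_Ioi, Set.mem_Iic]
      rcases le_or_gt w.2 0 with h | h
      · rw [if_neg (by linarith), if_pos h]; simp
      · rw [if_pos h, if_neg (by linarith)]; simp
    rw [this]; ring
  rw [key]
  refine (norm_add_le _ _).trans ?_
  rw [RCLike.norm_conj]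
  linarith

lemma bo_lim (q : ℝ≥0∞) (Q : ℕ → ℝ) (hQ0 : ∀ k, 0 < Q k)
    (hQ : (q ≠ ⊤ ∧ ∀ k, Q k = q.toReal) ∨ (q = ⊤ ∧ Filter.Tendsto Q Filter.atTop Filter.atTop))
    (h : ℕ → ℝ → ℝ≥0∞) (hm : ∀ k, Measurable (h k)) (N : ℝ → ℝ≥0∞)
    (hN : ∀ᵐ x, N x ≤ Filter.liminf (fun k => h k x) Filter.atTop) :
    eLpNorm N q volume ≤ Filter.liminf (fun k => (∫⁻ x, h k x ^ Q k) ^ (1 / Q k)) Filter.atTop := by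
  have hlr : ∀ (a : ℕ → ℝ≥0∞) (s : ℝ), 0 < s → (Filter.liminf a Filter.atTop) ^ s = Filter.liminf (fun k => a k ^ s) Filter.atTop := by
    intro a s hs
    exact Monotone.map_liminf_of_continuousAt (f := fun x : ℝ≥0∞ => x ^ s) (ENNReal.monotone_rpow_of_nonneg hs.le) a 
      ENNReal.continuous_rpow_const.continuousAt
  rcases hQ with ⟨hqt, hQq⟩ | ⟨rfl, hQt⟩
  · have hqr : 0 < q.toReal := by rw [← hQq 0]; exact hQ0 0
    have hq0 : q ≠ 0 := by rintro rfl; simp at hqr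
    rw [eLpNorm_eq_lintegral_rpow_enorm_toReal hq0 hqt]
    simp_rw [hQq]
    rw [← hlr _ _ (by positivity)]
    refine ENNReal.rpow_le_rpow ?_ (by positivity)
    refine le_trans (lintegral_mono_ae ?_) (lintegral_liminf_le (fun k => (hm k).pow_const _))
    filter_upwards [hN] with x hx
    rw [← hlr _ _ hqr]
    exact ENNReal.rpow_le_rpow hx hqr.le
  · rw [eLpNorm_exponent_top]
    refine le_of_forall_lt_imp_le_of_dense fun l hl => ?_
    set A : ℕ → Set ℝ := fun k => {x | |x| ≤ k ∧ ∀ n, k ≤ n → l ≤ h n x} with hA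
    have hex : ∃ k, volume (A k) ≠ 0 := by
      by_contra hcon
      push Not at hcon
      have h0 := measure_iUnion_null hcon
      refine absurd hl (not_lt.2 (essSup_le_of_ae_le l ?_))
      have h0' : ∀ᵐ x, x ∉ ⋃ k, A k := measure_eq_zero_iff_ae_notMem.1 h0
      filter_upwards [hN, h0'] with x hx hx'
      show N x ≤ l
      by_contra hlt
      apply hx'
      have hlt' : l < Filter.liminf (fun k => h k x) Filter.atTop := (not_le.1 hlt).trans_le hx
      have ev := Filter.eventually_lt_of_lt_liminf hlt'
      obtain ⟨n0, hn0⟩ := Filter.eventually_atTop.1 ev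
      obtain ⟨n1, hn1⟩ := exists_nat_ge |x|
      refine Set.mem_iUnion.2 ⟨max n0 n1, hn1.trans (by exact_mod_cast le_max_right _ _), fun n hn => 
        (hn0 n ((le_max_left _ _).trans hn)).le⟩
    obtain ⟨k, hk⟩ := hex
    set m := volume (A k) with hmd
    have hmt : m ≠ ⊤ := by
      have : m ≤ volume (Set.Icc (-(k:ℝ)) k) := measure_mono fun x hx => abs_le.1 hx.1
      exact (this.trans_lt (by simp)).ne
    have hlim : Filter.Tendsto (fun n => l * m ^ (1 / Q n)) Filter.atTop (nhds l) := by
      have e : ∀ n, m ^ (1 / Q n) = ENNReal.ofReal (m.toReal ^ (1 / Q n)) := by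
        intro n
        rw [← ENNReal.ofReal_rpow_of_pos (ENNReal.toReal_pos hk hmt), ENNReal.ofReal_toReal hmt]
      simp_rw [e]
      have h1 : Filter.Tendsto (fun n => m.toReal ^ (1 / Q n)) Filter.atTop (nhds 1) := by
        have : Filter.Tendsto (fun n => 1 / Q n) Filter.atTop (nhds 0) := by
          simp_rw [one_div]; exact tendsto_inv_atTop_zero.comp hQt
        have := (Real.continuousAt_const_rpow (a := m.toReal) (b := 0) (ENNReal.toReal_pos hk hmt).ne').tendsto.comp this
        simpa [Function.comp_def] using this
      have h2 := ENNReal.tendsto_ofReal h1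
      rw [ENNReal.ofReal_one] at h2
      have := ENNReal.Tendsto.const_mul (a := l) h2 (Or.inl one_ne_zero)
      simpa using this
    rw [← hlim.liminf_eq]
    refine Filter.liminf_le_liminf ?_
    filter_upwards [Filter.eventually_ge_atTop k] with n hn
    have h1 : l ^ Q n * m ≤ ∫⁻ x, h n x ^ Q n := by
      have hsub : A k ⊆ {x | l ^ Q n ≤ h n x ^ Q n} := fun x hx => ENNReal.rpow_le_rpow (hx.2 n hn) (hQ0 n).le
      refine (mul_le_mul_right (measure_mono hsub) _).trans ?_
      exact mul_meas_ge_le_lintegral ((hm n).pow_const _) _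
    have h2 := ENNReal.rpow_le_rpow h1 (one_div_pos.2 (hQ0 n)).le
    rw [ENNReal.mul_rpow_of_nonneg _ _ (one_div_pos.2 (hQ0 n)).le, ← ENNReal.rpow_mul, mul_one_div_cancel (hQ0 n).ne', ENNReal.rpow_one] at h2
    exact h2

lemma bo_holder (S : Set ℝ) (h : ℝ → ℝ≥0∞) (hm : Measurable h) (h0 : ∀ x, x ∉ S → h x = 0) (s : ℝ) (hs0 : 0 < s) (hs1 : s ≤ 1) :
    ∫⁻ x, h x ^ s ≤ (∫⁻ x, h x) ^ s * volume S ^ (1 - s) := by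
  have := ENNReal.lintegral_mul_norm_pow_le (μ := volume.restrict S) (f := h) (g := fun _ => 1) hm.aemeasurable aemeasurable_const hs0.le (sub_nonneg.2 hs1) (by ring)
  simp only [ENNReal.one_rpow, mul_one, lintegral_const, Measure.restrict_apply_univ, one_mul] at this
  rwa [setLIntegral_eq_of_support_subset, setLIntegral_eq_of_support_subset] at this
  · intro x hx; by_contra hc; exact hx (h0 x hc)
  · intro x hx; by_contra hc; apply hx; simp [h0 x hc, hs0]

/-- Truncation set used in the duality argument. -/
def bT (u : ℝ × ℝ → ℂ) (R ε : ℝ) : Set (ℝ × ℝ) :=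
  {z | |z.1| ≤ R ∧ |z.2| ≤ R ∧ ε ≤ ‖u z‖ ∧ ENNReal.ofReal ε ≤ volume {x : ℝ | |x| ≤ R ∧ ε ≤ ‖u (z.1, x)‖}}

lemma bT_meas (u : ℝ × ℝ → ℂ) (hu : Measurable u) (R ε : ℝ) : MeasurableSet (bT u R ε) := by
  have h1 : MeasurableSet {z : ℝ × ℝ | |z.2| ≤ R ∧ ε ≤ ‖u z‖} := by
    have a : MeasurableSet {z : ℝ × ℝ | |z.2| ≤ R} := measurableSet_le (by fun_prop) measurable_const
    have b : MeasurableSet {z : ℝ × ℝ | ε ≤ ‖u z‖} := measurableSet_le measurable_const hu.norm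
    exact a.inter b
  have h2 : Measurable (fun t : ℝ => volume {x : ℝ | |x| ≤ R ∧ ε ≤ ‖u (t, x)‖}) := measurable_measure_prodMk_left h1
  have h3 : MeasurableSet {z : ℝ × ℝ | ENNReal.ofReal ε ≤ volume {x : ℝ | |x| ≤ R ∧ ε ≤ ‖u (z.1, x)‖}} :=
    measurableSet_le measurable_const (h2.comp measurable_fst)
  have h4 : MeasurableSet {z : ℝ × ℝ | |z.1| ≤ R} := measurableSet_le (by fun_prop) measurable_const
  convert (h4.inter h1).inter h3 using 1
  ext z; simp only [bT, Set.mem_ofPred_eq, Set.mem_inter_iff]; tauto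

lemma bT_good (u : ℝ × ℝ → ℂ) (hu : Measurable u) (R ε B : ℝ) (hε : 0 < ε) (hB : ∀ z, ‖u z‖ ≤ B) :
    ∃ M, 1 ≤ M ∧ goodG M ((bT u R ε).indicator u) := by
  refine ⟨1 + |R| + |B| + ε⁻¹, by have := inv_pos.2 hε; linarith [abs_nonneg R, abs_nonneg B], hu.indicator (bT_meas u hu R ε), fun z hz => ?_⟩
  have hz' : z ∈ bT u R ε := Set.mem_of_indicator_ne_zero hz
  have hi := inv_pos.2 hε
  have hM : (1 + |R| + |B| + ε⁻¹)⁻¹ ≤ ε := inv_le_of_inv_le₀ hε (by linarith [abs_nonneg R, abs_nonneg B])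
  obtain ⟨a1, a2, a3, a4⟩ := id hz'
  have e : {x : ℝ | (bT u R ε).indicator u (z.1, x) ≠ 0} = {x : ℝ | |x| ≤ R ∧ ε ≤ ‖u (z.1, x)‖} := by
    ext x
    simp only [Set.mem_ofPred_eq, Set.indicator_apply_ne_zero, Set.mem_inter_iff, Function.mem_support]
    constructor
    · rintro ⟨⟨_, b2, b3, _⟩, _⟩; exact ⟨b2, b3⟩
    · rintro ⟨b2, b3⟩
      exact ⟨⟨a1, b2, b3, a4⟩, norm_pos_iff.1 (hε.trans_le b3)⟩
  rw [Set.indicator_of_mem hz', e]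
  refine ⟨?_, ?_, hM.trans a3, ?_, (ENNReal.ofReal_le_ofReal hM).trans a4⟩
  · linarith [abs_nonneg B, le_abs_self R]
  · linarith [abs_nonneg B, le_abs_self R]
  · linarith [abs_nonneg R, le_abs_self B, hB z]

set_option maxHeartbeats 2000000 in
lemma bo_dual (Y Z P Q D B R ε : ℝ) (u : ℝ × ℝ → ℂ) (hu : Measurable u) (hB : ∀ z, ‖u z‖ ≤ B) (hDp : 0 < D)
    (hD : ∀ M g b, 1 ≤ M → goodG M g → 0 < b → (∫⁻ t, (∫⁻ x, ‖g (t,x)‖ₑ^(1/Y))^(Y/Z)) ^ Z ≤ ENNReal.ofReal b →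
      ‖∫ z, g z * u z‖ ≤ D * b)
    (hP : 1 < P) (hQ : 1 < Q) (hY : 0 < Y) (hZ : 0 < Z) (hPY : 1 - 1 / P ≤ Y) (hQZ : 1 - 1 / Q ≤ Z) (hR : 0 < R) (hε : 0 < ε) :
    (∫⁻ t, (∫⁻ x, ‖(bT u R ε).indicator u (t, x)‖ₑ ^ P) ^ (Q / P)) ^ (1 / Q) ≤ 
      ENNReal.ofReal (D * (2 * R) ^ ((Y - (1 - 1 / P)) + (Z - (1 - 1 / Q)))) := by
  obtain ⟨M, hM, hv⟩ := bT_good u hu R ε B hε hB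
  set v := (bT u R ε).indicator u with hvd
  have hP0 : 0 < P := by linarith
  have hQ0 : 0 < Q := by linarith
  have hvm := hv.1
  have hM0 : 0 < M := by linarith
  obtain ⟨K, hK1, hKu, hKl⟩ := goodG.slice hM hv P hP0
  have hK0 : 0 < K := by linarith
  set Ie : ℝ → ℝ≥0∞ := fun t => ∫⁻ x, ‖v (t, x)‖ₑ ^ P with hIe
  have hIem : Measurable Ie := Measurable.lintegral_prod_right' (f := fun z : ℝ × ℝ => ‖v z‖ₑ ^ P) (by fun_prop)
  set J : ℝ → ℝ := fun t => (Ie t).toReal with hJ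
  have hJm : Measurable J := hIem.ennreal_toReal
  have hI : ∀ t, Ie t = ENNReal.ofReal (J t) := by
    intro t; rw [ENNReal.ofReal_toReal]; exact ((hKu t).trans_lt ENNReal.ofReal_lt_top).ne
  have hJK : ∀ z, v z ≠ 0 → K⁻¹ ≤ J z.1 ∧ J z.1 ≤ K := by
    intro z hz
    have a := hKl z hz
    have b : Ie z.1 ≤ _ := hKu z.1
    change _ ≤ Ie z.1 at a
    rw [hI] at a b
    exact ⟨(ENNReal.ofReal_le_ofReal_iff ENNReal.toReal_nonneg).1 a, (ENNReal.ofReal_le_ofReal_iff hK0.le).1 b⟩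
  have hJp : ∀ z, v z ≠ 0 → 0 < J z.1 := fun z hz => lt_of_lt_of_le (by positivity) (hJK z hz).1
  have hJ0 : ∀ t, 0 ≤ J t := fun t => ENNReal.toReal_nonneg
  set g : ℝ × ℝ → ℂ := fun z => (starRingEnd ℂ) (v z) * ((‖v z‖ ^ (P - 2) * J z.1 ^ ((Q - P) / P) : ℝ) : ℂ) with hg
  have hgm : Measurable g := by
    have : Measurable fun z => (starRingEnd ℂ) (v z) := continuous_star.measurable.comp hvm
    simp only [hg]; fun_prop
  have hg0 : ∀ z, v z = 0 → g z = 0 := by intro z h; simp [hg, h]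
  have hgn : ∀ z, v z ≠ 0 → ‖g z‖ = ‖v z‖ ^ (P - 1) * J z.1 ^ ((Q - P) / P) := by
    intro z h
    have h1 := norm_pos_iff.2 h
    have h2 := hJp z h
    simp only [hg]
    rw [norm_mul, RCLike.norm_conj, Complex.norm_real, Real.norm_of_nonneg (by positivity), ← mul_assoc]
    congr 1
    nth_rewrite 1 [← Real.rpow_one ‖v z‖]
    rw [← Real.rpow_add h1]; congr 1; ring
  have hg0' : ∀ z, g z ≠ 0 ↔ v z ≠ 0 := by
    intro z
    refine ⟨fun h h' => h (hg0 z h'), fun h => ?_⟩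
    rw [← norm_pos_iff, hgn z h]
    have h1 := norm_pos_iff.2 h
    have h2 := hJp z h
    positivity
  have hgG : ∃ N, 1 ≤ N ∧ goodG N g := by
    set M1 := M ^ |P - 1| with hM1
    set M2 := K ^ |(Q - P) / P| with hM2
    have h1 : 1 ≤ M1 := Real.one_le_rpow hM (abs_nonneg _)
    have h2 : 1 ≤ M2 := Real.one_le_rpow hK1 (abs_nonneg _)
    have h3 : M1 * M2 ≤ M * (M1 * M2) := by nlinarith [mul_pos (by linarith : 0 < M1) (by linarith : 0 < M2)]
    have h4 : M ≤ M * (M1 * M2) := by nlinarith [mul_nonneg (by linarith : 0 ≤ M1) (by linarith : 0 ≤ M2 - 1)]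
    have h12 : 0 < M1 * M2 := by positivity
    have h3' : (M * (M1 * M2))⁻¹ ≤ (M1 * M2)⁻¹ := inv_anti₀ h12 h3
    have h4' : (M * (M1 * M2))⁻¹ ≤ M⁻¹ := inv_anti₀ hM0 h4
    refine ⟨M * (M1 * M2), by linarith, hgm, fun z hz => ?_⟩
    have hz' := (hg0' z).1 hz
    obtain ⟨a1, a2, a3, a4, a5⟩ := hv.2 z hz'
    obtain ⟨b1, b2⟩ := bo_rpow_bounds hM a3 a4 (P - 1)
    obtain ⟨c1, c2⟩ := bo_rpow_bounds hK1 (hJK z hz').1 (hJK z hz').2 ((Q - P) / P)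
    have hJz := hJp z hz'
    rw [hgn z hz']
    refine ⟨a1.trans h4, a2.trans h4, h3'.trans ?_, le_trans ?_ h3, (ENNReal.ofReal_le_ofReal h4').trans (a5.trans (le_of_eq ?_))⟩
    · rw [mul_inv]; exact mul_le_mul b1 c1 (by positivity) (by positivity)
    · exact mul_le_mul b2 c2 (by positivity) (by positivity)
    · congr 1; ext x; exact (hg0' _).symm
  obtain ⟨N, hN1, hgG⟩ := hgG
  set A : ℝ≥0∞ := ∫⁻ t, Ie t ^ (Q / P) with hA
  -- pairing
  have hpair : ENNReal.ofReal ‖∫ z, g z * u z‖ = A := by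
    set w : ℝ × ℝ → ℝ := fun z => ‖v z‖ ^ P * J z.1 ^ (Q / P - 1) with hw
    have hw0 : ∀ z, 0 ≤ w z := fun z => mul_nonneg (by positivity) (Real.rpow_nonneg (hJ0 _) _)
    have e1 : ∀ z, g z * u z = (w z : ℂ) := by
      intro z
      by_cases hz : v z = 0
      · rw [hg0 z hz]; simp [hw, hz, hP0.ne']
      have hzu : v z = u z := Set.indicator_of_mem (Set.mem_of_indicator_ne_zero hz) _
      rw [← hzu]
      simp only [hg, hw]
      have h1 := norm_pos_iff.2 hz
      rw [mul_right_comm, ← Complex.normSq_eq_conj_mul_self, ← Complex.ofReal_mul, Complex.normSq_eq_norm_sq, ← mul_assoc, 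
        ← Real.rpow_natCast, ← Real.rpow_add h1]
      congr 2
      · congr 1; push_cast; ring
      · congr 1; field_simp
    simp_rw [e1]
    have hwi : Integrable w := by
      have : Integrable (fun z => g z * u z) := hgG.integrable.mul_bdd (c := B) hu.aestronglyMeasurable (Filter.Eventually.of_forall hB)
      simp_rw [e1] at this
      have := this.re
      simpa using this
    rw [integral_complex_ofReal, Complex.norm_real, Real.norm_of_nonneg (integral_nonneg hw0), 
      ofReal_integral_eq_lintegral_ofReal hwi (Filter.Eventually.of_forall hw0), Measure.volume_eq_prod, 
      lintegral_prod _ (by simp only [hw]; fun_prop)]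
    simp only [hA]
    congr 1; ext t
    by_cases hex : ∃ x, v (t, x) ≠ 0
    · obtain ⟨x0, hx0⟩ := hex
      have hJt : 0 < J t := hJp _ hx0
      have : ∀ x, ENNReal.ofReal (w (t, x)) = ‖v (t, x)‖ₑ ^ P * ENNReal.ofReal (J t ^ (Q / P - 1)) := by
        intro x
        simp only [hw]
        rw [ENNReal.ofReal_mul (by positivity), ← ENNReal.ofReal_rpow_of_nonneg (norm_nonneg _) hP0.le, ofReal_norm]
      simp_rw [this]
      rw [lintegral_mul_const _ (by fun_prop)]
      change Ie t * _ = _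
      rw [hI t, ← ENNReal.ofReal_mul hJt.le, ENNReal.ofReal_rpow_of_pos hJt]
      congr 1
      nth_rewrite 1 [← Real.rpow_one (J t)]
      rw [← Real.rpow_add hJt]; congr 1; ring
    · push Not at hex
      have z1 : Ie t = 0 := by simp [hIe, hex, hP0]
      rw [z1]
      have : 0 < Q / P := by positivity
      simp [hw, hex, hP0.ne', this]
  set Λ : ℝ≥0∞ := ENNReal.ofReal (2 * R) with hΛ
  have hΛ0 : Λ ≠ 0 := by simp [hΛ, hR]
  have hΛt : Λ ≠ ⊤ := ENNReal.ofReal_ne_top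
  have hvol : volume (Set.Icc (-R) R) = Λ := by rw [Real.volume_Icc, hΛ]; congr 1; ring
  set Y' := 1 - 1 / P with hY'
  set Z' := 1 - 1 / Q with hZ'
  have hY'0 : 0 < Y' := by rw [hY']; have : 1 / P < 1 := by rw [div_lt_one hP0]; exact hP
                           linarith
  have hZ'0 : 0 < Z' := by rw [hZ']; have : 1 / Q < 1 := by rw [div_lt_one hQ0]; exact hQ
                           linarith
  have hPY' : P * Y' = P - 1 := by rw [hY']; field_simp
  have hQZ' : Q * Z' = Q - 1 := by rw [hZ']; field_simp
  clear_value Y' Z' Λ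
  have hvbox : ∀ t x, ¬ (|t| ≤ R ∧ |x| ≤ R) → v (t, x) = 0 := by
    intro t x h
    apply Set.indicator_of_notMem
    rintro ⟨a, b, _⟩; exact h ⟨a, b⟩
  have hslice : ∀ t, (∫⁻ x, ‖g (t, x)‖ₑ ^ (1 / Y)) ^ (Y / Z) ≤ (Ie t ^ (Q / P)) ^ (Z' / Z) * Λ ^ ((Y - Y') / Z) := by
    intro t
    have hYZ : 0 < Y / Z := by positivity
    by_cases hex : ∃ x, v (t, x) ≠ 0
    · obtain ⟨x0, hx0⟩ := hex
      have hJt : 0 < J t := hJp _ hx0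
      have e : ∀ x, ‖g (t, x)‖ₑ ^ (1 / Y') = ENNReal.ofReal (J t ^ ((Q - P) / P * (1 / Y'))) * ‖v (t, x)‖ₑ ^ P := by
        intro x
        by_cases hz : v (t, x) = 0
        · rw [hg0 _ hz, hz]; simp [hY'0, hP0]
        rw [← ofReal_norm, hgn _ hz, ← ofReal_norm, ENNReal.ofReal_rpow_of_pos (by positivity), 
          ENNReal.ofReal_rpow_of_pos (by positivity), ← ENNReal.ofReal_mul (by positivity),
          Real.mul_rpow (by positivity) (by positivity), ← Real.rpow_mul (by positivity), ← Real.rpow_mul hJt.le, mul_comm]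
        have q1 : (P - 1) * (1 / Y') = P := by rw [← hPY']; field_simp
        rw [q1]
      have e2 : ∫⁻ x, ‖g (t, x)‖ₑ ^ (1 / Y') = Ie t ^ ((Q - 1) / (P * Y')) := by
        simp_rw [e]
        rw [lintegral_const_mul _ (by fun_prop)]
        change _ * Ie t = _
        rw [hI t, ← ENNReal.ofReal_mul (by positivity), ENNReal.ofReal_rpow_of_pos hJt]
        congr 1
        nth_rewrite 2 [← Real.rpow_one (J t)]
        rw [← Real.rpow_add hJt]
        congr 1
        field_simp
        linarith
      have hs0 : 0 < Y' / Y := by positivity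
      have hs1 : Y' / Y ≤ 1 := by rw [div_le_one hY]; exact hPY
      have hh := bo_holder (Set.Icc (-R) R) (fun x => ‖g (t, x)‖ₑ ^ (1 / Y')) (by fun_prop) (fun x hx => by
        have : v (t, x) = 0 := hvbox t x (fun h => hx (abs_le.1 h.2))
        rw [hg0 _ this]; simp [hY'0]) (Y' / Y) hs0 hs1
      rw [e2, hvol] at hh
      have e3 : ∀ x, (‖g (t, x)‖ₑ ^ (1 / Y')) ^ (Y' / Y) = ‖g (t, x)‖ₑ ^ (1 / Y) := by
        intro x; rw [← ENNReal.rpow_mul]; congr 1; field_simp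
      simp_rw [e3] at hh
      refine (ENNReal.rpow_le_rpow hh hYZ.le).trans (le_of_eq ?_)
      rw [ENNReal.mul_rpow_of_nonneg _ _ hYZ.le, ← ENNReal.rpow_mul, ← ENNReal.rpow_mul, ← ENNReal.rpow_mul, ← ENNReal.rpow_mul]
      congr 2
      · rw [← hQZ']; field_simp
      · field_simp
    · push Not at hex
      have : ∀ x, ‖g (t, x)‖ₑ ^ (1 / Y) = 0 := by
        intro x; rw [hg0 _ (hex x)]; simp [hY]
      simp_rw [this]
      simp [hYZ]
  have hng : (∫⁻ t, (∫⁻ x, ‖g (t, x)‖ₑ ^ (1 / Y)) ^ (Y / Z)) ^ Z ≤ A ^ Z' * Λ ^ ((Y - Y') + (Z - Z')) := by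
    have hs0 : 0 < Z' / Z := by positivity
    have hs1 : Z' / Z ≤ 1 := by rw [div_le_one hZ]; exact hQZ
    have hQP : 0 < Q / P := by positivity
    have h1 := lintegral_mono (μ := (volume : Measure ℝ)) hslice
    rw [lintegral_mul_const _ (by fun_prop)] at h1
    have hh := bo_holder (Set.Icc (-R) R) (fun t => Ie t ^ (Q / P)) (by fun_prop) (fun t ht => by
        have : ∀ x, v (t, x) = 0 := fun x => hvbox t x (fun h => ht (abs_le.1 h.1))
        simp [hIe, this, hP0, hQP]) (Z' / Z) hs0 hs1
    rw [hvol] at hh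
    have h2 := ENNReal.rpow_le_rpow (h1.trans (mul_le_mul_left hh _)) hZ.le
    refine h2.trans (le_of_eq ?_)
    rw [ENNReal.mul_rpow_of_nonneg _ _ hZ.le, ENNReal.mul_rpow_of_nonneg _ _ hZ.le, ← ENNReal.rpow_mul, ← ENNReal.rpow_mul, ← ENNReal.rpow_mul,
      mul_assoc, ← ENNReal.rpow_add _ _ hΛ0 hΛt]
    congr 2
    · field_simp
    · field_simp; ring
  have hAt : A ≠ ⊤ := by rw [← hpair]; exact ENNReal.ofReal_ne_top
  by_cases hA0 : A = 0
  · rw [hA0]; simp [hQ0]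
  have hAr : 0 < A.toReal := ENNReal.toReal_pos hA0 hAt
  have hAe : A = ENNReal.ofReal A.toReal := (ENNReal.ofReal_toReal hAt).symm
  set b := A.toReal ^ Z' * (2 * R) ^ ((Y - Y') + (Z - Z')) with hb
  have hbe : A ^ Z' * Λ ^ ((Y - Y') + (Z - Z')) = ENNReal.ofReal b := by
    rw [hb, ENNReal.ofReal_mul (by positivity), ← ENNReal.ofReal_rpow_of_pos hAr, ← ENNReal.ofReal_rpow_of_pos (by positivity), ← hAe, hΛ]
  rw [hbe] at hng
  have hfin := hD N g b hN1 hgG (by positivity) hng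
  have h3 : A.toReal ≤ D * b := by
    rw [← hpair, ENNReal.toReal_ofReal (norm_nonneg _)]; exact hfin
  rw [hAe, ENNReal.ofReal_rpow_of_pos hAr]
  apply ENNReal.ofReal_le_ofReal
  have h4 : A.toReal = A.toReal ^ (1 / Q) * A.toReal ^ Z' := by
    rw [← Real.rpow_add hAr, hZ']; simp
  have h5 : A.toReal ^ (1 / Q) * A.toReal ^ Z' ≤ (D * (2 * R) ^ ((Y - Y') + (Z - Z'))) * A.toReal ^ Z' := by
    rw [← h4]; refine h3.trans (le_of_eq ?_); rw [hb]; ring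
  exact le_of_mul_le_mul_right h5 (by positivity)

lemma bo_ft1_eq (φ : SchwartzMap ℝ ℂ) (ξ : ℝ) : ft1 (⇑φ) ξ = (FourierTransform.fourier φ : SchwartzMap ℝ ℂ) (ξ / (2 * Real.pi)) := by
  rw [SchwartzMap.fourier_coe, Real.fourier_real_eq_integral_exp_smul]
  unfold ft1
  congr 1; ext x
  rw [smul_eq_mul]
  congr 2
  have : (Real.pi : ℂ) ≠ 0 := by exact_mod_cast Real.pi_ne_zero
  push_cast
  field_simp

lemma bo_ft1_meas (φ : SchwartzMap ℝ ℂ) : Measurable (ft1 (⇑φ)) := by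
  have : ft1 (⇑φ) = fun ξ => (FourierTransform.fourier φ : SchwartzMap ℝ ℂ) (ξ / (2 * Real.pi)) := funext (bo_ft1_eq φ)
  rw [this]
  exact ((FourierTransform.fourier φ : SchwartzMap ℝ ℂ).continuous.comp (by fun_prop)).measurable

lemma bo_ft1_int (φ : SchwartzMap ℝ ℂ) (e : ℝ) (he0 : 0 ≤ e) (he1 : e ≤ 1) : Integrable (bW e (ft1 (⇑φ))) := by
  set G : SchwartzMap ℝ ℂ := FourierTransform.fourier φ with hG
  have hpi : 0 < 2 * Real.pi := by positivity
  have h0 : Integrable (fun ξ : ℝ => ‖ξ / (2 * Real.pi)‖ ^ 0 * ‖G (ξ / (2 * Real.pi))‖) := 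
    (G.integrable_pow_mul volume 0).comp_div hpi.ne'
  have h1 : Integrable (fun ξ : ℝ => ‖ξ / (2 * Real.pi)‖ ^ 1 * ‖G (ξ / (2 * Real.pi))‖) := 
    (G.integrable_pow_mul volume 1).comp_div hpi.ne'
  refine (h0.add (h1.const_mul (2 * Real.pi))).mono' (bW_meas e _ (bo_ft1_meas φ)).aestronglyMeasurable (Filter.Eventually.of_forall fun ξ => ?_)
  have hb : |ξ| ^ e ≤ 1 + |ξ| := by
    rcases le_total |ξ| 1 with h | h
    · exact (Real.rpow_le_one (abs_nonneg _) h he0).trans (by linarith [abs_nonneg ξ])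
    · refine (Real.rpow_le_rpow_of_exponent_le h he1).trans ?_
      rw [Real.rpow_one]; linarith
  simp only [bW, norm_mul, Complex.norm_real, bo_ft1_eq, Pi.add_apply, ← hG, pow_zero, pow_one, one_mul]
  rw [Real.norm_of_nonneg (by positivity : (0:ℝ) ≤ |ξ| ^ e), norm_div, Real.norm_of_nonneg hpi.le, Real.norm_eq_abs]
  calc _ ≤ (1 + |ξ|) * ‖G (ξ / (2 * Real.pi))‖ := mul_le_mul_of_nonneg_right hb (norm_nonneg _)
    _ = _ := by field_simp

lemma bo_exps (p : ℝ≥0∞) (Y : ℝ) (h : (p ≠ ⊤ ∧ 1 < p.toReal ∧ Y = 1 - 1 / p.toReal) ∨ (p = ⊤ ∧ Y = 1)) :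
    ∃ P : ℕ → ℝ, (∀ k, 1 < P k) ∧ ((p ≠ ⊤ ∧ ∀ k, P k = p.toReal) ∨ (p = ⊤ ∧ Filter.Tendsto P Filter.atTop Filter.atTop)) ∧ 
      (∀ k, 1 - 1 / P k ≤ Y) ∧ Filter.Tendsto (fun k : ℕ => (2 * ((k : ℝ) + 1)) ^ (Y - (1 - 1 / P k))) Filter.atTop (nhds 1) := by
  rcases h with ⟨hp, h1, hY⟩ | ⟨hp, hY⟩
  · refine ⟨fun _ => p.toReal, fun _ => h1, Or.inl ⟨hp, fun _ => rfl⟩, fun _ => hY.ge, ?_⟩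
    simp [hY]
  · have hL : Filter.Tendsto (fun k : ℕ => 2 * ((k : ℝ) + 1)) Filter.atTop Filter.atTop := 
      (Filter.tendsto_atTop_add_const_right _ _ tendsto_natCast_atTop_atTop).const_mul_atTop (by norm_num)
    refine ⟨fun k => 2 * ((k : ℝ) + 1), fun k => ?_, Or.inr ⟨hp, hL⟩, fun k => ?_, ?_⟩
    · have : (0:ℝ) ≤ k := Nat.cast_nonneg k
      linarith
    · rw [hY]
      have : (0:ℝ) ≤ 1 / (2 * ((k : ℝ) + 1)) := by positivity
      linarith
    · have := tendsto_rpow_div.comp hL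
      refine this.congr fun k => ?_
      simp [hY]

lemma bo_slice_lim (u : ℝ × ℝ → ℂ) (t : ℝ) :
    ∀ᵐ x : ℝ, ‖u (t, x)‖ₑ ≤ Filter.liminf (fun k : ℕ => ‖(bT u ((k : ℝ) + 1) (1 / ((k : ℝ) + 1))).indicator u (t, x)‖ₑ) Filter.atTop := by
  by_cases hex : ∃ n : ℕ, volume {x : ℝ | |x| ≤ (n : ℝ) + 1 ∧ 1 / ((n : ℝ) + 1) ≤ ‖u (t, x)‖} ≠ 0
  · obtain ⟨n, hn⟩ := hex
    refine Filter.Eventually.of_forall fun x => ?_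
    by_cases hx : u (t, x) = 0
    · simp [hx]
    have hx' := norm_pos_iff.2 hx
    have hε : Filter.Tendsto (fun k : ℕ => 1 / ((k : ℝ) + 1)) Filter.atTop (nhds 0) := tendsto_one_div_add_atTop_nhds_zero_nat
    have hε' : Filter.Tendsto (fun k : ℕ => ENNReal.ofReal (1 / ((k : ℝ) + 1))) Filter.atTop (nhds 0) := by
      simpa using ENNReal.tendsto_ofReal hε
    have hR : Filter.Tendsto (fun k : ℕ => (k : ℝ) + 1) Filter.atTop Filter.atTop := 
      Filter.tendsto_atTop_add_const_right _ _ tendsto_natCast_atTop_atTop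
    apply Filter.le_liminf_of_le
    · isBoundedDefault
    filter_upwards [hε.eventually (gt_mem_nhds hx'), hε'.eventually (gt_mem_nhds (pos_iff_ne_zero.2 hn)), 
      hR.eventually_ge_atTop |t|, hR.eventually_ge_atTop |x|, Filter.eventually_ge_atTop n] with k h1 h2 h3 h4 h5
    have h5' : (n : ℝ) ≤ k := by exact_mod_cast h5
    have hmem : (t, x) ∈ bT u ((k : ℝ) + 1) (1 / ((k : ℝ) + 1)) := by
      refine ⟨h3, h4, h1.le, h2.le.trans (measure_mono ?_)⟩
      rintro y ⟨y1, y2⟩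
      refine ⟨y1.trans (by linarith), le_trans ?_ y2⟩
      exact one_div_le_one_div_of_le (by positivity) (by linarith)
    rw [Set.indicator_of_mem hmem]
  · push Not at hex
    have h : ∀ᵐ x : ℝ, ∀ n : ℕ, ¬ (|x| ≤ (n : ℝ) + 1 ∧ 1 / ((n : ℝ) + 1) ≤ ‖u (t, x)‖) := by
      rw [ae_all_iff]
      intro n
      rw [ae_iff]
      simpa only [not_not] using hex n
    filter_upwards [h] with x hx
    have : u (t, x) = 0 := by
      by_contra h0
      have hx' := norm_pos_iff.2 h0
      obtain ⟨n1, h1⟩ := exists_nat_one_div_lt hx'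
      obtain ⟨n2, h2⟩ := exists_nat_ge |x|
      apply hx (max n1 n2)
      have e1 : (n1 : ℝ) ≤ (max n1 n2 : ℕ) := by exact_mod_cast le_max_left _ _
      have e2 : (n2 : ℝ) ≤ (max n1 n2 : ℕ) := by exact_mod_cast le_max_right _ _
      refine ⟨by linarith, le_trans ?_ h1.le⟩
      exact one_div_le_one_div_of_le (by positivity) (by linarith)
    simp [this]

lemma bo_max (p q : ℝ≥0∞) (Y Z D B : ℝ) (u : ℝ × ℝ → ℂ) (hu : Measurable u) (hB : ∀ z, ‖u z‖ ≤ B) (hDp : 0 < D)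
    (hD : ∀ M g b, 1 ≤ M → goodG M g → 0 < b → (∫⁻ t, (∫⁻ x, ‖g (t,x)‖ₑ^(1/Y))^(Y/Z)) ^ Z ≤ ENNReal.ofReal b →
      ‖∫ z, g z * u z‖ ≤ D * b)
    (hY : 0 < Y) (hZ : 0 < Z)
    (hp : (p ≠ ⊤ ∧ 1 < p.toReal ∧ Y = 1 - 1 / p.toReal) ∨ (p = ⊤ ∧ Y = 1))
    (hq : (q ≠ ⊤ ∧ 1 < q.toReal ∧ Z = 1 - 1 / q.toReal) ∨ (q = ⊤ ∧ Z = 1)) :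
    eLpNorm (fun t => eLpNorm (fun x => u (t, x)) p volume) q volume ≤ ENNReal.ofReal D := by
  obtain ⟨P, hP1, hPl, hPY, hPt⟩ := bo_exps p Y hp
  obtain ⟨Q, hQ1, hQl, hQZ, hQt⟩ := bo_exps q Z hq
  have hP0 : ∀ k, 0 < P k := fun k => by linarith [hP1 k]
  have hQ0 : ∀ k, 0 < Q k := fun k => by linarith [hQ1 k]
  set v : ℕ → ℝ × ℝ → ℂ := fun k => (bT u ((k : ℝ) + 1) (1 / ((k : ℝ) + 1))).indicator u with hv
  have hvm : ∀ k, Measurable (v k) := fun k => hu.indicator (bT_meas u hu _ _)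
  have hin : ∀ t, eLpNorm (fun x => u (t, x)) p volume ≤ 
      Filter.liminf (fun k => (∫⁻ x, ‖v k (t, x)‖ₑ ^ P k) ^ (1 / P k)) Filter.atTop := by
    intro t
    rw [← eLpNorm_enorm]
    refine bo_lim p P hP0 hPl (fun k x => ‖v k (t, x)‖ₑ) (fun k => ?_) _ (bo_slice_lim u t)
    have := hvm k
    fun_prop
  have hout := bo_lim q Q hQ0 hQl (fun k t => (∫⁻ x, ‖v k (t, x)‖ₑ ^ P k) ^ (1 / P k)) (fun k => by
    have := hvm k
    have : Measurable (fun t => ∫⁻ x, ‖v k (t, x)‖ₑ ^ P k) := 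
      Measurable.lintegral_prod_right' (f := fun z : ℝ × ℝ => ‖v k z‖ₑ ^ P k) (by fun_prop)
    fun_prop) _ (Filter.Eventually.of_forall hin)
  refine hout.trans ?_
  have hk : ∀ k : ℕ, (∫⁻ t, ((∫⁻ x, ‖v k (t, x)‖ₑ ^ P k) ^ (1 / P k)) ^ Q k) ^ (1 / Q k) ≤ 
      ENNReal.ofReal (D * ((2 * ((k : ℝ) + 1)) ^ (Y - (1 - 1 / P k)) * (2 * ((k : ℝ) + 1)) ^ (Z - (1 - 1 / Q k)))) := by
    intro k
    have h := bo_dual Y Z (P k) (Q k) D B ((k : ℝ) + 1) (1 / ((k : ℝ) + 1)) u hu hB hDp hD (hP1 k) (hQ1 k) hY hZ (hPY k) (hQZ k)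
      (by positivity) (by positivity)
    rw [Real.rpow_add (by positivity)] at h
    refine le_trans (le_of_eq ?_) h
    congr 2; ext t
    rw [← ENNReal.rpow_mul]; congr 1; ring
  have hlim : Filter.Tendsto (fun k : ℕ => ENNReal.ofReal (D * ((2 * ((k : ℝ) + 1)) ^ (Y - (1 - 1 / P k)) * (2 * ((k : ℝ) + 1)) ^ (Z - (1 - 1 / Q k)))))
      Filter.atTop (nhds (ENNReal.ofReal D)) := by
    apply ENNReal.tendsto_ofReal
    simpa using (hPt.mul hQt).const_mul D
  rw [← hlim.liminf_eq]
  exact Filter.liminf_le_liminf (Filter.Eventually.of_forall hk)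

lemma bo_inv (p : ℝ≥0∞) (h : p⁻¹.toReal < 1) (h' : p ≠ 0) : 
    (p ≠ ⊤ ∧ 1 < p.toReal ∧ 1 - p⁻¹.toReal = 1 - 1 / p.toReal) ∨ (p = ⊤ ∧ 1 - p⁻¹.toReal = 1) := by
  by_cases hp : p = ⊤
  · right; simp [hp]
  · left
    have h0 := ENNReal.toReal_pos h' hp
    rw [ENNReal.toReal_inv] at h ⊢
    refine ⟨hp, ?_, by rw [one_div]⟩
    exact (inv_lt_one₀ h0).1 h

lemma bo_cases (r r' q p : ℝ≥0∞) (hconj : 1 / r + 1 / r' = 1)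
    (hscal : 2 / q + 1 / p = 1 / r)
    (hcase : (4 ≤ q ∧ 4 < p) ∨ (1 / 4 ≤ 1 / p ∧ 1 / p + 1 / q < 1 / 2) ∨
      (q = ⊤ ∧ p = 2)) : 
    p ≠ 0 ∧ q ≠ 0 ∧ r'⁻¹.toReal = 1 - 2 * q⁻¹.toReal - p⁻¹.toReal ∧
      ((q⁻¹.toReal ≤ 1 / 4 ∧ p⁻¹.toReal < 1 / 4) ∨ (1 / 4 ≤ p⁻¹.toReal ∧ p⁻¹.toReal + q⁻¹.toReal < 1 / 2) ∨ (q⁻¹.toReal = 0 ∧ p⁻¹.toReal = 1 / 2)) := by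
  simp only [one_div, div_eq_mul_inv, one_mul] at *
  have hp0 : p ≠ 0 := by
    rintro rfl
    simp at hcase
  have hq0 : q ≠ 0 := by
    rintro rfl
    simp at hcase
  have hpt : p⁻¹ ≠ ⊤ := by simpa using hp0
  have hqt : q⁻¹ ≠ ⊤ := by simpa using hq0
  refine ⟨hp0, hq0, ?_, ?_⟩
  · have h1 : r⁻¹ ≠ ⊤ := fun h => by simp [h] at hconj
    have h2 : r'⁻¹ ≠ ⊤ := fun h => by simp [h] at hconj
    have e1 := congrArg ENNReal.toReal hconj
    have e2 := congrArg ENNReal.toReal hscal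
    rw [ENNReal.toReal_add h1 h2, ENNReal.toReal_one] at e1
    rw [ENNReal.toReal_add (ENNReal.mul_ne_top (by simp) hqt) hpt, ENNReal.toReal_mul, ENNReal.toReal_ofNat] at e2
    linarith
  · rcases hcase with ⟨h1, h2⟩ | ⟨h1, h2⟩ | ⟨h1, h2⟩
    · left
      have a1 : q⁻¹ ≤ 4⁻¹ := ENNReal.inv_le_inv.2 h1
      have a2 : p⁻¹ < 4⁻¹ := ENNReal.inv_lt_inv.2 h2
      have b1 := ENNReal.toReal_mono (by simp) a1
      have b2 := ENNReal.toReal_strict_mono (by simp) a2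
      rw [ENNReal.toReal_inv (4 : ℝ≥0∞), ENNReal.toReal_ofNat] at b1 b2
      exact ⟨b1, b2⟩
    · right; left
      have b1 := ENNReal.toReal_mono hpt h1
      have b2 := ENNReal.toReal_strict_mono (by simp) h2
      rw [ENNReal.toReal_inv (4 : ℝ≥0∞), ENNReal.toReal_ofNat] at b1
      rw [ENNReal.toReal_inv (2 : ℝ≥0∞), ENNReal.toReal_ofNat, ENNReal.toReal_add hpt hqt] at b2
      exact ⟨b1, b2⟩
    · right; right
      subst h1 h2
      simp

/-- Strichartz estimates for the free propagator (Lemma 2.2). -/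
theorem stmt0 (α : ℝ) (hα0 : 0 < α) (hα1 : α ≤ 1)
    (r r' q p : ℝ≥0∞) (hr : 1 ≤ r) (hconj : 1 / r + 1 / r' = 1)
    (hscal : 2 / q + 1 / p = 1 / r)
    (hcase : (4 ≤ q ∧ 4 < p) ∨ (1 / 4 ≤ 1 / p ∧ 1 / p + 1 / q < 1 / 2) ∨
      (q = ⊤ ∧ p = 2)) :
    ∃ C > (0 : ℝ), ∀ φ : SchwartzMap ℝ ℂ,
      mixedNorm q p (WpropD α (α / q.toReal) (⇑φ)) ≤
        ENNReal.ofReal C * eLpNorm (ft1 (⇑φ)) r' volume := by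
  obtain ⟨hp0, hq0, hX, hc⟩ := bo_cases r r' q p hconj hscal hcase
  set pi := p⁻¹.toReal with hpi
  set qi := q⁻¹.toReal with hqi
  have hpi0 : 0 ≤ pi := ENNReal.toReal_nonneg
  have hqi0 : 0 ≤ qi := ENNReal.toReal_nonneg
  have hpi1 : pi ≤ 1 / 2 := by rcases hc with h | h | h <;> linarith [h.1, h.2]
  have hqi1 : qi ≤ 1 / 4 := by rcases hc with h | h | h <;> linarith [h.1, h.2]
  have hX0 : 0 < 1 - 2 * qi - pi := by rcases hc with h | h | h <;> linarith [h.1, h.2]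
  have hbD : bD α (1 - pi) (1 - qi) := by
    apply bD_all α hα0 hα1 _ _ (by linarith) (by linarith)
    rcases hc with h | h | h
    · left; constructor <;> linarith [h.1, h.2]
    · right; left; constructor <;> linarith [h.1, h.2]
    · right; right; constructor <;> linarith [h.1, h.2]
  have hXe : (1 - pi) + 2 * (1 - qi) - 2 = 1 - 2 * qi - pi := by ring
  obtain ⟨C, hC0, hC⟩ := bo_full α (1 - pi) (1 - qi) (by linarith) (by linarith) (by linarith) hbD
  rw [hXe] at hC
  have hee : α / q.toReal = α * (1 - (1 - qi)) := by rw [hqi, ENNReal.toReal_inv]; ring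
  set e := α * (1 - (1 - qi)) with he
  have he0 : 0 ≤ e := by rw [he]; apply mul_nonneg <;> linarith
  have he1 : e ≤ 1 := by rw [he]; nlinarith
  refine ⟨C, hC0, fun φ => ?_⟩
  rw [hee]
  set F := ft1 (⇑φ) with hF
  have hFm : Measurable F := bo_ft1_meas φ
  have hFi : Integrable (bW e F) := bo_ft1_int φ e he0 he1
  set E := eLpNorm F r' volume with hE
  by_cases hEt : E = ⊤
  · rw [hEt, ENNReal.mul_top (by simpa using hC0)]; exact le_top
  have hr0 : r' ≠ 0 := by rintro rfl; simp at hconj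
  have hrt : r' ≠ ⊤ := by rintro rfl; simp at hX; linarith
  have hrX : r'.toReal = 1 / (1 - 2 * qi - pi) := by rw [← hX, ENNReal.toReal_inv]; simp
  have hEe : (∫⁻ ξ, ‖F ξ‖ₑ ^ (1 / (1 - 2 * qi - pi))) ^ (1 - 2 * qi - pi) = E := by
    rw [hE, eLpNorm_eq_lintegral_rpow_enorm_toReal hr0 hrt, hrX, one_div_one_div]
  set u : ℝ × ℝ → ℂ := fun z => ∫ ξ, bW e F ξ * bE α z ξ with hu
  have hum : Measurable u := bU_meas α _ (bW_meas e F hFm)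
  have huB : ∀ z, ‖u z‖ ≤ ∫ ξ, ‖bW e F ξ‖ := by
    intro z
    refine (norm_integral_le_integral_norm _).trans (le_of_eq ?_)
    simp only [norm_mul, bE_norm, mul_one]
  have hmain : ∀ δ : ℝ, 0 < δ → eLpNorm (fun t => eLpNorm (fun x => u (t, x)) p volume) q volume ≤ ENNReal.ofReal (C * (E.toReal + δ)) := by
    intro δ hδ
    have ha : 0 < E.toReal + δ := by linarith [ENNReal.toReal_nonneg (a := E)]
    refine bo_max p q (1 - pi) (1 - qi) _ _ u hum huB (by positivity) ?_ (by linarith) (by linarith) 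
      (bo_inv p (by linarith) hp0) (bo_inv q (by linarith) hq0)
    intro M g b hM hg hb hn
    refine hC M F g (E.toReal + δ) b hM hFm hFi hg ha hb ?_ hn
    rw [hEe]
    exact (ENNReal.ofReal_toReal hEt).symm.le.trans (ENNReal.ofReal_le_ofReal (by linarith))
  have hmain2 : eLpNorm (fun t => eLpNorm (fun x => u (t, x)) p volume) q volume ≤ ENNReal.ofReal C * E := by
    have hl : Filter.Tendsto (fun δ : ℝ => ENNReal.ofReal (C * (E.toReal + δ))) (nhdsWithin 0 (Set.Ioi 0)) (nhds (ENNReal.ofReal C * E)) := by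
      have : ENNReal.ofReal C * E = ENNReal.ofReal (C * (E.toReal + 0)) := by
        rw [add_zero, ENNReal.ofReal_mul hC0.le, ENNReal.ofReal_toReal hEt]
      rw [this]
      apply ENNReal.tendsto_ofReal
      apply Filter.Tendsto.mono_left _ nhdsWithin_le_nhds
      exact Continuous.tendsto (by fun_prop) 0
    exact ge_of_tendsto hl (Filter.eventually_of_mem self_mem_nhdsWithin hmain)
  refine le_trans ?_ hmain2
  unfold mixedNorm
  apply eLpNorm_mono_enorm
  intro t
  rw [Real.enorm_of_nonneg ENNReal.toReal_nonneg]
  refine ENNReal.ofReal_toReal_le.trans ?_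
  change _ ≤ eLpNorm (fun x => u (t, x)) p volume
  apply eLpNorm_mono
  intro x
  have : WpropD α e (⇑φ) t x = ((2 * Real.pi)⁻¹ : ℝ) * u (t, x) := by
    unfold WpropD
    rw [hu]
    congr 2; ext ξ
    simp only [bW, bE, ← hF]
    ring
  rw [this, norm_mul, Complex.norm_real, Real.norm_of_nonneg (by positivity)]
  have h1 : (2 * Real.pi)⁻¹ ≤ 1 := inv_le_one_of_one_le₀ (by linarith [Real.pi_gt_three])
  exact mul_le_of_le_one_left (norm_nonneg _) h1
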